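/- arXiv:2509.11463 — 4 statements merged into one kernel-verified Lean document; each statement's English description precedes it below -/
import Mathlib

section
/- Let G and G′ be finite subgroups of SU(2). Suppose that for every positive integer λ, Σ over pairs (p,q) with q ≥ 1 and 2q(p+1) = λ of dim_ℂ H_{p,q}^G equals Σ over the same pairs of dim_ℂ H_{p,q}^{G′}. Then G and G′ are isomorphic as groups. -/
noncomputable section

open MvPolynomial Matrix Complex Real Filter

/-- Variables: `Sum.inl i` is `z i`, `Sum.inr i` is `conj (z i)`. -/
abbrev Var (n : ℕ) := Fin n ⊕ Fin n

/-- Bidegree weight: `z`-variables have weight (1,0), `z̄`-variables weight (0,1). -/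
def bidegWt (n : ℕ) : Var n → ℕ × ℕ :=
  Sum.elim (fun _ => ((1 : ℕ), (0 : ℕ))) (fun _ => ((0 : ℕ), (1 : ℕ)))

/-- The Laplacian `∑ i, ∂²/∂zᵢ∂z̄ᵢ` on polynomials in `z, z̄`. -/
def kohnLap (n : ℕ) : MvPolynomial (Var n) ℂ →ₗ[ℂ] MvPolynomial (Var n) ℂ :=
  ∑ i : Fin n, ((pderiv (R := ℂ) (Sum.inl i)).toLinearMap.comp
    (pderiv (R := ℂ) (Sum.inr i)).toLinearMap)

/-- `H_{p,q}`: harmonic polynomials on ℂⁿ of bidegree `(p,q)`. -/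
def Hpq (n p q : ℕ) : Submodule ℂ (MvPolynomial (Var n) ℂ) :=
  (weightedHomogeneousSubmodule ℂ (bidegWt n) (p, q)) ⊓ (LinearMap.ker (kohnLap n))

/-- The action of a unitary matrix `g` on polynomials, `(g · f)(z) = f(g⁻¹ z)`:
substitution `zᵢ ↦ ∑ⱼ (g⁻¹)ᵢⱼ zⱼ`, `z̄ᵢ ↦ ∑ⱼ conj((g⁻¹)ᵢⱼ) z̄ⱼ`. -/
def uAct (n : ℕ) (g : Matrix.unitaryGroup (Fin n) ℂ) :
    MvPolynomial (Var n) ℂ →ₐ[ℂ] MvPolynomial (Var n) ℂ :=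
  aeval (Sum.elim
    (fun i => ∑ j : Fin n,
      MvPolynomial.C ((g⁻¹ : Matrix.unitaryGroup (Fin n) ℂ) i j) * X (Sum.inl j))
    (fun i => ∑ j : Fin n,
      MvPolynomial.C ((starRingEnd ℂ) ((g⁻¹ : Matrix.unitaryGroup (Fin n) ℂ) i j)) * X (Sum.inr j)))

/-- `H_{p,q}^S`: the subspace of `H_{p,q}` invariant under every element of `S`. -/
def HpqInv (n p q : ℕ) (S : Set (Matrix.unitaryGroup (Fin n) ℂ)) :
    Submodule ℂ (MvPolynomial (Var n) ℂ) :=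
  Hpq n p q ⊓ (⨅ g ∈ S, LinearMap.ker ((uAct n g).toLinearMap - LinearMap.id))

/-- `dim_ℂ H_{p,q}^S`. -/
def dimHpqInv (n p q : ℕ) (S : Set (Matrix.unitaryGroup (Fin n) ℂ)) : ℕ :=
  Module.finrank ℂ (HpqInv n p q S)

/-- A set of unitary matrices acts freely on the sphere iff no element other than
the identity has `1` as an eigenvalue. -/
def actsFreely {n : ℕ} (S : Set (Matrix.unitaryGroup (Fin n) ℂ)) : Prop :=
  ∀ g ∈ S, ((g : Matrix (Fin n) (Fin n) ℂ) - 1).det = 0 → g = 1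

/-- The multiplicity of `λ` in the spectrum of the Kohn Laplacian on `G\S³`:
the sum of `dim H_{p,q}^G` over pairs with `q ≥ 1` and `2q(p+1) = λ`. -/
def specMult (S : Set (Matrix.unitaryGroup (Fin 2) ℂ)) (lam : ℕ) : ℕ :=
  ∑ pq ∈ (Finset.range (lam + 1) ×ˢ Finset.range (lam + 1)).filter
      (fun pq => 1 ≤ pq.2 ∧ 2 * pq.2 * (pq.1 + 1) = lam),
    dimHpqInv 2 pq.1 pq.2 S

namespace KohnSpectrum

/-- The `SU(2)`-equivariant operator `z̄₂ ∂/∂z₁ - z̄₁ ∂/∂z₂`, of bidegree `(-1, 1)`. -/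
def lowerOp : Derivation ℂ (MvPolynomial (Var 2) ℂ) (MvPolynomial (Var 2) ℂ) :=
  (X (Sum.inr 1) : MvPolynomial (Var 2) ℂ) • pderiv (Sum.inl 0) -
    (X (Sum.inr 0) : MvPolynomial (Var 2) ℂ) • pderiv (Sum.inl 1)

/-- The `SU(2)`-equivariant operator `z₂ ∂/∂z̄₁ - z₁ ∂/∂z̄₂`, of bidegree `(1, -1)`. -/
def raiseOp : Derivation ℂ (MvPolynomial (Var 2) ℂ) (MvPolynomial (Var 2) ℂ) :=
  (X (Sum.inl 1) : MvPolynomial (Var 2) ℂ) • pderiv (Sum.inr 0) -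
    (X (Sum.inl 0) : MvPolynomial (Var 2) ℂ) • pderiv (Sum.inr 1)

theorem lowerOp_apply (f : MvPolynomial (Var 2) ℂ) :
    lowerOp f = X (Sum.inr 1) * pderiv (Sum.inl 0) f - X (Sum.inr 0) * pderiv (Sum.inl 1) f := rfl

theorem raiseOp_apply (f : MvPolynomial (Var 2) ℂ) :
    raiseOp f = X (Sum.inl 1) * pderiv (Sum.inr 0) f - X (Sum.inl 0) * pderiv (Sum.inr 1) f := rfl

theorem kohnLap_two_apply (f : MvPolynomial (Var 2) ℂ) :
    kohnLap 2 f = pderiv (Sum.inl 0) (pderiv (Sum.inr 0) f) +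
      pderiv (Sum.inl 1) (pderiv (Sum.inr 1) f) := by
  simp [kohnLap, Fin.sum_univ_two]

theorem pderiv_comm {σ : Type*} (i j : σ) (f : MvPolynomial σ ℂ) :
    pderiv i (pderiv j f) = pderiv j (pderiv i f) := by
  classical
  have h : ⁅pderiv (R := ℂ) i, pderiv (R := ℂ) j⁆ = 0 := by
    apply MvPolynomial.derivation_ext
    intro k
    rw [Derivation.commutator_apply]
    simp only [pderiv_X, Pi.single_apply]
    split_ifs <;> simp
  have := congrArg (fun D : Derivation ℂ (MvPolynomial σ ℂ) (MvPolynomial σ ℂ) => D f) h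
  simpa [Derivation.commutator_apply, sub_eq_zero] using this

theorem kohnLap_lowerOp (f : MvPolynomial (Var 2) ℂ) :
    kohnLap 2 (lowerOp f) = lowerOp (kohnLap 2 f) := by
  simp only [kohnLap_two_apply, lowerOp_apply, map_sub, map_add, Derivation.leibniz, smul_eq_mul,
    pderiv_X, Pi.single_apply, reduceCtorEq, Sum.inr.injEq]
  simp only [pderiv_comm (σ := Var 2) (Sum.inl 1) (Sum.inl 0),
    pderiv_comm (σ := Var 2) (Sum.inl _) (Sum.inr _)]
  simp
  ring

theorem kohnLap_raiseOp (f : MvPolynomial (Var 2) ℂ) :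
    kohnLap 2 (raiseOp f) = raiseOp (kohnLap 2 f) := by
  simp only [kohnLap_two_apply, raiseOp_apply, map_sub, map_add, Derivation.leibniz, smul_eq_mul,
    pderiv_X, Pi.single_apply, reduceCtorEq, Sum.inl.injEq]
  simp only [pderiv_comm (σ := Var 2) (Sum.inl _) (Sum.inr _),
    pderiv_comm (σ := Var 2) (Sum.inr 1) (Sum.inr 0)]
  simp
  ring

theorem IsWeightedHomogeneous.map_weight {σ M N : Type*} [AddCommMonoid M] [AddCommMonoid N]
    {w : σ → M} {m : M} {f : MvPolynomial σ ℂ} (h : IsWeightedHomogeneous w f m) (φ : M →+ N) :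
    IsWeightedHomogeneous (fun i => φ (w i)) f (φ m) := by
  intro d hd
  rw [← h hd, Finsupp.weight_apply, Finsupp.weight_apply, map_finsuppSum]
  simp

theorem euler_left {f : MvPolynomial (Var 2) ℂ} {p q : ℕ}
    (h : IsWeightedHomogeneous (bidegWt 2) f (p, q)) :
    X (Sum.inl 0) * pderiv (Sum.inl 0) f + X (Sum.inl 1) * pderiv (Sum.inl 1) f =
      (p : MvPolynomial (Var 2) ℂ) * f := by
  have := (IsWeightedHomogeneous.map_weight h (AddMonoidHom.fst ℕ ℕ)).sum_weight_X_mul_pderiv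
  simpa [bidegWt, Fintype.sum_sum_type, Fin.sum_univ_two] using this

theorem euler_right {f : MvPolynomial (Var 2) ℂ} {p q : ℕ}
    (h : IsWeightedHomogeneous (bidegWt 2) f (p, q)) :
    X (Sum.inr 0) * pderiv (Sum.inr 0) f + X (Sum.inr 1) * pderiv (Sum.inr 1) f =
      (q : MvPolynomial (Var 2) ℂ) * f := by
  have := (IsWeightedHomogeneous.map_weight h (AddMonoidHom.snd ℕ ℕ)).sum_weight_X_mul_pderiv
  simpa [bidegWt, Fintype.sum_sum_type, Fin.sum_univ_two] using this

theorem mem_Hpq {p q : ℕ} {f : MvPolynomial (Var 2) ℂ} :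
    f ∈ Hpq 2 p q ↔ IsWeightedHomogeneous (bidegWt 2) f (p, q) ∧ kohnLap 2 f = 0 := by
  rw [Hpq, Submodule.mem_inf, mem_weightedHomogeneousSubmodule, LinearMap.mem_ker]

theorem lowerOp_isWeightedHomogeneous {f : MvPolynomial (Var 2) ℂ} {p q : ℕ}
    (h : IsWeightedHomogeneous (bidegWt 2) f (p + 1, q)) :
    IsWeightedHomogeneous (bidegWt 2) (lowerOp f) (p, q + 1) := by
  rw [lowerOp_apply]
  have e : ((p, q + 1) : ℕ × ℕ) = (0, 1) + (p, q) := by ext <;> simp [add_comm]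
  rw [e]
  exact ((isWeightedHomogeneous_X ℂ (bidegWt 2) (Sum.inr 1)).mul (h.pderiv (by simp [bidegWt]))).sub
    ((isWeightedHomogeneous_X ℂ (bidegWt 2) (Sum.inr 0)).mul (h.pderiv (by simp [bidegWt])))

theorem raiseOp_isWeightedHomogeneous {f : MvPolynomial (Var 2) ℂ} {p q : ℕ}
    (h : IsWeightedHomogeneous (bidegWt 2) f (p, q + 1)) :
    IsWeightedHomogeneous (bidegWt 2) (raiseOp f) (p + 1, q) := by
  rw [raiseOp_apply]
  have e : ((p + 1, q) : ℕ × ℕ) = (1, 0) + (p, q) := by ext <;> simp [add_comm]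
  rw [e]
  exact ((isWeightedHomogeneous_X ℂ (bidegWt 2) (Sum.inl 1)).mul (h.pderiv (by simp [bidegWt]))).sub
    ((isWeightedHomogeneous_X ℂ (bidegWt 2) (Sum.inl 0)).mul (h.pderiv (by simp [bidegWt])))

theorem raiseOp_lowerOp {f : MvPolynomial (Var 2) ℂ} {p q : ℕ} (h : f ∈ Hpq 2 (p + 1) q) :
    raiseOp (lowerOp f) = (-((p + 1) * (q + 1)) : ℂ) • f := by
  obtain ⟨hf, hΔ⟩ := mem_Hpq.1 h
  have e₁ := euler_left hf
  have e₂ := euler_right hf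
  rw [kohnLap_two_apply] at hΔ
  have d₁ := congrArg (pderiv (Sum.inl 0)) e₂
  have d₂ := congrArg (pderiv (Sum.inl 1)) e₂
  simp only [lowerOp_apply, raiseOp_apply, map_sub, map_add, Derivation.leibniz, smul_eq_mul,
    pderiv_X, Pi.single_apply, reduceCtorEq, Sum.inr.injEq, if_false,
    Derivation.map_natCast, mul_zero, add_zero] at d₁ d₂ ⊢
  simp only [pderiv_comm (Sum.inl _) (Sum.inr _)] at *
  rw [smul_eq_C_mul]
  simp only [map_neg, map_mul, map_add, map_natCast, map_one]
  push_cast at *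
  simp only [mul_zero, mul_one]
  linear_combination (X (Sum.inl 1) * X (Sum.inr 1) + X (Sum.inl 0) * X (Sum.inr 0)) * hΔ -
    X (Sum.inl 0) * d₁ - X (Sum.inl 1) * d₂ - (q + 1) * e₁

theorem lowerOp_raiseOp {f : MvPolynomial (Var 2) ℂ} {p q : ℕ} (h : f ∈ Hpq 2 p (q + 1)) :
    lowerOp (raiseOp f) = (-((p + 1) * (q + 1)) : ℂ) • f := by
  obtain ⟨hf, hΔ⟩ := mem_Hpq.1 h
  have e₁ := euler_left hf
  have e₂ := euler_right hf
  rw [kohnLap_two_apply] at hΔ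
  have d₁ := congrArg (pderiv (Sum.inr 0)) e₁
  have d₂ := congrArg (pderiv (Sum.inr 1)) e₁
  simp only [lowerOp_apply, raiseOp_apply, map_sub, map_add, Derivation.leibniz, smul_eq_mul,
    pderiv_X, Pi.single_apply, reduceCtorEq, Sum.inl.injEq, if_false,
    Derivation.map_natCast, mul_zero, add_zero] at d₁ d₂ ⊢
  simp only [pderiv_comm (Sum.inl _) (Sum.inr _)] at *
  rw [smul_eq_C_mul]
  simp only [map_neg, map_mul, map_add, map_natCast, map_one]
  push_cast at *
  simp only [mul_zero, mul_one]
  linear_combination (X (Sum.inl 1) * X (Sum.inr 1) + X (Sum.inl 0) * X (Sum.inr 0)) * hΔ -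
    X (Sum.inr 0) * d₁ - X (Sum.inr 1) * d₂ - (p + 1) * e₂

theorem uAct_X_inl (g : unitaryGroup (Fin 2) ℂ) (i : Fin 2) :
    uAct 2 g (X (Sum.inl i)) = ∑ j, C ((g⁻¹ : unitaryGroup (Fin 2) ℂ) i j) * X (Sum.inl j) := by
  simp [uAct]

theorem uAct_X_inr (g : unitaryGroup (Fin 2) ℂ) (i : Fin 2) :
    uAct 2 g (X (Sum.inr i)) =
      ∑ j, C ((starRingEnd ℂ) ((g⁻¹ : unitaryGroup (Fin 2) ℂ) i j)) * X (Sum.inr j) := by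
  simp [uAct]

/-- An element of `SU(2)` has the form `(a, b; -b̄, ā)`. -/
theorem conj_entries {g : unitaryGroup (Fin 2) ℂ} (hg : det (g : Matrix (Fin 2) (Fin 2) ℂ) = 1) :
    (starRingEnd ℂ) (g 0 0) = g 1 1 ∧ (starRingEnd ℂ) (g 0 1) = - g 1 0 ∧
    (starRingEnd ℂ) (g 1 0) = - g 0 1 ∧ (starRingEnd ℂ) (g 1 1) = g 0 0 := by
  have h : star (g : Matrix (Fin 2) (Fin 2) ℂ) = adjugate (g : Matrix (Fin 2) (Fin 2) ℂ) := by
    have h₁ : star (g : Matrix (Fin 2) (Fin 2) ℂ) * g = 1 := (mem_unitaryGroup_iff').1 g.2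
    calc star (g : Matrix (Fin 2) (Fin 2) ℂ) = star (g : Matrix (Fin 2) (Fin 2) ℂ) *
          ((g : Matrix (Fin 2) (Fin 2) ℂ) * adjugate (g : Matrix (Fin 2) (Fin 2) ℂ)) := by
            rw [mul_adjugate, hg]; simp
      _ = _ := by rw [← mul_assoc, h₁, one_mul]
  rw [adjugate_fin_two] at h
  have e := fun i j => congrFun (congrFun h i) j
  refine ⟨by simpa [star_apply] using e 0 0, by simpa [star_apply] using e 1 0,
    by simpa [star_apply] using e 0 1, by simpa [star_apply] using e 1 1⟩

theorem lowerOp_uAct {g : unitaryGroup (Fin 2) ℂ} (hg : det (g : Matrix (Fin 2) (Fin 2) ℂ) = 1)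
    (f : MvPolynomial (Var 2) ℂ) : lowerOp (uAct 2 g f) = uAct 2 g (lowerOp f) := by
  obtain ⟨h₁, h₂, h₃, h₄⟩ := conj_entries hg
  induction f using MvPolynomial.induction_on with
  | C a => rw [← algebraMap_eq, AlgHom.commutes]; simp
  | add f₁ f₂ ih₁ ih₂ => simp only [map_add, ih₁, ih₂]
  | mul_X f i ih =>
    have hX : lowerOp (uAct 2 g (X i)) = uAct 2 g (lowerOp (X i)) := by
      obtain i | i := i
      · rw [uAct_X_inl]
        fin_cases i <;>
        simp [lowerOp_apply, pderiv_X, uAct_X_inr, Fin.sum_univ_two, h₁, h₂, h₃, h₄]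
          <;> ring
      · rw [uAct_X_inr]
        fin_cases i <;> simp [lowerOp_apply, pderiv_X, Fin.sum_univ_two]
    simp only [map_mul, Derivation.leibniz, ih, hX, map_add, smul_eq_mul]

theorem raiseOp_uAct {g : unitaryGroup (Fin 2) ℂ} (hg : det (g : Matrix (Fin 2) (Fin 2) ℂ) = 1)
    (f : MvPolynomial (Var 2) ℂ) : raiseOp (uAct 2 g f) = uAct 2 g (raiseOp f) := by
  obtain ⟨h₁, h₂, h₃, h₄⟩ := conj_entries hg
  induction f using MvPolynomial.induction_on with
  | C a => rw [← algebraMap_eq, AlgHom.commutes]; simp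
  | add f₁ f₂ ih₁ ih₂ => simp only [map_add, ih₁, ih₂]
  | mul_X f i ih =>
    have hX : raiseOp (uAct 2 g (X i)) = uAct 2 g (raiseOp (X i)) := by
      obtain i | i := i
      · rw [uAct_X_inl]
        fin_cases i <;> simp [raiseOp_apply, pderiv_X, Fin.sum_univ_two]
      · rw [uAct_X_inr]
        fin_cases i <;>
        simp [raiseOp_apply, pderiv_X, uAct_X_inl, Fin.sum_univ_two, h₁, h₂, h₃, h₄]
          <;> ring
    simp only [map_mul, Derivation.leibniz, ih, hX, map_add, smul_eq_mul]

theorem mem_HpqInv {p q : ℕ} {S : Set (unitaryGroup (Fin 2) ℂ)} {f : MvPolynomial (Var 2) ℂ} :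
    f ∈ HpqInv 2 p q S ↔ f ∈ Hpq 2 p q ∧ ∀ g ∈ S, uAct 2 g f = f := by
  simp [HpqInv, Submodule.mem_iInf, sub_eq_zero]

theorem lowerOp_mem_HpqInv {p q : ℕ} {S : Set (unitaryGroup (Fin 2) ℂ)}
    (hS : ∀ g ∈ S, det (g : Matrix (Fin 2) (Fin 2) ℂ) = 1) {f : MvPolynomial (Var 2) ℂ}
    (hf : f ∈ HpqInv 2 (p + 1) q S) : lowerOp f ∈ HpqInv 2 p (q + 1) S := by
  obtain ⟨hf, hi⟩ := mem_HpqInv.1 hf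
  obtain ⟨hf, hΔ⟩ := mem_Hpq.1 hf
  exact mem_HpqInv.2 ⟨mem_Hpq.2 ⟨lowerOp_isWeightedHomogeneous hf, by simp [kohnLap_lowerOp, hΔ]⟩,
    fun g hg => by rw [← lowerOp_uAct (hS g hg), hi g hg]⟩

theorem raiseOp_mem_HpqInv {p q : ℕ} {S : Set (unitaryGroup (Fin 2) ℂ)}
    (hS : ∀ g ∈ S, det (g : Matrix (Fin 2) (Fin 2) ℂ) = 1) {f : MvPolynomial (Var 2) ℂ}
    (hf : f ∈ HpqInv 2 p (q + 1) S) : raiseOp f ∈ HpqInv 2 (p + 1) q S := by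
  obtain ⟨hf, hi⟩ := mem_HpqInv.1 hf
  obtain ⟨hf, hΔ⟩ := mem_Hpq.1 hf
  exact mem_HpqInv.2 ⟨mem_Hpq.2 ⟨raiseOp_isWeightedHomogeneous hf, by simp [kohnLap_raiseOp, hΔ]⟩,
    fun g hg => by rw [← raiseOp_uAct (hS g hg), hi g hg]⟩

theorem dimHpqInv_succ_left {S : Set (unitaryGroup (Fin 2) ℂ)}
    (hS : ∀ g ∈ S, det (g : Matrix (Fin 2) (Fin 2) ℂ) = 1) (p q : ℕ) :
    dimHpqInv 2 (p + 1) q S = dimHpqInv 2 p (q + 1) S := by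
  have hc : (-((p + 1) * (q + 1)) : ℂ) ≠ 0 :=
    neg_ne_zero.2 (mul_ne_zero (Nat.cast_add_one_ne_zero p) (Nat.cast_add_one_ne_zero q))
  refine LinearEquiv.finrank_eq (LinearEquiv.ofBijective
    ((lowerOp : MvPolynomial (Var 2) ℂ →ₗ[ℂ] MvPolynomial (Var 2) ℂ).restrict
      (fun f hf => lowerOp_mem_HpqInv hS hf)) ⟨?_, ?_⟩)
  · rw [← LinearMap.ker_eq_bot, LinearMap.ker_eq_bot']
    rintro ⟨f, hf⟩ h
    have h₀ : lowerOp f = 0 := congrArg Subtype.val h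
    have h₁ := raiseOp_lowerOp (mem_HpqInv.1 hf).1
    rw [h₀, map_zero, eq_comm, smul_eq_zero] at h₁
    exact Subtype.ext (h₁.resolve_left hc)
  · rintro ⟨f, hf⟩
    refine ⟨⟨(-((p + 1) * (q + 1)) : ℂ)⁻¹ • raiseOp f,
      Submodule.smul_mem _ _ (raiseOp_mem_HpqInv hS hf)⟩, Subtype.ext ?_⟩
    change lowerOp ((-((p + 1) * (q + 1)) : ℂ)⁻¹ • raiseOp f) = f
    rw [Derivation.map_smul, lowerOp_raiseOp (mem_HpqInv.1 hf).1, smul_smul, inv_mul_cancel₀ hc,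
      one_smul]

theorem dimHpqInv_eq_zero_add {S : Set (unitaryGroup (Fin 2) ℂ)}
    (hS : ∀ g ∈ S, det (g : Matrix (Fin 2) (Fin 2) ℂ) = 1) (p q : ℕ) :
    dimHpqInv 2 p q S = dimHpqInv 2 0 (p + q) S := by
  induction p generalizing q with
  | zero => rw [zero_add]
  | succ p ih => rw [dimHpqInv_succ_left hS, ih]; congr 1; ring

end KohnSpectrum

namespace KohnSpectrum

theorem dimHpqInv_zero_eq_of_specMult_eq {S T : Set (unitaryGroup (Fin 2) ℂ)}
    (hS : ∀ g ∈ S, det (g : Matrix (Fin 2) (Fin 2) ℂ) = 1)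
    (hT : ∀ g ∈ T, det (g : Matrix (Fin 2) (Fin 2) ℂ) = 1)
    (hspec : ∀ lam : ℕ, 0 < lam → specMult S lam = specMult T lam) (m : ℕ) (hm : 0 < m) :
    dimHpqInv 2 0 m S = dimHpqInv 2 0 m T := by
  induction m using Nat.strong_induction_on with
  | _ m ih =>
  have h := hspec (2 * m) (by lia)
  have key : ∀ {U : Set (unitaryGroup (Fin 2) ℂ)},
      (∀ g ∈ U, det (g : Matrix (Fin 2) (Fin 2) ℂ) = 1) → specMult U (2 * m) =
        ∑ pq ∈ (Finset.range (2 * m + 1) ×ˢ Finset.range (2 * m + 1)).filter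
          (fun pq => 1 ≤ pq.2 ∧ 2 * pq.2 * (pq.1 + 1) = 2 * m), dimHpqInv 2 0 (pq.1 + pq.2) U :=
    fun hU => Finset.sum_congr rfl fun pq _ => dimHpqInv_eq_zero_add hU _ _
  rw [key hS, key hT] at h
  set A := (Finset.range (2 * m + 1) ×ˢ Finset.range (2 * m + 1)).filter
    (fun pq => 1 ≤ pq.2 ∧ 2 * pq.2 * (pq.1 + 1) = 2 * m) with hA
  rw [← Finset.sum_filter_add_sum_filter_not A (fun pq => pq.1 + pq.2 = m),
    ← Finset.sum_filter_add_sum_filter_not A (fun pq => pq.1 + pq.2 = m)] at h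
  have hlow : ∀ pq ∈ A.filter (fun pq => ¬ pq.1 + pq.2 = m),
      dimHpqInv 2 0 (pq.1 + pq.2) S = dimHpqInv 2 0 (pq.1 + pq.2) T := by
    rintro ⟨p, q⟩ hpq
    simp only [hA, Finset.mem_filter, Finset.mem_product, Finset.mem_range] at hpq
    obtain ⟨⟨-, hq, he⟩, hne⟩ := hpq
    refine ih _ (lt_of_le_of_ne ?_ hne) (by lia)
    nlinarith [Nat.mul_le_mul_right p hq]
  rw [Finset.sum_congr rfl hlow, Nat.add_right_cancel_iff] at h
  have htop : ∀ U : Set (unitaryGroup (Fin 2) ℂ),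
      ∑ pq ∈ A.filter (fun pq => pq.1 + pq.2 = m), dimHpqInv 2 0 (pq.1 + pq.2) U =
        (A.filter (fun pq => pq.1 + pq.2 = m)).card * dimHpqInv 2 0 m U := fun U => by
    rw [Finset.sum_congr rfl (g := fun _ => dimHpqInv 2 0 m U)
      (fun pq hpq => by rw [(Finset.mem_filter.1 hpq).2]), Finset.sum_const, smul_eq_mul]
  rw [htop, htop] at h
  refine Nat.eq_of_mul_eq_mul_left (Finset.card_pos.2 ⟨(0, m), ?_⟩) h
  simp only [hA, Finset.mem_filter, Finset.mem_product, Finset.mem_range]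
  lia

end KohnSpectrum

namespace KohnSpectrum

open scoped Quaternion

/-- The matrix of the quaternion `a + b i + c j + d k`. -/
def quatMatrix (q : ℍ[ℝ]) : Matrix (Fin 2) (Fin 2) ℂ :=
  !![⟨q.re, q.imI⟩, ⟨q.imJ, q.imK⟩; ⟨-q.imJ, q.imK⟩, ⟨q.re, -q.imI⟩]

theorem quatMatrix_one : quatMatrix 1 = 1 := by
  ext i j
  fin_cases i <;> fin_cases j <;> apply Complex.ext <;> simp [quatMatrix]

theorem quatMatrix_mul (p q : ℍ[ℝ]) : quatMatrix (p * q) = quatMatrix p * quatMatrix q := by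
  ext i j
  fin_cases i <;> fin_cases j <;> apply Complex.ext <;>
    simp [quatMatrix, Matrix.mul_apply, Fin.sum_univ_two] <;> ring

theorem quatMatrix_star (q : ℍ[ℝ]) : quatMatrix (star q) = star (quatMatrix q) := by
  ext i j
  fin_cases i <;> fin_cases j <;> apply Complex.ext <;>
    simp [quatMatrix, Matrix.star_apply]

/-- The embedding of the unit quaternions in the unitary group. -/
def quatHom : unitary ℍ[ℝ] →* unitaryGroup (Fin 2) ℂ where
  toFun q := ⟨quatMatrix q, by
    rw [mem_unitaryGroup_iff, ← quatMatrix_star, ← quatMatrix_mul, (Unitary.mem_iff.1 q.2).2, quatMatrix_one]⟩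
  map_one' := Subtype.ext quatMatrix_one
  map_mul' p q := Subtype.ext (quatMatrix_mul p q)

theorem coe_quatHom (q : unitary ℍ[ℝ]) :
    (quatHom q : Matrix (Fin 2) (Fin 2) ℂ) = quatMatrix q := rfl

theorem quatHom_injective : Function.Injective quatHom := fun p q h => by
  have h0 : quatMatrix p = quatMatrix q := congrArg Subtype.val h
  have h1 := congrFun (congrFun h0 0) 0
  have h2 := congrFun (congrFun h0 0) 1
  simp only [quatMatrix, of_apply, cons_val', cons_val_zero, cons_val_one, Complex.mk.injEq] at h1 h2
  exact Subtype.ext (QuaternionAlgebra.ext h1.1 h1.2 h2.1 h2.2)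

theorem mem_unitary_quaternion {q : ℍ[ℝ]} : q ∈ unitary ℍ[ℝ] ↔ Quaternion.normSq q = 1 := by
  rw [Unitary.mem_iff, Quaternion.star_mul_self, Quaternion.self_mul_star, and_self,
    ← Quaternion.coe_one, Quaternion.coe_inj]

theorem exists_quatHom_eq {g : unitaryGroup (Fin 2) ℂ}
    (hg : det (g : Matrix (Fin 2) (Fin 2) ℂ) = 1) : ∃ q, quatHom q = g := by
  obtain ⟨h1, h2, -, -⟩ := conj_entries hg
  have h3 : g 1 0 = -(starRingEnd ℂ) (g 0 1) := by rw [h2, neg_neg]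
  have hd := congrArg Complex.re hg
  rw [det_fin_two, ← h1, h3] at hd
  have hn : (g 0 0).re ^ 2 + (g 0 0).im ^ 2 + (g 0 1).re ^ 2 + (g 0 1).im ^ 2 = 1 := by
    simp at hd
    linarith
  refine ⟨⟨⟨(g 0 0).re, (g 0 0).im, (g 0 1).re, (g 0 1).im⟩,
    mem_unitary_quaternion.2 ((Quaternion.normSq_def' _).trans hn)⟩, ?_⟩
  ext i j
  fin_cases i <;> fin_cases j
  · simp [coe_quatHom, quatMatrix]
  · simp [coe_quatHom, quatMatrix]
  · simp [coe_quatHom, quatMatrix, h3, Complex.ext_iff]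
  · simp [coe_quatHom, quatMatrix, ← h1, Complex.ext_iff]

theorem nonempty_comap_quatHom_mulEquiv {G : Subgroup (unitaryGroup (Fin 2) ℂ)}
    (hG : ∀ g ∈ G, det (g : Matrix (Fin 2) (Fin 2) ℂ) = 1) :
    Nonempty (G.comap quatHom ≃* G) := by
  have h : (G.comap quatHom).map quatHom = G := by
    rw [Subgroup.map_comap_eq, inf_eq_right]
    exact fun g hg => exists_quatHom_eq (hG g hg)
  exact ⟨((G.comap quatHom).equivMapOfInjective quatHom quatHom_injective).trans
    (MulEquiv.subgroupCongr h)⟩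

end KohnSpectrum

namespace KohnSpectrum

theorem uAct_one (f : MvPolynomial (Var 2) ℂ) : uAct 2 1 f = f := by
  have h : uAct 2 1 = AlgHom.id ℂ _ := by
    apply MvPolynomial.algHom_ext
    rintro (i | i) <;> fin_cases i <;>
      simp [uAct_X_inl, uAct_X_inr, Fin.sum_univ_two]
  simp [h]

theorem uAct_mul (g h : unitaryGroup (Fin 2) ℂ) (f : MvPolynomial (Var 2) ℂ) :
    uAct 2 (g * h) f = uAct 2 g (uAct 2 h f) := by
  have h : uAct 2 (g * h) = (uAct 2 g).comp (uAct 2 h) := by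
    apply MvPolynomial.algHom_ext
    rintro (i | i) <;>
      simp only [uAct_X_inl, uAct_X_inr, Fin.sum_univ_two, AlgHom.comp_apply, map_add, map_mul,
        algHom_C, MvPolynomial.algebraMap_eq, _root_.mul_inv_rev, UnitaryGroup.mul_val, Matrix.mul_apply] <;>
      ring
  simp [h]

/-- The monomial `z̄₁ⁱ z̄₂ᵐ⁻ⁱ`. -/
def conjMonomial (m i : ℕ) : MvPolynomial (Var 2) ℂ := X (Sum.inr 0) ^ i * X (Sum.inr 1) ^ (m - i)

theorem conjMonomial_eq_monomial (m i : ℕ) : conjMonomial m i =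
    monomial (Finsupp.single (Sum.inr 0) i + Finsupp.single (Sum.inr 1) (m - i)) 1 := by
  rw [conjMonomial, X_pow_eq_monomial, X_pow_eq_monomial, monomial_mul, one_mul]

theorem conjMonomial_mem_Hpq {m i : ℕ} (hi : i ≤ m) : conjMonomial m i ∈ Hpq 2 0 m := by
  refine mem_Hpq.2 ⟨?_, ?_⟩
  · have h := ((isWeightedHomogeneous_X ℂ (bidegWt 2) (Sum.inr 0)).pow i).mul
      ((isWeightedHomogeneous_X ℂ (bidegWt 2) (Sum.inr 1)).pow (m - i))
    have e : i • bidegWt 2 (Sum.inr 0) + (m - i) • bidegWt 2 (Sum.inr 1) = (0, m) := by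
      simp [bidegWt]
      lia
    rwa [e] at h
  · rw [kohnLap_two_apply, pderiv_comm (Sum.inl 0), pderiv_comm (Sum.inl 1)]
    simp [conjMonomial, pderiv_X]

theorem linearIndependent_conjMonomial (m : ℕ) :
    LinearIndependent ℂ fun i : Fin (m + 1) => conjMonomial m i := by
  have h := (basisMonomials (Var 2) ℂ).linearIndependent.comp
    (fun i : Fin (m + 1) => Finsupp.single (Sum.inr 0 : Var 2) (i : ℕ) +
      Finsupp.single (Sum.inr 1) (m - i)) fun i j hij => by
        have := DFunLike.congr_fun hij (Sum.inr 0)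
        simpa [Fin.ext_iff] using this
  rw [coe_basisMonomials] at h
  have e : (fun i : Fin (m + 1) => conjMonomial m i) = (fun s => monomial s 1) ∘
      fun i : Fin (m + 1) => Finsupp.single (Sum.inr 0 : Var 2) (i : ℕ) +
        Finsupp.single (Sum.inr 1) (m - i) := funext fun i => conjMonomial_eq_monomial m i
  rw [e]
  exact h

theorem Hpq_zero_left (m : ℕ) :
    Hpq 2 0 m = Submodule.span ℂ (Set.range fun i : Fin (m + 1) => conjMonomial m i) := by
  refine le_antisymm (fun f hf => ?_) (Submodule.span_le.2 ?_)
  · have hf := (mem_Hpq.1 hf).1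
    rw [f.as_sum]
    refine Submodule.sum_mem _ fun d hd => ?_
    have hw := hf (mem_support_iff.1 hd)
    simp only [Finsupp.weight_apply, Finsupp.sum_fintype, Fintype.sum_sum_type, Fin.sum_univ_two,
      bidegWt, Sum.elim_inl, Sum.elim_inr, zero_smul, implies_true, Prod.smul_mk, smul_eq_mul,
      mul_one, mul_zero, Prod.mk_add_mk, Prod.mk.injEq, add_zero, zero_add] at hw
    obtain ⟨h0, h1⟩ := hw
    have : monomial d (coeff d f) = coeff d f • conjMonomial m (d (Sum.inr 0)) := by
      rw [conjMonomial_eq_monomial, smul_monomial, smul_eq_mul, mul_one]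
      refine congrArg (fun e => monomial e (coeff d f)) (Finsupp.ext ?_)
      rintro (i | i) <;> fin_cases i <;> simp <;> lia
    rw [this]
    exact Submodule.smul_mem _ _ (Submodule.subset_span ⟨⟨d (Sum.inr 0), by lia⟩, rfl⟩)
  · rintro _ ⟨i, rfl⟩
    exact conjMonomial_mem_Hpq (by lia)

theorem uAct_mem_Hpq (g : unitaryGroup (Fin 2) ℂ) {m : ℕ} {f : MvPolynomial (Var 2) ℂ}
    (hf : f ∈ Hpq 2 0 m) : uAct 2 g f ∈ Hpq 2 0 m := by
  suffices h : Hpq 2 0 m ≤ (Hpq 2 0 m).comap (uAct 2 g).toLinearMap from h hf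
  conv_lhs => rw [Hpq_zero_left]
  rw [Submodule.span_le]
  rintro _ ⟨i, rfl⟩
  have hX : ∀ j, IsWeightedHomogeneous (bidegWt 2) (uAct 2 g (X (Sum.inr j))) (0, 1) := fun j => by
    rw [uAct_X_inr]
    refine IsWeightedHomogeneous.sum _ _ _ fun k _ => ?_
    simpa [bidegWt] using (isWeightedHomogeneous_C (bidegWt 2) _).mul
      (isWeightedHomogeneous_X ℂ (bidegWt 2) (Sum.inr k))
  have hd : ∀ j k, pderiv (Sum.inl k) (uAct 2 g (X (Sum.inr j))) = 0 := fun j k => by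
    rw [uAct_X_inr]
    simp [pderiv_X]
  refine mem_Hpq.2 ⟨?_, ?_⟩
  · have h := ((hX 0).pow i).mul ((hX 1).pow (m - i))
    have e : (i : ℕ) • ((0, 1) : ℕ × ℕ) + (m - i) • ((0, 1) : ℕ × ℕ) = (0, m) := by
      simp
      lia
    rw [e] at h
    simpa [conjMonomial] using h
  · rw [kohnLap_two_apply, pderiv_comm (Sum.inl 0), pderiv_comm (Sum.inl 1)]
    simp [conjMonomial, hd]

/-- The representation of the unitary group on `H_{0,m}`. -/
def repHpq (m : ℕ) : Representation ℂ (unitaryGroup (Fin 2) ℂ) (Hpq 2 0 m) where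
  toFun g := (uAct 2 g).toLinearMap.restrict fun _ => uAct_mem_Hpq g
  map_one' := by
    exact LinearMap.ext fun f => Subtype.ext (uAct_one f)
  map_mul' g h := by
    exact LinearMap.ext fun f => Subtype.ext (uAct_mul g h f)

theorem coe_repHpq (m : ℕ) (g : unitaryGroup (Fin 2) ℂ) (f : Hpq 2 0 m) :
    (repHpq m g f : MvPolynomial (Var 2) ℂ) = uAct 2 g f := rfl

/-- The monomial basis of `H_{0,m}`. -/
def basisHpq (m : ℕ) : Module.Basis (Fin (m + 1)) ℂ (Hpq 2 0 m) :=
  (Module.Basis.span (linearIndependent_conjMonomial m)).map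
    (LinearEquiv.ofEq _ _ (Hpq_zero_left m).symm)

theorem coe_basisHpq (m : ℕ) (i : Fin (m + 1)) :
    (basisHpq m i : MvPolynomial (Var 2) ℂ) = conjMonomial m i := by
  simp [basisHpq, Module.Basis.span_apply]

instance (m : ℕ) : FiniteDimensional ℂ (Hpq 2 0 m) := (basisHpq m).finiteDimensional_of_finite

theorem finrank_invariants (m : ℕ) {H : Type*} [Group H] (φ : H →* unitaryGroup (Fin 2) ℂ) :
    Module.finrank ℂ (Representation.invariants ((repHpq m).comp φ)) =
      dimHpqInv 2 0 m (Set.range φ) := by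
  suffices e : (Representation.invariants ((repHpq m).comp φ)).map (Hpq 2 0 m).subtype =
      HpqInv 2 0 m (Set.range φ) by
    rw [dimHpqInv, ← e, Submodule.finrank_map_subtype_eq]
  ext f
  simp only [Submodule.mem_map, Representation.mem_invariants, mem_HpqInv, Set.forall_mem_range]
  constructor
  · rintro ⟨f, hf, rfl⟩
    exact ⟨f.2, fun g => congrArg Subtype.val (hf g)⟩
  · rintro ⟨hf, hi⟩
    exact ⟨⟨f, hf⟩, fun g => Subtype.ext (hi g), rfl⟩

end KohnSpectrum

namespace KohnSpectrum

open scoped Quaternion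

theorem exists_unit_conj_of_intertwine {h : ℍ[ℝ]} (hh : h ≠ 0) :
    ∃ q : unitary ℍ[ℝ], ∀ a b : unitary ℍ[ℝ], h * a = b * h → q * a * q⁻¹ = b := by
  have hn : ‖h‖ ≠ 0 := norm_ne_zero_iff.2 hh
  refine ⟨⟨‖h‖⁻¹ • h, mem_unitary_quaternion.2 ?_⟩, fun a b hab => ?_⟩
  · rw [Quaternion.normSq_smul, Quaternion.normSq_eq_norm_mul_self]
    field_simp
  · rw [mul_inv_eq_iff_eq_mul]
    apply Subtype.ext
    simp [hab]

/-- Two quaternions with the same real square `-n ≠ 0` are intertwined by a quaternion commuting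
with everything that commutes with `x` and anticommutes with both of them. -/
theorem exists_intertwine {w w' x : ℍ[ℝ]} {n : ℝ} (hw : w * w = -(n : ℍ[ℝ]))
    (hw' : w' * w' = -(n : ℍ[ℝ])) (hn : n ≠ 0) (hx : x * w ≠ w * x) :
    ∃ h : ℍ[ℝ], h ≠ 0 ∧ h * w = w' * h ∧
      ∀ u, u * x = x * u → u * w = -(w * u) → u * w' = -(w' * u) → u * h = h * u := by
  have hn' : (n : ℍ[ℝ]) ≠ 0 := by
    rwa [← Quaternion.coe_zero, Ne, Quaternion.coe_inj]
  have hc : ∀ y : ℍ[ℝ], y * n = n * y := fun y => (Quaternion.coe_commutes n y).symm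
  have key : ∀ y : ℍ[ℝ], (n * y - w' * y * w) * w = w' * (n * y - w' * y * w) := fun y => by
    have h1 : w' * y * w * w = -(n * (w' * y)) := by rw [mul_assoc, hw, mul_neg, hc]
    have h2 : w' * (w' * y * w) = -(n * (y * w)) := by
      rw [← mul_assoc, ← mul_assoc, hw', neg_mul, neg_mul, mul_assoc]
    rw [sub_mul, mul_sub, h1, h2, ← mul_assoc w', hc]
    noncomm_ring
  have comm : ∀ y u : ℍ[ℝ], u * y = y * u → u * w = -(w * u) → u * w' = -(w' * u) →
      u * (n * y - w' * y * w) = (n * y - w' * y * w) * u := fun y u h1 h2 h3 => by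
    have e1 : u * (w' * y * w) = w' * y * w * u := by
      calc u * (w' * y * w) = u * w' * y * w := by noncomm_ring
        _ = - (w' * (u * y) * w) := by rw [h3]; noncomm_ring
        _ = - (w' * y * (u * w)) := by rw [h1]; noncomm_ring
        _ = _ := by rw [h2]; noncomm_ring
    rw [mul_sub, e1, ← mul_assoc, hc, mul_assoc, h1]
    noncomm_ring
  by_cases h1 : (n * 1 - w' * 1 * w : ℍ[ℝ]) = 0
  · refine ⟨n * x - w' * x * w, fun h2 => hx ?_, key x, comm x⟩
    have e : w' = -w := by
      have : (n : ℍ[ℝ]) * (w' + w) = 0 := by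
        have := congrArg (· * w) h1
        simp only [mul_one, sub_mul, mul_assoc, hw, zero_mul, mul_neg, hc] at this
        rw [mul_add, ← this]
        noncomm_ring
      exact eq_neg_of_add_eq_zero_left ((mul_eq_zero.1 this).resolve_left hn')
    have h3 : w * (x * w) = w * (w * x) := by
      rw [e] at h2
      rw [neg_mul, neg_mul, sub_neg_eq_add, add_comm] at h2
      rw [← mul_assoc, ← mul_assoc, hw, neg_mul]
      exact eq_neg_of_add_eq_zero_left h2
    refine mul_left_cancel₀ (fun h0 => ?_) h3
    rw [h0, mul_zero, zero_eq_neg] at hw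
    exact hn' hw
  · exact ⟨_, h1, key 1, fun u _ => comm 1 u (by simp)⟩

theorem normSq_eq_one (q : unitary ℍ[ℝ]) : Quaternion.normSq (q : ℍ[ℝ]) = 1 :=
  mem_unitary_quaternion.1 q.2

theorem eq_coe_re_of_sq_eq_one {q : unitary ℍ[ℝ]} (h : (q : ℍ[ℝ]).re ^ 2 = 1) :
    (q : ℍ[ℝ]) = ((q : ℍ[ℝ]).re : ℍ[ℝ]) := by
  have h1 := normSq_eq_one q
  rw [Quaternion.normSq_def'] at h1
  ext
  · simp
  all_goals simp; nlinarith

theorem im_mul_im (q : unitary ℍ[ℝ]) : (q : ℍ[ℝ]).im * (q : ℍ[ℝ]).im =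
    -((1 - (q : ℍ[ℝ]).re ^ 2 : ℝ) : ℍ[ℝ]) := by
  have h1 := normSq_eq_one q
  rw [Quaternion.normSq_def'] at h1
  obtain ⟨t, ht⟩ : ∃ t, t = 1 - (q : ℍ[ℝ]).re ^ 2 := ⟨_, rfl⟩
  rw [← ht]
  ext <;> simp <;> linarith

theorem exists_not_commute_im {q : unitary ℍ[ℝ]} (h : (q : ℍ[ℝ]).re ^ 2 ≠ 1) :
    ∃ x : ℍ[ℝ], x * (q : ℍ[ℝ]).im ≠ (q : ℍ[ℝ]).im * x := by
  by_contra! hx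
  obtain ⟨i, hi⟩ : ∃ i : ℍ[ℝ], i.re = 0 ∧ i.imI = 1 ∧ i.imJ = 0 ∧ i.imK = 0 :=
    ⟨⟨0, 1, 0, 0⟩, rfl, rfl, rfl, rfl⟩
  obtain ⟨j, hj⟩ : ∃ j : ℍ[ℝ], j.re = 0 ∧ j.imI = 0 ∧ j.imJ = 1 ∧ j.imK = 0 :=
    ⟨⟨0, 0, 1, 0⟩, rfl, rfl, rfl, rfl⟩
  have h1 : (i * (q : ℍ[ℝ]).im).imK = ((q : ℍ[ℝ]).im * i).imK := by rw [hx]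
  have h2 : (i * (q : ℍ[ℝ]).im).imJ = ((q : ℍ[ℝ]).im * i).imJ := by rw [hx]
  have h3 : (j * (q : ℍ[ℝ]).im).imK = ((q : ℍ[ℝ]).im * j).imK := by rw [hx]
  have h4 := normSq_eq_one q
  rw [Quaternion.normSq_def'] at h4
  simp [hi, hj] at h1 h2 h3
  have e1 : (q : ℍ[ℝ]).imI = 0 := by linarith
  have e2 : (q : ℍ[ℝ]).imJ = 0 := by linarith
  have e3 : (q : ℍ[ℝ]).imK = 0 := by linarith
  rw [e1, e2, e3] at h4
  exact h (by linarith)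

theorem exists_conj_of_re_eq {a b : unitary ℍ[ℝ]} (h : (a : ℍ[ℝ]).re = (b : ℍ[ℝ]).re) :
    ∃ q : unitary ℍ[ℝ], q * a * q⁻¹ = b := by
  by_cases h1 : (a : ℍ[ℝ]).re ^ 2 = 1
  · refine ⟨1, ?_⟩
    have : a = b := Subtype.ext (by
      rw [eq_coe_re_of_sq_eq_one h1, h, ← eq_coe_re_of_sq_eq_one (h ▸ h1)])
    simp [this]
  · obtain ⟨x, hx⟩ := exists_not_commute_im h1
    obtain ⟨k, hk, hk1, -⟩ := exists_intertwine (im_mul_im a) (h ▸ im_mul_im b)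
      (sub_ne_zero.2 (Ne.symm h1)) hx
    obtain ⟨q, hq⟩ := exists_unit_conj_of_intertwine hk
    refine ⟨q, hq a b ?_⟩
    rw [← Quaternion.re_add_im (a : ℍ[ℝ]), ← Quaternion.re_add_im (b : ℍ[ℝ]), mul_add, add_mul,
      hk1, h, Quaternion.coe_commutes]

/-- The multiple `2|u|²` of the component of `b` orthogonal to `1` and to the imaginary `u`. -/
theorem orthComponent_mul_self {u b : ℍ[ℝ]} (hu : u.re = 0) :
    (Quaternion.normSq u * b + u * b * u) * (Quaternion.normSq u * b + u * b * u) =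
      -((4 * Quaternion.normSq u * (Quaternion.normSq u * (Quaternion.normSq b - b.re ^ 2) -
        (u * b).re ^ 2) : ℝ) : ℍ[ℝ]) := by
  obtain ⟨s, hs⟩ : ∃ s, s = Quaternion.normSq u := ⟨_, rfl⟩
  obtain ⟨t, ht⟩ : ∃ t, t = 4 * s * (s * (Quaternion.normSq b - b.re ^ 2) - (u * b).re ^ 2) :=
    ⟨_, rfl⟩
  rw [← hs, ← ht]
  rw [Quaternion.normSq_def', hu] at hs
  rw [Quaternion.normSq_def'] at ht
  simp [hu] at ht
  ext <;> simp [hu]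
  · rw [ht, hs]
    ring
  all_goals
    rw [hs]
    ring

theorem coe_normSq_mul_sub {u b : ℍ[ℝ]} (hu : u.re = 0) :
    Quaternion.normSq u * b - u * b * u =
      ((2 * Quaternion.normSq u * b.re : ℝ) : ℍ[ℝ]) - ((2 * (u * b).re : ℝ) : ℍ[ℝ]) * u := by
  obtain ⟨s, hs⟩ : ∃ s, s = Quaternion.normSq u := ⟨_, rfl⟩
  obtain ⟨t, ht⟩ : ∃ t, t = (u * b).re := ⟨_, rfl⟩
  rw [← hs, ← ht]
  rw [Quaternion.normSq_def', hu] at hs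
  simp [hu] at ht
  ext <;> simp [hu]
  · rw [hs]
    ring
  all_goals
    rw [ht, hs]
    ring

theorem mul_self_of_re_eq_zero {u : ℍ[ℝ]} (hu : u.re = 0) :
    u * u = -((Quaternion.normSq u : ℝ) : ℍ[ℝ]) := by
  obtain ⟨s, hs⟩ : ∃ s, s = Quaternion.normSq u := ⟨_, rfl⟩
  rw [← hs]
  rw [Quaternion.normSq_def', hu] at hs
  ext <;> simp [hu]
  · rw [hs]
    ring
  all_goals ring

theorem normSq_im (q : unitary ℍ[ℝ]) :
    Quaternion.normSq (q : ℍ[ℝ]).im = 1 - (q : ℍ[ℝ]).re ^ 2 := by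
  have h1 := normSq_eq_one q
  rw [Quaternion.normSq_def'] at h1 ⊢
  simp
  linarith

theorem im_mul_re (a b : ℍ[ℝ]) : (a.im * b).re = (a * b).re - a.re * b.re := by
  simp
  ring

theorem quaternion_two_ne_zero : (2 : ℍ[ℝ]) ≠ 0 := fun h => by
  have : ((2 : ℝ) : ℍ[ℝ]) = ((0 : ℝ) : ℍ[ℝ]) := by
    push_cast
    exact h
  exact two_ne_zero (Quaternion.coe_injective this)

theorem re_mul_comm (a b : unitary ℍ[ℝ]) :
    ((a * b : unitary ℍ[ℝ]) : ℍ[ℝ]).re = ((b * a : unitary ℍ[ℝ]) : ℍ[ℝ]).re := by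
  simp
  ring

theorem re_conj (p x : unitary ℍ[ℝ]) :
    ((p * x * p⁻¹ : unitary ℍ[ℝ]) : ℍ[ℝ]).re = (x : ℍ[ℝ]).re := by
  rw [re_mul_comm, inv_mul_cancel_left]

theorem exists_conj_of_commute_aux {a b b' : unitary ℍ[ℝ]} (hb : (b : ℍ[ℝ]).re = (b' : ℍ[ℝ]).re)
    (hab : ((a * b : unitary ℍ[ℝ]) : ℍ[ℝ]).re = ((a * b' : unitary ℍ[ℝ]) : ℍ[ℝ]).re)
    (hne : a * b ≠ b * a) : ∃ q : unitary ℍ[ℝ], q * a * q⁻¹ = a ∧ q * b * q⁻¹ = b' := by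
  set u := (a : ℍ[ℝ]).im with hu
  have hu0 : u.re = 0 := by simp [hu]
  have hau : (a : ℍ[ℝ]) = (a : ℍ[ℝ]).re + u := (Quaternion.re_add_im _).symm
  have hub : (u * b).re = (u * b').re := by
    rw [hu, im_mul_re, im_mul_re, hb]
    simpa using hab
  set s : ℍ[ℝ] := ((Quaternion.normSq u : ℝ) : ℍ[ℝ]) with hs
  have hsc : ∀ y : ℍ[ℝ], y * s = s * y := fun y => (Quaternion.coe_commutes _ y).symm
  have huu : u * u = -s := mul_self_of_re_eq_zero hu0
  have hcomm : u * b ≠ b * u := fun h => hne <| Subtype.ext <| by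
    rw [Submonoid.coe_mul, Submonoid.coe_mul, hau, mul_add, add_mul, h, Quaternion.coe_commutes]
  have hu' : u ≠ 0 := fun h => hcomm (by simp [h])
  have hs0 : s ≠ 0 := fun h => hu' (by simpa [h] using huu)
  have hanti : ∀ y : ℍ[ℝ], u * (s * y + u * y * u) = -((s * y + u * y * u) * u) := fun y => by
    have e1 : u * (u * y * u) = -(s * y * u) := by rw [← mul_assoc, ← mul_assoc, huu]; noncomm_ring
    have e2 : u * y * u * u = -(s * (u * y)) := by rw [mul_assoc, huu, mul_neg, hsc]
    rw [mul_add, add_mul, e1, e2, ← mul_assoc, hsc, mul_assoc]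
    noncomm_ring
  have hW := orthComponent_mul_self (b := b) hu0
  have hW' := orthComponent_mul_self (b := b') hu0
  rw [← hb, ← hub, normSq_eq_one, ← hs] at hW'
  rw [normSq_eq_one, ← hs] at hW
  have hW0 : s * b + u * b * u ≠ 0 := fun h => hcomm <| by
    have : s * (u * b - b * u) = 0 := by
      have h3 := congrArg (u * ·) h
      have e1 : u * (u * b * u) = -(s * b * u) := by
        rw [← mul_assoc, ← mul_assoc, huu]; noncomm_ring
      simp only [mul_add, e1, mul_zero] at h3
      rw [← mul_assoc, hsc] at h3
      rw [← h3]
      noncomm_ring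
    exact sub_eq_zero.1 ((mul_eq_zero.1 this).resolve_left hs0)
  obtain ⟨h, h0, h1, h2⟩ := exists_intertwine (x := u) hW hW' (fun h => hW0 (by
    rw [h, Quaternion.coe_zero, neg_zero] at hW
    exact mul_self_eq_zero.1 hW)) (fun h => by
      have h3 := hanti b
      rw [h, eq_neg_iff_add_eq_zero, ← two_mul] at h3
      exact mul_ne_zero quaternion_two_ne_zero (mul_ne_zero hW0 hu') h3)
  have hhu : u * h = h * u := h2 u rfl (hanti b) (hanti b')
  obtain ⟨q, hq⟩ := exists_unit_conj_of_intertwine h0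
  refine ⟨q, hq a a ?_, hq b b' ?_⟩
  · rw [hau, mul_add, add_mul, hhu, Quaternion.coe_commutes]
  · have e : ∀ y : unitary ℍ[ℝ], s * y * 2 = (s * y + u * y * u) +
      (((2 * Quaternion.normSq u * (y : ℍ[ℝ]).re : ℝ) : ℍ[ℝ]) -
        ((2 * (u * y).re : ℝ) : ℍ[ℝ]) * u) := fun y => by
      rw [← coe_normSq_mul_sub hu0]
      noncomm_ring
    have h5 : h * (s * b * 2) = s * b' * 2 * h := by
      rw [e, e, mul_add, add_mul, h1, ← hb, ← hub, mul_sub, sub_mul, ← Quaternion.coe_commutes,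
        ← mul_assoc h, ← Quaternion.coe_commutes, mul_assoc _ h u, mul_assoc _ u h, hhu]
    have h6 : s * (2 * (h * b - b' * h)) = 0 := by
      have e1 : h * (s * b * 2) = s * (h * b) * 2 := by rw [← mul_assoc, ← mul_assoc, hsc, mul_assoc s]
      have := sub_eq_zero.2 (e1.symm.trans h5)
      rw [← this]
      noncomm_ring
    exact sub_eq_zero.1 ((mul_eq_zero.1 ((mul_eq_zero.1 h6).resolve_left hs0)).resolve_left
      quaternion_two_ne_zero)

theorem exists_conj_pair {a b a' b' : unitary ℍ[ℝ]} (ha : (a : ℍ[ℝ]).re = (a' : ℍ[ℝ]).re)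
    (hb : (b : ℍ[ℝ]).re = (b' : ℍ[ℝ]).re)
    (hab : ((a * b : unitary ℍ[ℝ]) : ℍ[ℝ]).re = ((a' * b' : unitary ℍ[ℝ]) : ℍ[ℝ]).re)
    (hne : a * b ≠ b * a) : ∃ q : unitary ℍ[ℝ], q * a * q⁻¹ = a' ∧ q * b * q⁻¹ = b' := by
  obtain ⟨p, rfl⟩ := exists_conj_of_re_eq ha
  have e : ∀ x y : unitary ℍ[ℝ], p * x * p⁻¹ * (p * y * p⁻¹) = p * (x * y) * p⁻¹ := fun x y => by
    group
  obtain ⟨q, h1, h2⟩ := exists_conj_of_commute_aux (a := p * a * p⁻¹) (b := p * b * p⁻¹) (b' := b')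
    (by rw [re_conj, hb]) (by rw [← hab, e, re_conj])
    fun h => hne (by rwa [e, e, mul_left_inj, mul_right_inj] at h)
  exact ⟨q * p, by rw [← h1]; group, by rw [← h2]; group⟩

end KohnSpectrum

namespace KohnSpectrum

open scoped Quaternion

theorem uAct_quatHom_X_inr (q : unitary ℍ[ℝ]) (hJ : (q : ℍ[ℝ]).imJ = 0) (hK : (q : ℍ[ℝ]).imK = 0) :
    uAct 2 (quatHom q) (X (Sum.inr 0)) =
        C (⟨(q : ℍ[ℝ]).re, (q : ℍ[ℝ]).imI⟩ : ℂ) * X (Sum.inr 0) ∧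
      uAct 2 (quatHom q) (X (Sum.inr 1)) =
        C (⟨(q : ℍ[ℝ]).re, -(q : ℍ[ℝ]).imI⟩ : ℂ) * X (Sum.inr 1) := by
  have h : (((quatHom q)⁻¹ : unitaryGroup (Fin 2) ℂ) : Matrix (Fin 2) (Fin 2) ℂ) =
      quatMatrix (star (q : ℍ[ℝ])) := by rw [← map_inv]; rfl
  have e : ∀ i j, (starRingEnd ℂ) (quatMatrix (star (q : ℍ[ℝ])) i j) =
      !![(⟨(q : ℍ[ℝ]).re, (q : ℍ[ℝ]).imI⟩ : ℂ), 0; 0, ⟨(q : ℍ[ℝ]).re, -(q : ℍ[ℝ]).imI⟩] i j :=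
    fun i j => by
      fin_cases i <;> fin_cases j <;> apply Complex.ext <;> simp [quatMatrix, hJ, hK]
  constructor <;> rw [uAct_X_inr, Fin.sum_univ_two, h, e, e] <;> simp

theorem character_eq_sum (m : ℕ) (q : unitary ℍ[ℝ]) (hJ : (q : ℍ[ℝ]).imJ = 0)
    (hK : (q : ℍ[ℝ]).imK = 0) : Representation.character (repHpq m) (quatHom q) =
      ∑ i ∈ Finset.range (m + 1), (⟨(q : ℍ[ℝ]).re, (q : ℍ[ℝ]).imI⟩ : ℂ) ^ i *
        (⟨(q : ℍ[ℝ]).re, -(q : ℍ[ℝ]).imI⟩ : ℂ) ^ (m - i) := by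
  obtain ⟨h0, h1⟩ := uAct_quatHom_X_inr q hJ hK
  have hb : ∀ i : Fin (m + 1), repHpq m (quatHom q) (basisHpq m i) =
      ((⟨(q : ℍ[ℝ]).re, (q : ℍ[ℝ]).imI⟩ : ℂ) ^ (i : ℕ) *
        (⟨(q : ℍ[ℝ]).re, -(q : ℍ[ℝ]).imI⟩ : ℂ) ^ (m - i)) • basisHpq m i := fun i => by
    apply Subtype.ext
    rw [coe_repHpq, Submodule.coe_smul, coe_basisHpq, conjMonomial, map_mul, map_pow, map_pow,
      h0, h1, smul_eq_C_mul, C_mul, C_pow, C_pow]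
    ring
  rw [Representation.character, LinearMap.trace_eq_matrix_trace ℂ (basisHpq m), Matrix.trace,
    ← Fin.sum_univ_eq_sum_range]
  refine Finset.sum_congr rfl fun i _ => ?_
  rw [Matrix.diag_apply, LinearMap.toMatrix_apply, hb]
  simp

theorem sum_pow_mul_pow_eq_eval_U {z w : ℂ} {c : ℝ} (hzw : z * w = 1) (hc : z + w = 2 * c) (m : ℕ) :
    ∑ i ∈ Finset.range (m + 1), z ^ i * w ^ (m - i) =
      ((Polynomial.Chebyshev.U ℝ m).eval c : ℝ) := by
  have hrec : ∀ m : ℕ, ∑ i ∈ Finset.range (m + 2), z ^ i * w ^ (m + 1 - i) =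
      z ^ (m + 1) + w * ∑ i ∈ Finset.range (m + 1), z ^ i * w ^ (m - i) := fun m => by
    rw [Finset.sum_range_succ, Nat.sub_self, pow_zero, mul_one, add_comm, Finset.mul_sum]
    congr 1
    refine Finset.sum_congr rfl fun i hi => ?_
    rw [Nat.sub_add_comm (by have := Finset.mem_range.1 hi; lia), pow_succ]
    ring
  induction m using Nat.twoStepInduction with
  | zero => simp
  | one => simp [Finset.sum_range_succ, add_comm w, hc]
  | more m h0 h1 =>
    have hU := Polynomial.Chebyshev.U_add_two ℂ m
    have e1 := hrec m
    rw [hrec (m + 1)]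
    rw [h1, h0] at e1
    rw [h1]
    push_cast at e1 ⊢
    rw [hU]
    simp only [Polynomial.eval_sub, Polynomial.eval_mul, Polynomial.eval_X, Polynomial.eval_ofNat]
    linear_combination -z * e1 - ((Polynomial.Chebyshev.U ℂ m).eval (c : ℂ)) * hzw +
      ((Polynomial.Chebyshev.U ℂ (m + 1)).eval (c : ℂ)) * hc

theorem character_quatHom (m : ℕ) (q : unitary ℍ[ℝ]) :
    Representation.character (repHpq m) (quatHom q) =
      ((Polynomial.Chebyshev.U ℝ m).eval (q : ℍ[ℝ]).re : ℝ) := by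
  have hn := normSq_eq_one q
  rw [Quaternion.normSq_def'] at hn
  have hs : (q : ℍ[ℝ]).re ^ 2 + √(1 - (q : ℍ[ℝ]).re ^ 2) ^ 2 = 1 := by
    rw [Real.sq_sqrt (by nlinarith)]
    ring
  obtain ⟨d, hd⟩ : ∃ d : unitary ℍ[ℝ], (d : ℍ[ℝ]) = ⟨(q : ℍ[ℝ]).re, √(1 - (q : ℍ[ℝ]).re ^ 2), 0, 0⟩ :=
    ⟨⟨_, mem_unitary_quaternion.2 ((Quaternion.normSq_def' _).trans (by simpa using hs))⟩, rfl⟩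
  obtain ⟨p, rfl⟩ := exists_conj_of_re_eq (a := d) (b := q) (by rw [hd])
  rw [re_conj] at hd hs ⊢
  rw [map_mul, map_mul, map_inv, Representation.char_conj, character_eq_sum m d (by rw [hd]) (by rw [hd]),
    sum_pow_mul_pow_eq_eval_U (c := (d : ℍ[ℝ]).re)]
  · rw [hd]
    apply Complex.ext
    · simp
      linarith
    · simp
      ring
  · apply Complex.ext <;> simp
    ring

/-- The Molien-type formula for `dim H_{0,m}^G`. -/
theorem sum_eval_U_eq (m : ℕ) (H : Subgroup (unitary ℍ[ℝ])) [Fintype H] :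
    ∑ g : H, (Polynomial.Chebyshev.U ℝ m).eval ((g : unitary ℍ[ℝ]) : ℍ[ℝ]).re =
      Nat.card H * dimHpqInv 2 0 m (Set.range (quatHom.comp H.subtype)) := by
  have hN : (Nat.card H : ℂ) ≠ 0 := Nat.cast_ne_zero.2 Nat.card_pos.ne'
  have := invertibleOfNonzero hN
  have h := Representation.card_inv_mul_sum_char_eq_finrank
    ((repHpq m).comp (quatHom.comp H.subtype))
  rw [finrank_invariants, inv_mul_eq_iff_eq_mul₀ hN] at h
  have e : ∀ g : H, Representation.character ((repHpq m).comp (quatHom.comp H.subtype)) g =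
      (((Polynomial.Chebyshev.U ℝ m).eval ((g : unitary ℍ[ℝ]) : ℍ[ℝ]).re : ℝ) : ℂ) := fun g =>
    character_quatHom m g
  rw [Finset.sum_congr rfl fun g _ => e g] at h
  exact_mod_cast h

theorem linearMap_eq_zero_of_U (L : Polynomial ℝ →ₗ[ℝ] ℝ)
    (hL : ∀ m : ℕ, L (Polynomial.Chebyshev.U ℝ m) = 0) : L = 0 := by
  have h : ∀ k m : ℕ, L (Polynomial.X ^ k * Polynomial.Chebyshev.U ℝ m) = 0 := fun k => by
    induction k with
    | zero => simpa using hL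
    | succ k ih =>
      have h2 : ∀ P : Polynomial ℝ, L (2 * P) = 2 * L P := fun P => by
        rw [two_mul, map_add, two_mul]
      intro m
      rw [← mul_right_inj' (two_ne_zero : (2 : ℝ) ≠ 0), mul_zero, ← h2]
      rcases m with _ | m
      · have e := ih 1
        simp only [Nat.cast_one, Polynomial.Chebyshev.U_one] at e
        rw [← e]
        congr 1
        simp
        ring
      · have e := Polynomial.Chebyshev.U_add_two ℝ m
        have e' : 2 * (Polynomial.X ^ (k + 1) * Polynomial.Chebyshev.U ℝ (m + 1 : ℕ)) =
            Polynomial.X ^ k * Polynomial.Chebyshev.U ℝ (m + 2 : ℕ) +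
              Polynomial.X ^ k * Polynomial.Chebyshev.U ℝ m := by
          push_cast
          rw [e]
          ring
        rw [e', map_add, ih, ih, add_zero]
  apply Polynomial.lhom_ext'
  intro k
  apply LinearMap.ext_ring
  have := h k 0
  simpa [Polynomial.X_pow_eq_monomial] using this

theorem average_eq {H K : Subgroup (unitary ℍ[ℝ])} [Fintype H] [Fintype K]
    (h : ∀ m : ℕ, 0 < m → dimHpqInv 2 0 m (Set.range (quatHom.comp H.subtype)) =
      dimHpqInv 2 0 m (Set.range (quatHom.comp K.subtype))) (P : Polynomial ℝ) :
    (Nat.card K : ℝ) * ∑ g : H, P.eval ((g : unitary ℍ[ℝ]) : ℍ[ℝ]).re =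
      Nat.card H * ∑ g : K, P.eval ((g : unitary ℍ[ℝ]) : ℍ[ℝ]).re := by
  let L : Polynomial ℝ →ₗ[ℝ] ℝ :=
    (Nat.card K : ℝ) • ∑ g : H, Polynomial.leval ((g : unitary ℍ[ℝ]) : ℍ[ℝ]).re -
      (Nat.card H : ℝ) • ∑ g : K, Polynomial.leval ((g : unitary ℍ[ℝ]) : ℍ[ℝ]).re
  have hLP : ∀ P, L P = (Nat.card K : ℝ) * ∑ g : H, P.eval ((g : unitary ℍ[ℝ]) : ℍ[ℝ]).re -
      Nat.card H * ∑ g : K, P.eval ((g : unitary ℍ[ℝ]) : ℍ[ℝ]).re := fun P => by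
    simp [L, LinearMap.sum_apply]
  have hL : L = 0 := linearMap_eq_zero_of_U L fun m => by
    rw [hLP, sub_eq_zero]
    rcases m.eq_zero_or_pos with rfl | hm
    · simp [mul_comm]
    · rw [sum_eval_U_eq, sum_eval_U_eq, h m hm]
      ring
  rw [← sub_eq_zero, ← hLP, hL, LinearMap.zero_apply]

/-- The number of elements of `H` with real part `c`. -/
def reCount (H : Subgroup (unitary ℍ[ℝ])) (c : ℝ) : ℕ :=
  Nat.card {g : H // ((g : unitary ℍ[ℝ]) : ℍ[ℝ]).re = c}

theorem card_mul_reCount_eq {H K : Subgroup (unitary ℍ[ℝ])} [Finite H] [Finite K]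
    (h : ∀ m : ℕ, 0 < m → dimHpqInv 2 0 m (Set.range (quatHom.comp H.subtype)) =
      dimHpqInv 2 0 m (Set.range (quatHom.comp K.subtype))) (c : ℝ) :
    Nat.card K * reCount H c = Nat.card H * reCount K c := by
  classical
  have := Fintype.ofFinite H
  have := Fintype.ofFinite K
  let S : Finset ℝ := insert c (Finset.univ.image (fun g : H => ((g : unitary ℍ[ℝ]) : ℍ[ℝ]).re) ∪
    Finset.univ.image (fun g : K => ((g : unitary ℍ[ℝ]) : ℍ[ℝ]).re))
  have hP : ∀ x ∈ S, (Lagrange.basis S id c).eval x = if x = c then 1 else 0 := fun x hx => by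
    split_ifs with hxc
    · rw [hxc]
      exact Lagrange.eval_basis_self (v := id) Function.injective_id.injOn
        (Finset.mem_insert_self _ _)
    · exact Lagrange.eval_basis_of_ne (v := id) (Ne.symm hxc) hx
  have hH : ∀ H : Subgroup (unitary ℍ[ℝ]), ∀ _ : Fintype H,
      (∀ g : H, ((g : unitary ℍ[ℝ]) : ℍ[ℝ]).re ∈ S) →
      ∑ g : H, (Lagrange.basis S id c).eval ((g : unitary ℍ[ℝ]) : ℍ[ℝ]).re = reCount H c :=
    fun H _ hS => by
      rw [Finset.sum_congr rfl fun g _ => hP _ (hS g), Finset.sum_boole, reCount,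
        Nat.card_eq_fintype_card, Fintype.card_subtype]
  have e := average_eq h (Lagrange.basis S id c)
  rw [hH H _ fun g => by simp [S], hH K _ fun g => by simp [S]] at e
  exact_mod_cast e

theorem eq_one_of_re_eq_one {g : unitary ℍ[ℝ]} (h : (g : ℍ[ℝ]).re = 1) : g = 1 :=
  Subtype.ext <| by
    rw [eq_coe_re_of_sq_eq_one (by rw [h, one_pow]), h]
    rfl

theorem reCount_one (H : Subgroup (unitary ℍ[ℝ])) : reCount H 1 = 1 := by
  rw [reCount, Nat.card_eq_one_iff_unique]
  refine ⟨⟨fun a b => ?_⟩, ⟨⟨1, by simp⟩⟩⟩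
  apply Subtype.ext
  apply Subtype.ext
  rw [eq_one_of_re_eq_one a.2, eq_one_of_re_eq_one b.2]

theorem card_eq_and_reCount_eq {H K : Subgroup (unitary ℍ[ℝ])} [Finite H] [Finite K]
    (h : ∀ m : ℕ, 0 < m → dimHpqInv 2 0 m (Set.range (quatHom.comp H.subtype)) =
      dimHpqInv 2 0 m (Set.range (quatHom.comp K.subtype))) :
    Nat.card H = Nat.card K ∧ ∀ c, reCount H c = reCount K c := by
  have hc : Nat.card H = Nat.card K := by
    have := card_mul_reCount_eq h 1
    rw [reCount_one, reCount_one] at this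
    lia
  refine ⟨hc, fun c => Nat.eq_of_mul_eq_mul_left (Nat.card_pos (α := K)) ?_⟩
  rw [card_mul_reCount_eq h c, hc]

end KohnSpectrum

namespace KohnSpectrum

open scoped Quaternion

/-- The group of unit quaternions. -/
abbrev UQ : Type := unitary ℍ[ℝ]

/-- The real part of a unit quaternion. -/
def qre (q : UQ) : ℝ := (q : ℍ[ℝ]).re

theorem qre_one : qre 1 = 1 := by simp [qre]

theorem qre_neg (q : UQ) : qre (-q) = -qre q := Quaternion.re_neg (q : ℍ[ℝ])

theorem qre_inv (q : UQ) : qre q⁻¹ = qre q := by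
  change (star (q : ℍ[ℝ])).re = _
  simp [qre]

theorem qre_conj (p x : UQ) : qre (p * x * p⁻¹) = qre x := re_conj p x

theorem qre_mul_add (a b : UQ) : qre (a * b) + qre (a * b⁻¹) = 2 * qre a * qre b := by
  have : ((b⁻¹ : UQ) : ℍ[ℝ]) = star (b : ℍ[ℝ]) := rfl
  simp [qre, this]
  ring

theorem qre_eq_one {q : UQ} : qre q = 1 ↔ q = 1 :=
  ⟨eq_one_of_re_eq_one, fun h => by rw [h, qre_one]⟩

theorem qre_eq_neg_one {q : UQ} : qre q = -1 ↔ q = -1 := by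
  rw [← neg_eq_iff_eq_neg, ← qre_neg, qre_eq_one, neg_eq_iff_eq_neg]

theorem qre_sq_eq_one {q : UQ} : qre q ^ 2 = 1 ↔ q = 1 ∨ q = -1 := by
  rw [sq_eq_one_iff, qre_eq_one, qre_eq_neg_one]

theorem qre_pow_add_two (q : UQ) (n : ℕ) :
    qre (q ^ (n + 2)) = 2 * qre q * qre (q ^ (n + 1)) - qre (q ^ n) := by
  have h := qre_mul_add (q ^ (n + 1)) q
  rw [← pow_succ, pow_succ q n, mul_inv_cancel_right] at h
  rw [pow_succ q n]
  linarith

theorem ne_neg_self (q : UQ) : q ≠ -q := fun h => by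
  have h1 := congrArg Subtype.val h
  have : (2 : ℍ[ℝ]) * q = 0 := by
    rw [two_mul]
    nth_rewrite 1 [h1]
    exact neg_add_cancel (q : ℍ[ℝ])
  have h2 := (mul_eq_zero.1 this).resolve_left quaternion_two_ne_zero
  have h3 := normSq_eq_one q
  rw [h2, map_zero] at h3
  exact zero_ne_one h3

theorem mul_self_eq_one {q : UQ} : q * q = 1 ↔ q = 1 ∨ q = -1 := by
  rw [Subtype.ext_iff, Submonoid.coe_mul, Submonoid.coe_one, mul_self_eq_one_iff, Subtype.ext_iff,
    Subtype.ext_iff]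
  rfl

theorem mul_self_eq_neg_one {q : UQ} : q * q = -1 ↔ qre q = 0 := by
  rw [← qre_eq_neg_one, ← pow_two, qre_pow_add_two q 0]
  simp only [zero_add, pow_one, pow_zero, qre_one]
  constructor <;> intro h
  · nlinarith
  · rw [h]
    norm_num

theorem exists_conj_of_qre_eq {a b : UQ} (h : qre a = qre b) : ∃ q, q * a * q⁻¹ = b :=
  exists_conj_of_re_eq h

theorem orderOf_eq_of_qre_eq {a b : UQ} (h : qre a = qre b) : orderOf a = orderOf b := by
  obtain ⟨q, rfl⟩ := exists_conj_of_qre_eq h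
  exact (orderOf_injective (MulAut.conj q).toMonoidHom (MulAut.conj q).injective a).symm

/-- A pure unit quaternion which commutes with `g`. -/
structure IsAxis (g u : UQ) : Prop where
  qre_eq_zero : qre u = 0
  commute : g * u = u * g

theorem exists_commute_axis {g : UQ} (h : qre g ^ 2 ≠ 1) :
    ∃ w, qre w = 0 ∧ ∀ x, g * x = x * g → x * w = w * x := by
  have hn : (g : ℍ[ℝ]).im ≠ 0 := fun h0 => h (by
    have := normSq_im g
    rw [h0, map_zero] at this
    unfold qre
    linarith)
  have hn' : ‖(g : ℍ[ℝ]).im‖ ≠ 0 := norm_ne_zero_iff.2 hn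
  refine ⟨⟨‖(g : ℍ[ℝ]).im‖⁻¹ • (g : ℍ[ℝ]).im, mem_unitary_quaternion.2 ?_⟩, ?_, fun x hx => ?_⟩
  · rw [Quaternion.normSq_smul, Quaternion.normSq_eq_norm_mul_self]
    field_simp
  · simp [qre]
  · apply Subtype.ext
    have e : (g : ℍ[ℝ]).im = g - ((g : ℍ[ℝ]).re : ℍ[ℝ]) :=
      eq_sub_of_add_eq' (Quaternion.re_add_im (g : ℍ[ℝ]))
    have h1 : (g : ℍ[ℝ]) * x = x * g := congrArg Subtype.val hx
    have : (x : ℍ[ℝ]) * (g : ℍ[ℝ]).im = (g : ℍ[ℝ]).im * x := by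
      rw [e, mul_sub, sub_mul, h1, Quaternion.coe_commutes]
    simp [this]

theorem exists_isAxis {g : UQ} (h : qre g ^ 2 ≠ 1) : ∃ u, IsAxis g u := by
  obtain ⟨w, hw, hc⟩ := exists_commute_axis h
  exact ⟨w, hw, hc g rfl⟩

theorem eq_or_eq_neg_of_commute {u v : UQ} (hu : qre u = 0) (hv : qre v = 0)
    (h : u * v = v * u) : v = u ∨ v = -u := by
  have h1 : (v * u⁻¹) * (v * u⁻¹) = 1 := by
    have e : u⁻¹ * v = v * u⁻¹ := by rw [inv_mul_eq_iff_eq_mul, ← mul_assoc, h, mul_inv_cancel_right]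
    calc v * u⁻¹ * (v * u⁻¹) = v * (u⁻¹ * v) * u⁻¹ := by group
      _ = (v * v) * (u * u)⁻¹ := by rw [e]; group
      _ = 1 := by rw [mul_self_eq_neg_one.2 hu, mul_self_eq_neg_one.2 hv, mul_inv_cancel]
  rcases mul_self_eq_one.1 h1 with h2 | h2
  · exact Or.inl (mul_inv_eq_one.1 h2)
  · right
    rw [mul_inv_eq_iff_eq_mul] at h2
    simpa using h2

/-- The quaternion `i`. -/
def unitI : UQ :=
  ⟨⟨0, 1, 0, 0⟩, mem_unitary_quaternion.2 ((Quaternion.normSq_def' _).trans (by simp))⟩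

theorem unitI_coord : (unitI : ℍ[ℝ]).re = 0 ∧ (unitI : ℍ[ℝ]).imI = 1 ∧ (unitI : ℍ[ℝ]).imJ = 0 ∧
    (unitI : ℍ[ℝ]).imK = 0 := ⟨rfl, rfl, rfl, rfl⟩

theorem im_eq_zero_of_commute_unitI {a : UQ} (h : a * unitI = unitI * a) :
    (a : ℍ[ℝ]).imJ = 0 ∧ (a : ℍ[ℝ]).imK = 0 := by
  have h1 : (a : ℍ[ℝ]) * (unitI : UQ) = (unitI : UQ) * (a : ℍ[ℝ]) := congrArg Subtype.val h
  have hj := congrArg QuaternionAlgebra.imJ h1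
  have hk := congrArg QuaternionAlgebra.imK h1
  rw [Quaternion.imJ_mul, Quaternion.imJ_mul] at hj
  rw [Quaternion.imK_mul, Quaternion.imK_mul] at hk
  simp only [unitI_coord] at hj hk
  constructor <;> linarith

theorem exists_injective_centralizer {u : UQ} (hu : qre u = 0) :
    ∃ f : Subgroup.centralizer {u} →* ℂ, Function.Injective f := by
  obtain ⟨q, hq⟩ := exists_conj_of_qre_eq (a := u) (b := unitI) hu
  have key : ∀ g : Subgroup.centralizer {u}, (MulAut.conj q g : UQ) * unitI =
      unitI * MulAut.conj q g := fun g => by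
    rw [← hq, ← MulAut.conj_apply, ← map_mul, ← map_mul,
      Subgroup.mem_centralizer_singleton_iff.1 g.2]
  refine ⟨⟨⟨fun g => ⟨((MulAut.conj q g : UQ) : ℍ[ℝ]).re, ((MulAut.conj q g : UQ) : ℍ[ℝ]).imI⟩, ?_⟩,
    ?_⟩, ?_⟩
  · simp [Complex.ext_iff]
  · intro a b
    obtain ⟨h1, h2⟩ := im_eq_zero_of_commute_unitI (key a)
    obtain ⟨h3, h4⟩ := im_eq_zero_of_commute_unitI (key b)
    have e : ((MulAut.conj q (a * b : UQ) : UQ) : ℍ[ℝ]) =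
        (MulAut.conj q a : UQ) * (MulAut.conj q b : UQ) := by rw [map_mul, Submonoid.coe_mul]
    apply Complex.ext
    · refine (congrArg QuaternionAlgebra.re e).trans ?_
      rw [Quaternion.re_mul, h1, h2, Complex.mul_re]
      ring
    · refine (congrArg QuaternionAlgebra.imI e).trans ?_
      rw [Quaternion.imI_mul, h1, h2, Complex.mul_im]
      ring
  · intro a b hab
    obtain ⟨h1, h2⟩ := im_eq_zero_of_commute_unitI (key a)
    obtain ⟨h3, h4⟩ := im_eq_zero_of_commute_unitI (key b)
    have h5 := congrArg Complex.re hab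
    have h6 := congrArg Complex.im hab
    apply Subtype.ext
    apply (MulAut.conj q).injective
    apply Subtype.ext
    ext
    · exact h5
    · exact h6
    · rw [h1, h3]
    · rw [h2, h4]

theorem commute_of_commute {u a b : UQ} (hu : qre u = 0) (ha : a * u = u * a)
    (hb : b * u = u * b) : a * b = b * a := by
  obtain ⟨f, hf⟩ := exists_injective_centralizer hu
  let a' : Subgroup.centralizer {u} := ⟨a, Subgroup.mem_centralizer_singleton_iff.2 ha⟩
  let b' : Subgroup.centralizer {u} := ⟨b, Subgroup.mem_centralizer_singleton_iff.2 hb⟩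
  have : a' * b' = b' * a' := hf (by rw [map_mul, map_mul, mul_comm])
  exact congrArg Subtype.val this

theorem isCyclic_of_commute {u : UQ} (hu : qre u = 0) (K : Subgroup UQ) [Finite K]
    (hK : ∀ g ∈ K, g * u = u * g) : IsCyclic K := by
  obtain ⟨f, hf⟩ := exists_injective_centralizer hu
  have hle : K ≤ Subgroup.centralizer {u} := fun g hg =>
    Subgroup.mem_centralizer_singleton_iff.2 (hK g hg)
  exact isCyclic_of_injective_ringHom (f.comp (Subgroup.inclusion hle))
    (hf.comp (Subgroup.inclusion_injective hle))

/-- A quaternion commuting with a pure unit `u` is a real combination of `1` and `u`. -/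
theorem isAxis_of_commute {g h u : UQ} (hg : qre g ^ 2 ≠ 1) (hu : IsAxis g u)
    (hgh : g * h = h * g) : IsAxis h u := by
  obtain ⟨w, hw, hc⟩ := exists_commute_axis hg
  refine ⟨hu.qre_eq_zero, ?_⟩
  rcases eq_or_eq_neg_of_commute hw hu.qre_eq_zero (hc u hu.commute).symm with rfl | rfl
  · exact hc h hgh
  · rw [mul_neg, neg_mul, hc h hgh]

theorem eq_or_eq_neg_of_isAxis {g u v : UQ} (hg : qre g ^ 2 ≠ 1) (hu : IsAxis g u)
    (hv : IsAxis g v) : v = u ∨ v = -u :=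
  eq_or_eq_neg_of_commute hu.1 hv.1 (isAxis_of_commute hg hu hv.2).2.symm

end KohnSpectrum

namespace KohnSpectrum

theorem three_unit_fractions_of_le {r₁ r₂ r₃ M : ℕ} (h₁ : 2 ≤ r₁) (h12 : r₁ ≤ r₂) (h23 : r₂ ≤ r₃)
    (h : M * (r₂ * r₃ + r₁ * r₃ + r₁ * r₂) = (M + 2) * (r₁ * r₂ * r₃)) :
    M = 2 * r₃ ∨ (r₁ = 2 ∧ r₂ = 3 ∧ 3 ≤ r₃ ∧ r₃ ≤ 5 ∧ M * (6 - r₃) = 12 * r₃) := by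
  have hr1 : r₁ = 2 := by
    by_contra h0
    have h3 : 3 ≤ r₁ := by omega
    have e1 : 3 * (r₂ * r₃) ≤ r₁ * r₂ * r₃ := by
      rw [mul_assoc]
      exact Nat.mul_le_mul_right _ h3
    have h2 : 0 < r₂ := by omega
    have h3' : 0 < r₃ := by omega
    have e2 : r₁ * r₃ ≤ r₂ * r₃ := Nat.mul_le_mul_right _ h12
    have e3 : r₁ * r₂ ≤ r₂ * r₃ := by
      rw [mul_comm]
      exact Nat.mul_le_mul_left _ (h12.trans h23)
    have e4 : 0 < r₁ * r₂ * r₃ := by positivity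
    nlinarith
  subst hr1
  have hr2 : r₂ < 4 := by
    by_contra h0
    have h2 : 0 < r₂ := by omega
    have h3' : 0 < r₃ := by omega
    have e1 : 4 * r₃ ≤ r₂ * r₃ := Nat.mul_le_mul_right _ (by omega)
    have e4 : 0 < r₂ * r₃ := by positivity
    nlinarith
  interval_cases r₂
  · left
    nlinarith
  · right
    have hr3 : r₃ < 6 := by
      by_contra h0
      nlinarith
    refine ⟨rfl, rfl, h23, by omega, ?_⟩
    interval_cases r₃ <;> omega


/-- The solutions of `1 / r₁ + 1 / r₂ + 1 / r₃ = 1 + 2 / M`. -/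
theorem three_unit_fractions {r₁ r₂ r₃ M : ℕ} (h₁ : 2 ≤ r₁) (h₂ : 2 ≤ r₂) (h₃ : 2 ≤ r₃)
    (h : M * (r₂ * r₃ + r₁ * r₃ + r₁ * r₂) = (M + 2) * (r₁ * r₂ * r₃)) :
    (M = 2 * r₁ ∨ M = 2 * r₂ ∨ M = 2 * r₃) ∨ ∃ k, (3 ≤ k ∧ k ≤ 5) ∧ M * (6 - k) = 12 * k ∧
      (r₁ = k ∨ r₂ = k ∨ r₃ = k) ∧ (r₁ = 2 ∨ r₁ = 3 ∨ r₁ = k) ∧ (r₂ = 2 ∨ r₂ = 3 ∨ r₂ = k) ∧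
      (r₃ = 2 ∨ r₃ = 3 ∨ r₃ = k) := by
  rcases le_total r₁ r₂ with h12 | h12 <;> rcases le_total r₂ r₃ with h23 | h23 <;>
    rcases le_total r₁ r₃ with h13 | h13
  · rcases three_unit_fractions_of_le h₁ h12 h23 (by linarith) with H | ⟨e₁, e₂, e₃, e₄, e₅⟩
    · exact Or.inl (by omega)
    · exact Or.inr ⟨r₃, ⟨e₃, e₄⟩, e₅, by omega⟩
  · rcases three_unit_fractions_of_le h₁ h12 h23 (by linarith) with H | ⟨e₁, e₂, e₃, e₄, e₅⟩
    · exact Or.inl (by omega)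
    · exact Or.inr ⟨r₃, ⟨e₃, e₄⟩, e₅, by omega⟩
  · rcases three_unit_fractions_of_le h₁ h13 h23 (by linarith) with H | ⟨e₁, e₂, e₃, e₄, e₅⟩
    · exact Or.inl (by omega)
    · exact Or.inr ⟨r₂, ⟨e₃, e₄⟩, e₅, by omega⟩
  · rcases three_unit_fractions_of_le h₃ h13 h12 (by linarith) with H | ⟨e₁, e₂, e₃, e₄, e₅⟩
    · exact Or.inl (by omega)
    · exact Or.inr ⟨r₂, ⟨e₃, e₄⟩, e₅, by omega⟩
  · rcases three_unit_fractions_of_le h₂ h12 h13 (by linarith) with H | ⟨e₁, e₂, e₃, e₄, e₅⟩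
    · exact Or.inl (by omega)
    · exact Or.inr ⟨r₃, ⟨e₃, e₄⟩, e₅, by omega⟩
  · rcases three_unit_fractions_of_le h₂ h23 h13 (by linarith) with H | ⟨e₁, e₂, e₃, e₄, e₅⟩
    · exact Or.inl (by omega)
    · exact Or.inr ⟨r₁, ⟨e₃, e₄⟩, e₅, by omega⟩
  · rcases three_unit_fractions_of_le h₃ h23 h12 (by linarith) with H | ⟨e₁, e₂, e₃, e₄, e₅⟩
    · exact Or.inl (by omega)
    · exact Or.inr ⟨r₁, ⟨e₃, e₄⟩, e₅, by omega⟩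
  · rcases three_unit_fractions_of_le h₃ h23 h12 (by linarith) with H | ⟨e₁, e₂, e₃, e₄, e₅⟩
    · exact Or.inl (by omega)
    · exact Or.inr ⟨r₁, ⟨e₃, e₄⟩, e₅, by omega⟩

end KohnSpectrum

namespace KohnSpectrum

open MulAction

/-- The subgroup `{1, -1}` of the unit quaternions. -/
def signSubgroup : Subgroup UQ where
  carrier := {q | qre q ^ 2 = 1}
  one_mem' := by simp [qre_one]
  mul_mem' := by
    intro a b ha hb
    rw [Set.mem_ofPred_eq, qre_sq_eq_one] at *
    rcases ha with rfl | rfl <;> rcases hb with rfl | rfl <;> simp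
  inv_mem' := by
    intro a ha
    rw [Set.mem_ofPred_eq, qre_inv]
    exact ha

theorem mem_signSubgroup {q : UQ} : q ∈ signSubgroup ↔ qre q ^ 2 = 1 := Iff.rfl

/-- The stabilizer of `u` in `G`, acting by conjugation. -/
def stab (G : Subgroup UQ) (u : UQ) : Subgroup UQ := G ⊓ Subgroup.centralizer {u}

theorem mem_stab {G : Subgroup UQ} {u g : UQ} : g ∈ stab G u ↔ g ∈ G ∧ g * u = u * g := by
  rw [stab, Subgroup.mem_inf, Subgroup.mem_centralizer_singleton_iff]

theorem stab_le (G : Subgroup UQ) (u : UQ) : stab G u ≤ G := inf_le_left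

instance (G : Subgroup UQ) [Finite G] (u : UQ) : Finite (stab G u) :=
  Finite.of_injective _ (Subgroup.inclusion_injective (stab_le G u))

instance (G : Subgroup UQ) [Finite G] : Finite (G ⊓ signSubgroup : Subgroup UQ) :=
  Finite.of_injective _ (Subgroup.inclusion_injective (inf_le_left : G ⊓ signSubgroup ≤ G))

theorem commute_of_mem_signSubgroup {q : UQ} (h : q ∈ signSubgroup) (u : UQ) : q * u = u * q := by
  rcases qre_sq_eq_one.1 h with rfl | rfl <;> simp

theorem inf_signSubgroup_le_stab (G : Subgroup UQ) (u : UQ) : G ⊓ signSubgroup ≤ stab G u :=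
  fun _ hg => mem_stab.2 ⟨hg.1, commute_of_mem_signSubgroup hg.2 u⟩

theorem isAxis_conj {g u : UQ} (h : UQ) (hu : IsAxis g u) : IsAxis (h * g * h⁻¹) (h * u * h⁻¹) := by
  refine ⟨by rw [qre_conj, hu.qre_eq_zero], ?_⟩
  rw [← MulAut.conj_apply, ← MulAut.conj_apply, ← map_mul, ← map_mul, hu.commute]

/-- The axes of the elements of `G` other than `1` and `-1`. -/
def Pole (G : Subgroup UQ) : Type := {u : UQ // ∃ g ∈ G, qre g ^ 2 ≠ 1 ∧ IsAxis g u}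

instance (G : Subgroup UQ) : MulAction G (Pole G) where
  smul h u := ⟨h * u.1 * (h : UQ)⁻¹, by
    obtain ⟨g, hg, hr, hu⟩ := u.2
    exact ⟨h * g * (h : UQ)⁻¹, G.mul_mem (G.mul_mem h.2 hg) (G.inv_mem h.2), by rwa [qre_conj],
      isAxis_conj _ hu⟩⟩
  one_smul u := Subtype.ext (by
    change ((1 : G) : UQ) * u.1 * ((1 : G) : UQ)⁻¹ = u.1
    simp)
  mul_smul a b u := Subtype.ext (by
    change ((a * b : G) : UQ) * u.1 * ((a * b : G) : UQ)⁻¹ =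
      (a : UQ) * ((b : UQ) * u.1 * (b : UQ)⁻¹) * (a : UQ)⁻¹
    rw [Subgroup.coe_mul]
    group)

theorem smul_eq_iff {G : Subgroup UQ} {g : G} {u : Pole G} :
    g • u = u ↔ (g : UQ) * u.1 = u.1 * g := by
  rw [← mul_inv_eq_iff_eq_mul]
  exact Subtype.ext_iff

theorem qre_pole {G : Subgroup UQ} (u : Pole G) : qre u.1 = 0 := by
  obtain ⟨g, -, -, hu⟩ := u.2
  exact hu.qre_eq_zero

instance (G : Subgroup UQ) [Finite G] : Finite (Pole G) := by
  have : Set.Finite {u : UQ | ∃ g ∈ G, qre g ^ 2 ≠ 1 ∧ IsAxis g u} := by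
    refine ((Set.toFinite (G : Set UQ)).biUnion (t := fun g => {u | qre g ^ 2 ≠ 1 ∧ IsAxis g u})
      fun g _ => ?_).subset fun u ⟨g, hg, h⟩ => Set.mem_biUnion hg h
    by_cases h : ∃ u, qre g ^ 2 ≠ 1 ∧ IsAxis g u
    · obtain ⟨u, hr, hu⟩ := h
      exact (Set.toFinite {u, -u}).subset fun v hv => eq_or_eq_neg_of_isAxis hr hu hv.2
    · exact Set.Finite.subset Set.finite_empty fun u hu => h ⟨u, hu⟩
  exact this.to_subtype

theorem card_fixedBy_of_mem {G : Subgroup UQ} {g : G} (h : qre g ^ 2 = 1) :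
    Nat.card (fixedBy (Pole G) g) = Nat.card (Pole G) := by
  have : fixedBy (Pole G) g = Set.univ := Set.eq_univ_of_forall fun u =>
    smul_eq_iff.2 (commute_of_mem_signSubgroup h u.1)
  rw [this, Nat.card_congr (Equiv.Set.univ _)]

theorem card_fixedBy_of_notMem {G : Subgroup UQ} {g : G} (h : qre g ^ 2 ≠ 1) :
    Nat.card (fixedBy (Pole G) g) = 2 := by
  obtain ⟨u, hu⟩ := exists_isAxis h
  have hu' : IsAxis (g : UQ) (-u) :=
    ⟨by rw [qre_neg, hu.qre_eq_zero, neg_zero], by rw [mul_neg, neg_mul, hu.commute]⟩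
  let v : Pole G := ⟨u, g, g.2, h, hu⟩
  let w : Pole G := ⟨-u, g, g.2, h, hu'⟩
  have hvw : v ≠ w := fun e => ne_neg_self u (congrArg Subtype.val e)
  have : fixedBy (Pole G) g = {v, w} := by
    ext p
    rw [mem_fixedBy, smul_eq_iff, Set.mem_insert_iff, Set.mem_singleton_iff]
    constructor
    · intro hp
      exact (eq_or_eq_neg_of_isAxis h hu ⟨qre_pole p, hp⟩).imp Subtype.ext Subtype.ext
    · rintro (rfl | rfl)
      · exact hu.commute
      · exact hu'.commute
  rw [this, Nat.card_coe_set_eq, Set.ncard_pair hvw]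

theorem card_stabilizer_pole {G : Subgroup UQ} (u : Pole G) :
    Nat.card (stabilizer G u) = Nat.card (stab G u.1) := by
  refine Nat.card_congr ⟨fun g => ⟨g.1, mem_stab.2 ⟨g.1.2, smul_eq_iff.1 g.2⟩⟩,
    fun g => ⟨⟨g.1, (mem_stab.1 g.2).1⟩, smul_eq_iff.2 (mem_stab.1 g.2).2⟩, fun _ => rfl, fun _ => rfl⟩

theorem exists_orbit_weights (G : Subgroup UQ) [Finite G] :
    ∃ (M : ℕ) (ι : Type) (_ : Fintype ι) (r : ι → ℕ), 0 < M ∧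
      Nat.card G = Nat.card (G ⊓ signSubgroup : Subgroup UQ) * M ∧
      (∀ i, 2 ≤ r i ∧ r i ≤ M ∧ ∃ u, qre u = 0 ∧
        Nat.card (stab G u) = Nat.card (G ⊓ signSubgroup : Subgroup UQ) * r i) ∧
      (∀ g ∈ G, qre g ^ 2 ≠ 1 → ∃ i u, g * u = u * g ∧
        Nat.card (stab G u) = Nat.card (G ⊓ signSubgroup : Subgroup UQ) * r i) ∧
      ∑ i, (1 - 1 / (r i : ℚ)) = 2 - 2 / M := by
  classical
  have := Fintype.ofFinite G
  have := Fintype.ofFinite (Pole G)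
  set z := Nat.card (G ⊓ signSubgroup : Subgroup UQ) with hz
  have hz0 : 0 < z := Nat.card_pos
  obtain ⟨M, hM⟩ : z ∣ Nat.card G := Subgroup.card_dvd_of_le inf_le_left
  have hM0 : 0 < M := Nat.pos_of_ne_zero fun h => by
    have : 0 < Nat.card G := Nat.card_pos
    rw [hM, h, mul_zero] at this
    exact lt_irrefl 0 this
  have hs : ∀ u : Pole G, ∃ r, Nat.card (stab G u.1) = z * r := fun u =>
    Subgroup.card_dvd_of_le (inf_signSubgroup_le_stab G u.1)
  choose r hr using hs
  have hr2 : ∀ u, 2 ≤ r u := fun u => by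
    by_contra h0
    obtain ⟨g, hg, hg1, hu⟩ := u.2
    have : G ⊓ signSubgroup = stab G u.1 := Subgroup.eq_of_le_of_card_ge
      (inf_signSubgroup_le_stab G u.1) (by
        rw [hr u, ← hz]
        exact (Nat.mul_le_mul_left z (by omega : r u ≤ 1)).trans_eq (mul_one z))
    have h2 : g ∈ G ⊓ signSubgroup := by
      rw [this]
      exact mem_stab.2 ⟨hg, hu.commute⟩
    exact hg1 h2.2
  have hrM : ∀ u, r u ∣ M := fun u => by
    have h := Subgroup.card_dvd_of_le (stab_le G u.1)
    rw [hr u, hM] at h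
    exact Nat.dvd_of_mul_dvd_mul_left hz0 h
  refine ⟨M, Quotient (orbitRel G (Pole G)), inferInstance, fun ω => r ω.out, hM0, hM,
    fun ω => ⟨hr2 _, Nat.le_of_dvd hM0 (hrM _), ω.out.1, qre_pole _, hr _⟩, ?_, ?_⟩
  · intro g hg hg1
    obtain ⟨u, hu⟩ := exists_isAxis hg1
    let p : Pole G := ⟨u, g, hg, hg1, hu⟩
    refine ⟨Quotient.mk'' p, u, hu.commute, ?_⟩
    rw [← hr, ← card_stabilizer_pole, ← card_stabilizer_pole p]
    exact Nat.card_congr (stabilizerEquivStabilizerOfOrbitRel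
      ((orbitRel G (Pole G)).symm (Quotient.mk_out p))).toEquiv
  · have h1 := sum_card_fixedBy_eq_card_orbits_mul_card_group G (Pole G)
    have h2 := card_eq_sum_card_group_div_card_stabilizer G (Pole G)
    have h3 : ∀ g : G, Fintype.card (fixedBy (Pole G) g) =
        if qre g ^ 2 = 1 then Fintype.card (Pole G) else 2 := fun g => by
      split_ifs with h
      · rw [← Nat.card_eq_fintype_card, card_fixedBy_of_mem h, Nat.card_eq_fintype_card]
      · rw [← Nat.card_eq_fintype_card, card_fixedBy_of_notMem h]
    have h4 : (Finset.univ.filter fun g : G => qre g ^ 2 = 1).card = z := by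
      rw [hz, ← Fintype.card_subtype, ← Nat.card_eq_fintype_card]
      exact Nat.card_congr ⟨fun g => ⟨g.1, g.1.2, g.2⟩, fun g => ⟨⟨g.1, g.2.1⟩, g.2.2⟩,
        fun _ => rfl, fun _ => rfl⟩
    have h5 := Finset.card_filter_add_card_filter_not (s := (Finset.univ : Finset G))
      (fun g : G => qre g ^ 2 = 1)
    rw [Finset.sum_congr rfl fun g _ => h3 g, Finset.sum_ite, Finset.sum_const, Finset.sum_const,
      smul_eq_mul, smul_eq_mul, h4] at h1
    rw [h4, Finset.card_univ] at h5
    have hN : Fintype.card G = z * M := by rw [← Nat.card_eq_fintype_card, hM]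
    rw [hN] at h1 h2 h5
    have h6 : ∀ ω : Quotient (orbitRel G (Pole G)),
        ((z * M / Fintype.card (stabilizer G ω.out) : ℕ) : ℚ) = M / r ω.out := fun ω => by
      rw [← Nat.card_eq_fintype_card, card_stabilizer_pole, hr, Nat.mul_div_mul_left _ _ hz0,
        Nat.cast_div (hrM _)]
      have := hr2 ω.out
      positivity
    have h7 : (Fintype.card (Pole G) : ℚ) =
        ∑ ω : Quotient (orbitRel G (Pole G)), (M : ℚ) / r ω.out := by
      rw [h2, Nat.cast_sum]
      exact Finset.sum_congr rfl fun ω _ => h6 ω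
    have h8 : (Fintype.card (Pole G) : ℚ) = M * ∑ ω : Quotient (orbitRel G (Pole G)),
        1 / (r ω.out : ℚ) := by
      rw [h7, Finset.mul_sum]
      exact Finset.sum_congr rfl fun ω _ => by ring
    rw [Finset.sum_sub_distrib, Finset.sum_const, Finset.card_univ, nsmul_eq_mul, mul_one]
    have hzq : (z : ℚ) ≠ 0 := by positivity
    have hMq : (M : ℚ) ≠ 0 := by positivity
    have h1q := congrArg (Nat.cast : ℕ → ℚ) h1
    have h5q := congrArg (Nat.cast : ℕ → ℚ) h5
    push_cast at h1q h5q
    rw [h8] at h1q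
    field_simp
    apply mul_left_cancel₀ hzq
    linarith

end KohnSpectrum

namespace KohnSpectrum

theorem neg_one_mem_of_even {G : Subgroup UQ} [Finite G] (h : 2 ∣ Nat.card G) : -1 ∈ G := by
  have : Fact (Nat.Prime 2) := ⟨Nat.prime_two⟩
  obtain ⟨x, hx⟩ := exists_prime_orderOf_dvd_card' (G := G) 2 h
  have h1 : x * x = 1 := by rw [← pow_two, ← hx, pow_orderOf_eq_one]
  rcases mul_self_eq_one.1 (congrArg Subtype.val h1) with h2 | h2
  · rw [Subtype.ext (a2 := (1 : G)) h2, orderOf_one] at hx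
    norm_num at hx
  · rw [← h2]
    exact x.2

theorem card_inf_signSubgroup {G : Subgroup UQ} (h : -1 ∈ G) :
    Nat.card (G ⊓ signSubgroup : Subgroup UQ) = 2 := by
  have : ((G ⊓ signSubgroup : Subgroup UQ) : Set UQ) = {1, -1} := by
    ext q
    rw [SetLike.mem_coe, Subgroup.mem_inf, mem_signSubgroup, qre_sq_eq_one]
    constructor
    · exact fun h => h.2
    · rintro (rfl | rfl)
      · exact ⟨G.one_mem, Or.inl rfl⟩
      · exact ⟨h, Or.inr rfl⟩
  rw [← SetLike.coe_sort_coe, Nat.card_coe_set_eq, this, Set.ncard_pair (ne_neg_self 1)]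

theorem isCyclic_of_card_stab_eq {G : Subgroup UQ} [Finite G] {u : UQ} (hu : qre u = 0)
    (h : Nat.card (stab G u) = Nat.card G) : IsCyclic G := by
  refine isCyclic_of_commute hu G fun g hg => ?_
  rw [← Subgroup.eq_of_le_of_card_ge (stab_le G u) h.ge] at hg
  exact (mem_stab.1 hg).2

/-- `G` has the order and the element orders of a binary polyhedral group with a `k`-fold axis. -/
structure IsPolyhedral (G : Subgroup UQ) (k : ℕ) : Prop where
  three_le : 3 ≤ k
  le_five : k ≤ 5
  card_eq : Nat.card G * (6 - k) = 24 * k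
  exists_axis : ∃ u, qre u = 0 ∧ Nat.card (stab G u) = 2 * k
  pow_eq_one : ∀ g ∈ G, qre g ^ 2 ≠ 1 → g ^ 4 = 1 ∨ g ^ 6 = 1 ∨ g ^ (2 * k) = 1

theorem dihedral_or_polyhedral (G : Subgroup UQ) [Finite G] (hG : ¬ IsCyclic G) :
    (∃ u, qre u = 0 ∧ 2 * Nat.card (stab G u) = Nat.card G ∧
      Nat.card (G ⊓ signSubgroup : Subgroup UQ) < Nat.card (stab G u)) ∨
    ∃ k, IsPolyhedral G k := by
  obtain ⟨M, ι, _, r₀, hM, hN, h1, h2, hsum⟩ := exists_orbit_weights G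
  obtain ⟨t, ⟨e⟩⟩ : ∃ t, Nonempty (ι ≃ Fin t) := ⟨_, ⟨Fintype.equivFin ι⟩⟩
  obtain ⟨r, hr⟩ : ∃ r : Fin t → ℕ, r = r₀ ∘ e.symm := ⟨_, rfl⟩
  have h1' := fun i => h1 (e.symm i)
  have h2' : ∀ g ∈ G, qre g ^ 2 ≠ 1 → ∃ i u, g * u = u * g ∧
      Nat.card (stab G u) = Nat.card (G ⊓ signSubgroup : Subgroup UQ) * r i := fun g hg hg1 => by
    obtain ⟨i, hi⟩ := h2 g hg hg1
    refine ⟨e i, ?_⟩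
    simpa [hr] using hi
  rw [← e.symm.sum_comp] at hsum
  change ∀ i, 2 ≤ (r₀ ∘ e.symm) i ∧ (r₀ ∘ e.symm) i ≤ M ∧ ∃ u, qre u = 0 ∧ Nat.card (stab G u) =
    Nat.card (G ⊓ signSubgroup : Subgroup UQ) * (r₀ ∘ e.symm) i at h1'
  change ∑ i, (1 - 1 / ((r₀ ∘ e.symm) i : ℚ)) = _ at hsum
  rw [← hr] at h1' hsum
  clear hr h1 h2
  have hMq : (0 : ℚ) < M := by exact_mod_cast hM
  have hrq : ∀ i, (0 : ℚ) < r i := fun i => by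
    have := (h1' i).1
    exact_mod_cast (by omega : 0 < r i)
  have hr1 : ∀ i, 1 / (r i : ℚ) ≤ 1 / 2 := fun i =>
    one_div_le_one_div_of_le (by norm_num) (by exact_mod_cast (h1' i).1)
  have hr2 : ∀ i, 1 / (M : ℚ) ≤ 1 / r i := fun i =>
    one_div_le_one_div_of_le (hrq i) (by exact_mod_cast (h1' i).2.1)
  have hMi : 0 < 1 / (M : ℚ) := by positivity
  have hM2 : (2 : ℚ) / M = 2 * (1 / M) := by ring
  rw [hM2] at hsum
  have ht : t < 4 := by
    have : ∑ _i : Fin t, (1 / 2 : ℚ) ≤ ∑ i, (1 - 1 / (r i : ℚ)) :=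
      Finset.sum_le_sum fun i _ => by linarith [hr1 i]
    rw [hsum, Finset.sum_const, Finset.card_univ, Fintype.card_fin, nsmul_eq_mul] at this
    have : (t : ℚ) < 4 := by linarith
    exact_mod_cast this
  interval_cases t
  · exfalso
    rw [Finset.univ_eq_empty, Finset.sum_empty] at hsum
    have hM1 : (M : ℚ) = 1 := by
      field_simp at hsum
      linarith
    have hM1' : M = 1 := by exact_mod_cast hM1
    rw [hM1', mul_one] at hN
    refine hG (isCyclic_of_card_stab_eq (u := unitI) rfl ?_)
    exact le_antisymm (Nat.le_of_dvd Nat.card_pos (Subgroup.card_dvd_of_le (stab_le G _)))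
      (hN.le.trans (Nat.le_of_dvd Nat.card_pos
        (Subgroup.card_dvd_of_le (inf_signSubgroup_le_stab G _))))
  · exfalso
    rw [Fin.sum_univ_one] at hsum
    have := hr1 0
    have := hr2 0
    linarith
  · exfalso
    rw [Fin.sum_univ_two] at hsum
    have := hr2 0
    have := hr2 1
    have h3 : 1 / (M : ℚ) = 1 / r 0 := by linarith
    have h4 : (M : ℚ) = r 0 := by
      rwa [one_div, one_div, _root_.inv_inj] at h3
    have h5 : M = r 0 := by exact_mod_cast h4
    obtain ⟨-, -, u, hu, hc⟩ := h1' 0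
    exact hG (isCyclic_of_card_stab_eq hu (by rw [hc, hN, h5]))
  · rw [Fin.sum_univ_three] at hsum
    have h3 : M * (r 1 * r 2 + r 0 * r 2 + r 0 * r 1) = (M + 2) * (r 0 * r 1 * r 2) := by
      have := hrq 0
      have := hrq 1
      have := hrq 2
      field_simp at hsum
      have h4 : (M : ℚ) * (r 1 * r 2 + r 0 * r 2 + r 0 * r 1) = (M + 2) * (r 0 * r 1 * r 2) := by
        linarith
      exact_mod_cast h4
    have hz : 0 < Nat.card (G ⊓ signSubgroup : Subgroup UQ) := Nat.card_pos
    rcases three_unit_fractions (h1' 0).1 (h1' 1).1 (h1' 2).1 h3 with h | ⟨k, hk, hMk, hi, h0⟩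
    · left
      obtain ⟨i, hi⟩ : ∃ i, M = 2 * r i := by
        rcases h with h | h | h
        exacts [⟨0, h⟩, ⟨1, h⟩, ⟨2, h⟩]
      obtain ⟨hi2, -, u, hu, hc⟩ := h1' i
      refine ⟨u, hu, ?_, ?_⟩
      · rw [hc, hN, hi]
        ring
      · rw [hc]
        nlinarith
    · right
      have hMe : 2 ∣ M := by
        obtain ⟨hk1, hk2⟩ := hk
        interval_cases k <;> omega
      have hz2 := card_inf_signSubgroup (neg_one_mem_of_even (hN ▸ hMe.mul_left _))
      rw [hz2] at hN h1' h2'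
      obtain ⟨i, hi⟩ : ∃ i, r i = k := by
        rcases hi with h | h | h
        exacts [⟨0, h⟩, ⟨1, h⟩, ⟨2, h⟩]
      have hall : ∀ i, r i = 2 ∨ r i = 3 ∨ r i = k := by
        rw [Fin.forall_fin_succ, Fin.forall_fin_two]
        exact h0
      obtain ⟨-, -, u, hu, hc⟩ := h1' i
      refine ⟨k, hk.1, hk.2, ?_, ⟨u, hu, by rw [hc, hi]⟩, fun g hg hg1 => ?_⟩
      · rw [hN, mul_assoc, hMk]
        ring
      · obtain ⟨j, v, hv, hj⟩ := h2' g hg hg1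
        have hp : (⟨g, mem_stab.2 ⟨hg, hv⟩⟩ : stab G v) ^ (2 * r j) = 1 := by
          rw [← hj, pow_card_eq_one']
        have hp' : g ^ (2 * r j) = 1 := congrArg Subtype.val hp
        rcases hall j with h | h | h <;> rw [h] at hp'
        exacts [Or.inl hp', Or.inr (Or.inl hp'), Or.inr (Or.inr hp')]

end KohnSpectrum

namespace KohnSpectrum

theorem nonempty_mulEquiv_of_pairs {a b a' b' : UQ} (ha : qre a = qre a') (hb : qre b = qre b')
    (hab : qre (a * b) = qre (a' * b')) (hne : a * b ≠ b * a) :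
    Nonempty (Subgroup.closure {a, b} ≃* Subgroup.closure {a', b'}) := by
  obtain ⟨q, rfl, rfl⟩ := exists_conj_pair ha hb hab hne
  refine ⟨(Subgroup.equivMapOfInjective _ (MulAut.conj q).toMonoidHom
    (MulAut.conj q).injective).trans (MulEquiv.subgroupCongr ?_)⟩
  rw [MonoidHom.map_closure, Set.image_pair]
  rfl

theorem not_isCyclic_of_not_commute {G : Subgroup UQ} {a b : UQ} (ha : a ∈ G) (hb : b ∈ G)
    (hne : a * b ≠ b * a) : ¬ IsCyclic G := fun h => hne (by
  have := h.isMulCommutative.is_comm.comm (⟨a, ha⟩ : G) ⟨b, hb⟩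
  exact congrArg Subtype.val this)

theorem exists_orderOf_eq_card_stab (G : Subgroup UQ) [Finite G] {u : UQ} (hu : qre u = 0) :
    ∃ a ∈ stab G u, orderOf a = Nat.card (stab G u) ∧ Subgroup.zpowers a = stab G u := by
  have := isCyclic_of_commute hu (stab G u) fun g hg => (mem_stab.1 hg).2
  obtain ⟨a, ha⟩ := IsCyclic.exists_ofOrder_eq_natCard (α := stab G u)
  rw [← Subgroup.orderOf_coe] at ha
  refine ⟨a, a.2, ha, Subgroup.eq_of_le_of_card_ge ?_ ?_⟩
  · rw [Subgroup.zpowers_le]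
    exact a.2
  · rw [Nat.card_zpowers, ha]

theorem index_stab {G : Subgroup UQ} [Finite G] {u : UQ} :
    Nat.card (stab G u) * ((stab G u).subgroupOf G).index = Nat.card G := by
  rw [← Subgroup.card_mul_index ((stab G u).subgroupOf G),
    Nat.card_congr (Subgroup.subgroupOfEquivOfLe (stab_le G u)).toEquiv]

theorem qre_eq_zero_of_conj_eq_neg {b u : UQ} (h : b * u * b⁻¹ = -u) : qre b = 0 := by
  have h1 : u⁻¹ * b * u = -b := by
    rw [mul_inv_eq_iff_eq_mul] at h
    rw [mul_assoc, h, neg_mul, mul_neg, inv_mul_cancel_left]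
  have h2 := qre_conj u⁻¹ b
  rw [inv_inv, h1, qre_neg] at h2
  linarith

theorem qre_eq_zero_of_notMem_stab {G : Subgroup UQ} [Finite G] {u a b : UQ} (hu : qre u = 0)
    (h : 2 * Nat.card (stab G u) = Nat.card G) (ha : a ∈ stab G u) (ha1 : qre a ^ 2 ≠ 1)
    (hb : b ∈ G) (hbu : b ∉ stab G u) : qre b = 0 := by
  have hi : ((stab G u).subgroupOf G).index = 2 := by
    have h1 := index_stab (G := G) (u := u)
    rw [← h, mul_comm 2] at h1
    exact Nat.eq_of_mul_eq_mul_left Nat.card_pos h1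
  have hn := Subgroup.normal_of_index_eq_two hi
  have h2 := hn.conj_mem ⟨a, stab_le G u ha⟩ (Subgroup.mem_subgroupOf.2 ha) ⟨b, hb⟩
  have h3 : b * a * b⁻¹ ∈ stab G u := Subgroup.mem_subgroupOf.1 h2
  have h4 : IsAxis (b * a * b⁻¹) (b * u * b⁻¹) := isAxis_conj b ⟨hu, (mem_stab.1 ha).2⟩
  have h5 : IsAxis (b * a * b⁻¹) u := ⟨hu, (mem_stab.1 h3).2⟩
  rcases eq_or_eq_neg_of_isAxis (by rwa [qre_conj]) h5 h4 with h6 | h6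
  · exact absurd (mem_stab.2 ⟨hb, mul_inv_eq_iff_eq_mul.1 h6⟩) hbu
  · exact qre_eq_zero_of_conj_eq_neg h6

theorem exists_generators_of_orderOf {G : Subgroup UQ} [Finite G] (hG : ¬ IsCyclic G) {a : UQ}
    (ha : a ∈ G) (ha1 : qre a ^ 2 ≠ 1) (ho : 2 * orderOf a = Nat.card G) :
    ∃ b, qre b = 0 ∧ qre (a * b) = 0 ∧ a * b ≠ b * a ∧ Subgroup.closure {a, b} = G := by
  obtain ⟨u, hu⟩ := exists_isAxis ha1
  have hau : a ∈ stab G u := mem_stab.2 ⟨ha, hu.commute⟩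
  have hne : Nat.card (stab G u) ≠ Nat.card G := fun h =>
    hG (isCyclic_of_card_stab_eq hu.qre_eq_zero h)
  have hle : Subgroup.zpowers a ≤ stab G u := by rwa [Subgroup.zpowers_le]
  have hcard : Nat.card (stab G u) = orderOf a := by
    obtain ⟨c, hc⟩ := Subgroup.card_dvd_of_le hle
    obtain ⟨d, hd⟩ := Subgroup.card_dvd_of_le (stab_le G u)
    rw [Nat.card_zpowers] at hc
    have h0 : 0 < orderOf a := by
      have : 0 < Nat.card G := Nat.card_pos
      omega
    have hcd : c * d = 2 := by
      apply Nat.eq_of_mul_eq_mul_left h0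
      rw [← mul_assoc, ← hc, ← hd, ← ho, mul_comm]
    have hd1 : d ≠ 1 := fun h => hne (by rw [hd, h, mul_one])
    have hc1 : c = 1 := by
      have hd2 : d ∣ 2 := ⟨c, by rw [← hcd, mul_comm]⟩
      rw [((Nat.dvd_prime Nat.prime_two).1 hd2).resolve_left hd1] at hcd
      omega
    rw [hc, hc1, mul_one]
  obtain ⟨b, hb, hbu⟩ : ∃ b ∈ G, b ∉ stab G u := by
    by_contra! h
    exact hne (congrArg (fun H : Subgroup UQ => Nat.card H) (le_antisymm (stab_le G u) h))
  have key : ∀ x ∈ G, x ∉ stab G u → qre x = 0 := fun x hx hxu =>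
    qre_eq_zero_of_notMem_stab hu.qre_eq_zero (by rw [hcard, ho]) hau ha1 hx hxu
  refine ⟨b, key b hb hbu, key _ (G.mul_mem ha hb) fun h => hbu ?_, fun h => hbu ?_, ?_⟩
  · exact ((stab G u).mul_mem_cancel_left hau).1 h
  · exact mem_stab.2 ⟨hb, (isAxis_of_commute ha1 hu h).commute⟩
  · have hK : Subgroup.closure {a, b} ≤ G := by
      rw [Subgroup.closure_le, Set.insert_subset_iff, Set.singleton_subset_iff]
      exact ⟨ha, hb⟩
    have haK : a ∈ Subgroup.closure {a, b} := Subgroup.subset_closure (Set.mem_insert _ _)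
    have hbK : b ∈ Subgroup.closure {a, b} :=
      Subgroup.subset_closure (Set.mem_insert_of_mem _ (Set.mem_singleton _))
    have : Finite (Subgroup.closure {a, b}) :=
      Finite.of_injective _ (Subgroup.inclusion_injective hK)
    have hsK : Subgroup.zpowers a ≤ Subgroup.closure {a, b} := by rwa [Subgroup.zpowers_le]
    have hs : Subgroup.zpowers a = stab G u :=
      Subgroup.eq_of_le_of_card_ge hle (by rw [hcard, Nat.card_zpowers])
    obtain ⟨c, hc⟩ := Subgroup.card_dvd_of_le hsK
    rw [Nat.card_zpowers] at hc
    have hc1 : c ≠ 1 := fun h => by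
      have h1 := Subgroup.eq_of_le_of_card_ge hsK (by rw [Nat.card_zpowers, hc, h, mul_one])
      rw [← h1, hs] at hbK
      exact hbu hbK
    have hc0 : c ≠ 0 := fun h => by
      rw [h, mul_zero] at hc
      exact Nat.card_pos.ne' hc
    refine Subgroup.eq_of_le_of_card_ge hK ?_
    rw [← ho, hc, mul_comm]
    exact Nat.mul_le_mul_left _ (by omega)

end KohnSpectrum

namespace KohnSpectrum

theorem qre_pow_two (g : UQ) : qre (g ^ 2) = 2 * qre g ^ 2 - 1 := by
  rw [qre_pow_add_two g 0, zero_add, pow_one, pow_zero, qre_one]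
  ring

theorem qre_pow_three (g : UQ) : qre (g ^ 3) = 4 * qre g ^ 3 - 3 * qre g := by
  rw [qre_pow_add_two g 1, qre_pow_two, pow_one]
  ring

theorem qre_pow_four (g : UQ) : qre (g ^ 4) = 8 * qre g ^ 4 - 8 * qre g ^ 2 + 1 := by
  rw [qre_pow_add_two g 2, qre_pow_three, qre_pow_two]
  ring

theorem qre_pow_five (g : UQ) : qre (g ^ 5) = 16 * qre g ^ 5 - 20 * qre g ^ 3 + 5 * qre g := by
  rw [qre_pow_add_two g 3, qre_pow_four, qre_pow_three]
  ring

theorem qre_pow_sq_eq_one {g : UQ} {n : ℕ} (h : g ^ (2 * n) = 1) : qre (g ^ n) ^ 2 = 1 := by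
  have h1 := qre_pow_two (g ^ n)
  rw [← pow_mul, mul_comm n 2, h, qre_one] at h1
  linarith

theorem qre_of_pow_four {g : UQ} (hg : qre g ^ 2 ≠ 1) (h : g ^ 4 = 1) : qre g = 0 := by
  have h1 := qre_pow_sq_eq_one (n := 2) h
  rw [qre_pow_two] at h1
  have h2 : (qre g ^ 2 - 1) * (qre g) ^ 2 = 0 := by linear_combination h1 / 4
  exact pow_eq_zero_iff two_ne_zero |>.1 ((mul_eq_zero.1 h2).resolve_left (sub_ne_zero.2 hg))

theorem qre_of_pow_six {g : UQ} (hg : qre g ^ 2 ≠ 1) (h : g ^ 6 = 1) :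
    qre g = 1 / 2 ∨ qre g = -(1 / 2) := by
  have h1 := qre_pow_sq_eq_one (n := 3) h
  rw [qre_pow_three] at h1
  have h2 : (qre g ^ 2 - 1) * (4 * qre g ^ 2 - 1) ^ 2 = 0 := by linear_combination h1
  have h3 := pow_eq_zero_iff two_ne_zero |>.1 ((mul_eq_zero.1 h2).resolve_left (sub_ne_zero.2 hg))
  have h4 : (qre g - 1 / 2) * (qre g + 1 / 2) = 0 := by linear_combination h3 / 4
  rcases mul_eq_zero.1 h4 with h5 | h5
  · left; linarith
  · right; linarith

theorem qre_of_pow_eight {g : UQ} (hg : qre g ^ 2 ≠ 1) (h : g ^ 8 = 1) :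
    qre g = 0 ∨ qre g = √2 / 2 ∨ qre g = -(√2 / 2) := by
  have h1 := qre_pow_sq_eq_one (n := 4) h
  rw [qre_pow_four] at h1
  have hs : √2 ^ 2 = 2 := Real.sq_sqrt (by norm_num)
  have h2 : (qre g ^ 2 - 1) * (qre g * (2 * qre g ^ 2 - 1)) ^ 2 = 0 := by
    linear_combination h1 / 16
  have h3 := pow_eq_zero_iff two_ne_zero |>.1 ((mul_eq_zero.1 h2).resolve_left (sub_ne_zero.2 hg))
  have h4 : qre g * ((qre g - √2 / 2) * (qre g + √2 / 2)) = 0 := by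
    linear_combination h3 / 2 - qre g / 4 * hs
  rcases mul_eq_zero.1 h4 with h5 | h5
  · exact Or.inl h5
  · rcases mul_eq_zero.1 h5 with h6 | h6
    · right; left; linarith
    · right; right; linarith

theorem qre_of_pow_ten {g : UQ} (hg : qre g ^ 2 ≠ 1) (h : g ^ 10 = 1) :
    qre g = (1 + √5) / 4 ∨ qre g = (1 - √5) / 4 ∨ qre g = -((1 + √5) / 4) ∨
      qre g = -((1 - √5) / 4) := by
  have h1 := qre_pow_sq_eq_one (n := 5) h
  rw [qre_pow_five] at h1
  have hs : √5 ^ 2 = 5 := Real.sq_sqrt (by norm_num)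
  have h2 : (qre g ^ 2 - 1) * (16 * qre g ^ 4 - 12 * qre g ^ 2 + 1) ^ 2 = 0 := by
    linear_combination h1
  have h3 := pow_eq_zero_iff two_ne_zero |>.1 ((mul_eq_zero.1 h2).resolve_left (sub_ne_zero.2 hg))
  have h4 : ((qre g - (1 + √5) / 4) * (qre g - (1 - √5) / 4)) *
      ((qre g + (1 + √5) / 4) * (qre g + (1 - √5) / 4)) = 0 := by
    have e1 : (qre g - (1 + √5) / 4) * (qre g - (1 - √5) / 4) = qre g ^ 2 - qre g / 2 - 1 / 4 := by
      linear_combination -hs / 16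
    have e2 : (qre g + (1 + √5) / 4) * (qre g + (1 - √5) / 4) = qre g ^ 2 + qre g / 2 - 1 / 4 := by
      linear_combination -hs / 16
    rw [e1, e2]
    linear_combination h3 / 16
  rcases mul_eq_zero.1 h4 with h5 | h5 <;> rcases mul_eq_zero.1 h5 with h6 | h6
  · left; linarith
  · right; left; linarith
  · right; right; left; linarith
  · right; right; right; linarith

theorem sqrt_five_bounds : 2.2 < √5 ∧ √5 < 2.3 :=
  ⟨Real.lt_sqrt_of_sq_lt (by norm_num), (Real.sqrt_lt' (by norm_num)).2 (by norm_num)⟩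

theorem sqrt_two_bounds : 1.4 < √2 ∧ √2 < 1.5 :=
  ⟨Real.lt_sqrt_of_sq_lt (by norm_num), (Real.sqrt_lt' (by norm_num)).2 (by norm_num)⟩

theorem IsPolyhedral.cases {G : Subgroup UQ} {k : ℕ} (h : IsPolyhedral G k) : (k = 3 ∧ Nat.card G = 24) ∨
    (k = 4 ∧ Nat.card G = 48) ∨ (k = 5 ∧ Nat.card G = 120) := by
  have h1 := h.three_le
  have h2 := h.le_five
  have h3 := h.card_eq
  interval_cases k <;> omega

variable {G : Subgroup UQ} [Finite G] {k : ℕ}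

theorem IsPolyhedral.neg_one_mem (h : IsPolyhedral G k) : -1 ∈ G :=
  neg_one_mem_of_even (by rcases h.cases with h | h | h <;> omega)

theorem IsPolyhedral.card_stab_le (h : IsPolyhedral G k) {u : UQ} (hu : qre u = 0) :
    Nat.card (stab G u) ≤ 10 := by
  obtain ⟨a, ha, ho, -⟩ := exists_orderOf_eq_card_stab G hu
  rw [← ho]
  by_cases h1 : qre a ^ 2 = 1
  · have h2 : a * a = 1 := mul_self_eq_one.2 (qre_sq_eq_one.1 h1)
    rw [← pow_two] at h2
    exact (orderOf_le_of_pow_eq_one (by norm_num) h2).trans (by norm_num)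
  · have := h.three_le
    have := h.le_five
    rcases h.pow_eq_one a (stab_le G u ha) h1 with h2 | h2 | h2 <;>
      exact (orderOf_le_of_pow_eq_one (by omega) h2).trans (by omega)

theorem IsPolyhedral.exists_qre_eq (h : IsPolyhedral G k) : ∃ a ∈ G, qre a = Real.cos (π / k) := by
  obtain ⟨u, hu, hc⟩ := h.exists_axis
  obtain ⟨a, ha, ho, -⟩ := exists_orderOf_eq_card_stab G hu
  rw [hc] at ho
  have h3 := h.three_le
  have haG := stab_le G u ha
  have ha1 : qre a ^ 2 ≠ 1 := fun h1 => by
    have h2 : a * a = 1 := mul_self_eq_one.2 (qre_sq_eq_one.1 h1)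
    rw [← pow_two] at h2
    have := orderOf_le_of_pow_eq_one (by norm_num) h2
    omega
  have hneg : ∀ x ∈ G, -x ∈ G := fun x hx => by
    rw [← neg_one_mul]
    exact G.mul_mem h.neg_one_mem hx
  have h2k : a ^ (2 * k) = 1 := by rw [← ho, pow_orderOf_eq_one]
  rcases h.cases with ⟨rfl, -⟩ | ⟨rfl, -⟩ | ⟨rfl, -⟩
  · rw [show (((3 : ℕ) : ℝ)) = 3 by norm_num, Real.cos_pi_div_three]
    rcases qre_of_pow_six ha1 h2k with h4 | h4
    · exact ⟨a, haG, h4⟩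
    · exact ⟨-a, hneg a haG, by rw [qre_neg, h4, neg_neg]⟩
  · rw [show (((4 : ℕ) : ℝ)) = 4 by norm_num, Real.cos_pi_div_four]
    rcases qre_of_pow_eight ha1 h2k with h4 | h4 | h4
    · exfalso
      have h5 : a ^ 4 = 1 := by
        rw [show 4 = 2 * 2 by norm_num, pow_mul, pow_two a, mul_self_eq_neg_one.2 h4, neg_one_sq]
      have := orderOf_le_of_pow_eq_one (by norm_num) h5
      omega
    · exact ⟨a, haG, h4⟩
    · exact ⟨-a, hneg a haG, by rw [qre_neg, h4, neg_neg]⟩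
  · rw [show (((5 : ℕ) : ℝ)) = 5 by norm_num, Real.cos_pi_div_five]
    have hs : √5 ^ 2 = 5 := Real.sq_sqrt (by norm_num)
    have hsq : 4 * qre (a ^ 2) = -1 + √5 ∨ 4 * qre (a ^ 2) = -1 - √5 := by
      rw [qre_pow_two]
      rcases qre_of_pow_ten ha1 h2k with h4 | h4 | h4 | h4 <;> rw [h4]
      · left; linear_combination hs / 2
      · right; linear_combination hs / 2
      · left; linear_combination hs / 2
      · right; linear_combination hs / 2
    rcases hsq with h4 | h4
    · refine ⟨-(a ^ 2) ^ 2, hneg _ (G.pow_mem (G.pow_mem haG 2) 2), ?_⟩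
      rw [qre_neg, qre_pow_two]
      have h5 : qre (a ^ 2) = (-1 + √5) / 4 := by linarith
      rw [h5]
      linear_combination -hs / 8
    · refine ⟨-a ^ 2, hneg _ (G.pow_mem haG 2), ?_⟩
      rw [qre_neg]
      linarith

theorem IsPolyhedral.exists_not_commute (h : IsPolyhedral G k) {a : UQ} (ha : a ∈ G)
    (ha1 : qre a ^ 2 ≠ 1) : ∃ b ∈ G, qre b = qre a ∧ a * b ≠ b * a := by
  by_contra! hcon
  obtain ⟨u, hu⟩ := exists_isAxis ha1
  have key : ∀ g ∈ G, g * u * g⁻¹ = u ∨ g * u * g⁻¹ = -u := fun g hg => by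
    have h1 := hcon (g * a * g⁻¹) (G.mul_mem (G.mul_mem hg ha) (G.inv_mem hg)) (qre_conj g a)
    exact eq_or_eq_neg_of_isAxis (by rwa [qre_conj]) (isAxis_of_commute ha1 hu h1) (isAxis_conj g hu)
  have hle := h.card_stab_le hu.qre_eq_zero
  have h24 : 24 ≤ Nat.card G := by rcases h.cases with h | h | h <;> omega
  obtain ⟨c, hc, hcu⟩ : ∃ c ∈ G, c ∉ stab G u := by
    by_contra! h1
    rw [le_antisymm (stab_le G u) h1] at hle
    omega
  have hneg : ∀ x ∈ G, x ∉ stab G u → x * u * x⁻¹ = -u := fun x hx hxu =>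
    (key x hx).resolve_left fun h1 => hxu (mem_stab.2 ⟨hx, mul_inv_eq_iff_eq_mul.1 h1⟩)
  have hi : ((stab G u).subgroupOf G).index = 2 := by
    rw [Subgroup.index_eq_two_iff]
    refine ⟨⟨c, hc⟩, fun b => ?_⟩
    rw [Subgroup.mem_subgroupOf, Subgroup.mem_subgroupOf, Subgroup.coe_mul]
    by_cases hb : (b : UQ) ∈ stab G u
    · exact Or.inr ⟨hb, fun h1 => hcu (((stab G u).mul_mem_cancel_left hb).1 h1)⟩
    · refine Or.inl ⟨mem_stab.2 ⟨G.mul_mem b.2 hc, mul_inv_eq_iff_eq_mul.1 ?_⟩, hb⟩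
      calc b * c * u * (b * c : UQ)⁻¹ = b * (c * u * c⁻¹) * (b : UQ)⁻¹ := by group
        _ = u := by rw [hneg c hc hcu, mul_neg, neg_mul, hneg b b.2 hb, neg_neg]
  have h1 := index_stab (G := G) (u := u)
  rw [hi] at h1
  omega

/-- The real part of the product of two suitable generators of a binary polyhedral group. -/
def polyMulRe (k : ℕ) : ℝ := if k = 3 then 0 else 1 / 2

theorem IsPolyhedral.exists_pair (h : IsPolyhedral G k) : ∃ a ∈ G, ∃ b ∈ G,
    qre a = Real.cos (π / k) ∧ qre b = Real.cos (π / k) ∧ qre (a * b) = polyMulRe k ∧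
      a * b ≠ b * a := by
  obtain ⟨a, ha, hac⟩ := h.exists_qre_eq
  obtain ⟨hs1, hs2⟩ := sqrt_five_bounds
  obtain ⟨ht1, ht2⟩ := sqrt_two_bounds
  have hs : √5 ^ 2 = 5 := Real.sq_sqrt (by norm_num)
  have ht : √2 ^ 2 = 2 := Real.sq_sqrt (by norm_num)
  have ha1 : qre a ^ 2 ≠ 1 := by
    rw [hac]
    rcases h.cases with ⟨rfl, -⟩ | ⟨rfl, -⟩ | ⟨rfl, -⟩
    · rw [show (((3 : ℕ) : ℝ)) = 3 by norm_num, Real.cos_pi_div_three]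
      norm_num
    · rw [show (((4 : ℕ) : ℝ)) = 4 by norm_num, Real.cos_pi_div_four]
      intro h1
      linarith
    · rw [show (((5 : ℕ) : ℝ)) = 5 by norm_num, Real.cos_pi_div_five]
      intro h1
      linarith
  obtain ⟨b, hb, hba, hne⟩ := h.exists_not_commute ha ha1
  have hne' : a * b⁻¹ ≠ b⁻¹ * a := fun h1 => hne (by
    rw [eq_inv_mul_iff_mul_eq, ← mul_assoc, mul_inv_eq_iff_eq_mul] at h1
    exact h1.symm)
  suffices H : qre (a * b) = polyMulRe k ∨ qre (a * b⁻¹) = polyMulRe k by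
    rcases H with H | H
    · exact ⟨a, ha, b, hb, hac, hba.trans hac, H, hne⟩
    · exact ⟨a, ha, b⁻¹, G.inv_mem hb, hac, (qre_inv b).trans (hba.trans hac), H, hne'⟩
  have hx1 : qre (a * b) ^ 2 ≠ 1 := fun h1 => hne (by
    have h2 := commute_of_mem_signSubgroup h1 a
    rw [mul_assoc] at h2
    exact (mul_left_cancel h2).symm)
  have hy1 : qre (a * b⁻¹) ^ 2 ≠ 1 := fun h1 => hne' (by
    have h2 := commute_of_mem_signSubgroup h1 a
    rw [mul_assoc] at h2
    exact (mul_left_cancel h2).symm)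
  have hx := h.pow_eq_one _ (G.mul_mem ha hb) hx1
  have hy := h.pow_eq_one _ (G.mul_mem ha (G.inv_mem hb)) hy1
  have hxy := qre_mul_add a b
  rw [hba, hac] at hxy
  have hx4 := qre_of_pow_four hx1
  have hx6 := qre_of_pow_six hx1
  have hy4 := qre_of_pow_four hy1
  have hy6 := qre_of_pow_six hy1
  unfold polyMulRe
  rcases h.cases with ⟨rfl, -⟩ | ⟨rfl, -⟩ | ⟨rfl, -⟩
  · rw [show (((3 : ℕ) : ℝ)) = 3 by norm_num, Real.cos_pi_div_three] at hxy
    rw [if_pos rfl]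
    have hx' := hx.imp hx4 fun h => h.elim hx6 hx6
    have hy' := hy.imp hy4 fun h => h.elim hy6 hy6
    rcases hx' with e | e | e
    · exact Or.inl e
    all_goals
      rcases hy' with f | f | f
      · exact Or.inr f
      all_goals exfalso; rw [e, f] at hxy; norm_num at hxy
  · rw [show (((4 : ℕ) : ℝ)) = 4 by norm_num, Real.cos_pi_div_four] at hxy
    rw [if_neg (by norm_num)]
    have hx' := hx.imp hx4 fun h => h.imp hx6 (qre_of_pow_eight hx1)
    have hy' := hy.imp hy4 fun h => h.imp hy6 (qre_of_pow_eight hy1)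
    rcases hx' with e | (e | e) | (e | e | e)
    on_goal 2 => exact Or.inl e
    all_goals
      rcases hy' with f | (f | f) | (f | f | f)
      on_goal 2 => exact Or.inr f
      all_goals exfalso; rw [e, f] at hxy; linarith
  · rw [show (((5 : ℕ) : ℝ)) = 5 by norm_num, Real.cos_pi_div_five] at hxy
    rw [if_neg (by norm_num)]
    have hx' := hx.imp hx4 fun h => h.imp hx6 (qre_of_pow_ten hx1)
    have hy' := hy.imp hy4 fun h => h.imp hy6 (qre_of_pow_ten hy1)
    rcases hx' with e | (e | e) | (e | e | e | e)
    on_goal 2 => exact Or.inl e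
    all_goals
      rcases hy' with f | (f | f) | (f | f | f | f)
      on_goal 2 => exact Or.inr f
      all_goals exfalso; rw [e, f] at hxy; linarith

end KohnSpectrum

namespace KohnSpectrum

open scoped Quaternion

variable {G : Subgroup UQ} [Finite G] {k : ℕ}

theorem cos_pi_div_values : 0 < Real.cos (π / (3 : ℕ)) ∧ 0.6 < Real.cos (π / (4 : ℕ)) ∧
    0.6 < Real.cos (π / (5 : ℕ)) := by
  have h3 : ((3 : ℕ) : ℝ) = 3 := by norm_num
  have h4 : ((4 : ℕ) : ℝ) = 4 := by norm_num
  have h5 : ((5 : ℕ) : ℝ) = 5 := by norm_num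
  rw [h3, h4, h5, Real.cos_pi_div_three, Real.cos_pi_div_four, Real.cos_pi_div_five]
  obtain ⟨hs1, -⟩ := sqrt_five_bounds
  obtain ⟨ht1, -⟩ := sqrt_two_bounds
  exact ⟨by norm_num, by linarith, by linarith⟩

theorem IsPolyhedral.closure_eq (h : IsPolyhedral G k) {a b : UQ} (ha : a ∈ G) (hb : b ∈ G)
    (hac : qre a = Real.cos (π / k)) (hbc : qre b = Real.cos (π / k)) (hne : a * b ≠ b * a) :
    Subgroup.closure {a, b} = G := by
  obtain ⟨h3, h4, h5⟩ := cos_pi_div_values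
  have hpos : 0 < Real.cos (π / k) := by
    rcases h.cases with ⟨rfl, -⟩ | ⟨rfl, -⟩ | ⟨rfl, -⟩ <;> linarith
  have hK : Subgroup.closure {a, b} ≤ G := by
    rw [Subgroup.closure_le, Set.insert_subset_iff, Set.singleton_subset_iff]
    exact ⟨ha, hb⟩
  have haK : a ∈ Subgroup.closure {a, b} := Subgroup.subset_closure (Set.mem_insert _ _)
  have hbK : b ∈ Subgroup.closure {a, b} :=
    Subgroup.subset_closure (Set.mem_insert_of_mem _ (Set.mem_singleton _))
  have : Finite (Subgroup.closure {a, b}) :=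
    Finite.of_injective _ (Subgroup.inclusion_injective hK)
  rcases dihedral_or_polyhedral _ (not_isCyclic_of_not_commute haK hbK hne) with
    ⟨u, hu, hc, hlt⟩ | ⟨l, hl⟩
  · exfalso
    obtain ⟨g, hg, hg1⟩ : ∃ g ∈ stab (Subgroup.closure {a, b}) u, qre g ^ 2 ≠ 1 := by
      by_contra! h1
      have hle : stab (Subgroup.closure {a, b}) u ≤ Subgroup.closure {a, b} ⊓ signSubgroup :=
        fun g hg => ⟨stab_le _ u hg, h1 g hg⟩
      exact absurd (Subgroup.card_le_of_le hle) hlt.not_ge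
    have key : ∀ x ∈ Subgroup.closure {a, b}, qre x = Real.cos (π / k) → x * u = u * x :=
      fun x hx hxc => by
        by_contra h1
        have := qre_eq_zero_of_notMem_stab hu hc hg hg1 hx fun h2 => h1 (mem_stab.1 h2).2
        linarith
    exact hne (commute_of_commute hu (key a haK hac) (key b hbK hbc))
  · refine Subgroup.eq_of_le_of_card_ge hK ?_
    have hdvd := Subgroup.card_dvd_of_le hK
    by_cases hl3 : l = 3 ∧ k ≠ 3
    · exfalso
      obtain ⟨rfl, hk⟩ := hl3
      have hbig : 0.6 < qre a := by
        rw [hac]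
        rcases h.cases with ⟨rfl, -⟩ | ⟨rfl, -⟩ | ⟨rfl, -⟩
        · exact absurd rfl hk
        · exact h4
        · exact h5
      have ha1 : qre a ^ 2 ≠ 1 := fun h1 => hne (commute_of_mem_signSubgroup h1 b)
      have hor : qre a = 0 ∨ qre a = 1 / 2 ∨ qre a = -(1 / 2) :=
        (hl.pow_eq_one a haK ha1).imp (qre_of_pow_four ha1)
          fun h => h.elim (qre_of_pow_six ha1) (qre_of_pow_six ha1)
      rcases hor with e | e | e <;> rw [e] at hbig <;> norm_num at hbig
    · rcases h.cases with h | h | h <;> rcases hl.cases with h' | h' | h' <;>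
        first
        | omega
        | (rw [h.2, h'.2] at hdvd; omega)

theorem IsPolyhedral.nonempty_mulEquiv {G' : Subgroup UQ} [Finite G'] (h : IsPolyhedral G k)
    (h' : IsPolyhedral G' k) : Nonempty (G ≃* G') := by
  obtain ⟨a, ha, b, hb, hac, hbc, hab, hne⟩ := h.exists_pair
  obtain ⟨a', ha', b', hb', hac', hbc', hab', hne'⟩ := h'.exists_pair
  have := nonempty_mulEquiv_of_pairs (hac.trans hac'.symm) (hbc.trans hbc'.symm)
    (hab.trans hab'.symm) hne
  rwa [h.closure_eq ha hb hac hbc hne, h'.closure_eq ha' hb' hac' hbc' hne'] at this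

theorem exists_mem_qre_eq {G G' : Subgroup UQ} [Finite G] [Finite G']
    (h : ∀ c, reCount G c = reCount G' c) {a : UQ} (ha : a ∈ G) : ∃ a' ∈ G', qre a' = qre a := by
  have h1 : 0 < reCount G (qre a) := by
    have : Nonempty {g : G // ((g : UQ) : ℍ[ℝ]).re = qre a} := ⟨⟨⟨a, ha⟩, rfl⟩⟩
    exact Nat.card_pos
  rw [h] at h1
  obtain ⟨⟨g, hg⟩⟩ := (Nat.card_pos_iff.1 h1).1
  exact ⟨g, g.2, hg⟩

theorem isCyclic_of_reCount_eq {G G' : Subgroup UQ} [Finite G] [Finite G']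
    (hN : Nat.card G = Nat.card G') (h : ∀ c, reCount G c = reCount G' c) (hG : IsCyclic G) :
    IsCyclic G' := by
  obtain ⟨a, ha⟩ := IsCyclic.exists_ofOrder_eq_natCard (α := G)
  obtain ⟨a', ha', he⟩ := exists_mem_qre_eq h a.2
  refine isCyclic_of_orderOf_eq_card (⟨a', ha'⟩ : G') ?_
  rw [← hN, ← ha, ← Subgroup.orderOf_coe, ← Subgroup.orderOf_coe]
  exact orderOf_eq_of_qre_eq he

theorem nonempty_mulEquiv_of_dihedral {G G' : Subgroup UQ} [Finite G] [Finite G']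
    (hN : Nat.card G = Nat.card G') (h : ∀ c, reCount G c = reCount G' c) (hG : ¬ IsCyclic G)
    (hG' : ¬ IsCyclic G') {u : UQ} (hu : qre u = 0) (hc : 2 * Nat.card (stab G u) = Nat.card G)
    (hlt : Nat.card (G ⊓ signSubgroup : Subgroup UQ) < Nat.card (stab G u)) :
    Nonempty (G ≃* G') := by
  obtain ⟨a, ha, ho, hz⟩ := exists_orderOf_eq_card_stab G hu
  have haG := stab_le G u ha
  have ha1 : qre a ^ 2 ≠ 1 := fun h1 => by
    have : stab G u ≤ G ⊓ signSubgroup := by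
      rw [← hz, Subgroup.zpowers_le]
      exact ⟨haG, h1⟩
    exact absurd (Subgroup.card_le_of_le this) hlt.not_ge
  obtain ⟨a', ha', he⟩ := exists_mem_qre_eq h haG
  obtain ⟨b, hb, hab, hne, hcl⟩ := exists_generators_of_orderOf hG haG ha1 (by rw [ho, hc])
  obtain ⟨b', hb', hab', -, hcl'⟩ := exists_generators_of_orderOf hG' ha' (by rwa [he])
    (by rw [orderOf_eq_of_qre_eq he, ho, hc, hN])
  have := nonempty_mulEquiv_of_pairs he.symm (hb.trans hb'.symm) (hab.trans hab'.symm) hne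
  rwa [hcl, hcl'] at this

theorem nonempty_mulEquiv_of_reCount_eq {G G' : Subgroup UQ} [Finite G] [Finite G']
    (hN : Nat.card G = Nat.card G') (h : ∀ c, reCount G c = reCount G' c) :
    Nonempty (G ≃* G') := by
  by_cases hG : IsCyclic G
  · have := isCyclic_of_reCount_eq hN h hG
    exact ⟨mulEquivOfCyclicCardEq hN⟩
  · have hG' : ¬ IsCyclic G' := fun h1 => hG (isCyclic_of_reCount_eq hN.symm (fun c => (h c).symm) h1)
    rcases dihedral_or_polyhedral G hG with ⟨u, hu, hc, hlt⟩ | ⟨k, hk⟩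
    · exact nonempty_mulEquiv_of_dihedral hN h hG hG' hu hc hlt
    · rcases dihedral_or_polyhedral G' hG' with ⟨u, hu, hc, hlt⟩ | ⟨l, hl⟩
      · obtain ⟨e⟩ := nonempty_mulEquiv_of_dihedral hN.symm (fun c => (h c).symm) hG' hG hu hc hlt
        exact ⟨e.symm⟩
      · obtain rfl : k = l := by
          rcases hk.cases with h1 | h1 | h1 <;> rcases hl.cases with h2 | h2 | h2 <;> omega
        exact hk.nonempty_mulEquiv hl

theorem range_quatHom_comap {G : Subgroup (Matrix.unitaryGroup (Fin 2) ℂ)}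
    (hG : ∀ g ∈ G, Matrix.det (g : Matrix (Fin 2) (Fin 2) ℂ) = 1) :
    Set.range (quatHom.comp (G.comap quatHom).subtype) = G := by
  ext g
  constructor
  · rintro ⟨q, rfl⟩
    exact q.2
  · intro hg
    obtain ⟨q, rfl⟩ := exists_quatHom_eq (hG g hg)
    exact ⟨⟨q, hg⟩, rfl⟩

end KohnSpectrum

/-- Isospectral quotients of `S³` by finite subgroups of `SU(2)` have isomorphic groups. -/
theorem isospectral_SU2_isomorphic
    (G G' : Subgroup (Matrix.unitaryGroup (Fin 2) ℂ))
    (hGfin : Finite G) (hG'fin : Finite G')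
    (hGdet : ∀ g ∈ G, Matrix.det (g : Matrix (Fin 2) (Fin 2) ℂ) = 1)
    (hG'det : ∀ g ∈ G', Matrix.det (g : Matrix (Fin 2) (Fin 2) ℂ) = 1)
    (hspec : ∀ lam : ℕ, 0 < lam → specMult (G : Set _) lam = specMult (G' : Set _) lam) :
    Nonempty (G ≃* G') := by
  have hr := KohnSpectrum.range_quatHom_comap hGdet
  have hr' := KohnSpectrum.range_quatHom_comap hG'det
  obtain ⟨e⟩ := KohnSpectrum.nonempty_comap_quatHom_mulEquiv hGdet
  obtain ⟨e'⟩ := KohnSpectrum.nonempty_comap_quatHom_mulEquiv hG'det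
  have := Finite.of_equiv G e.symm.toEquiv
  have := Finite.of_equiv G' e'.symm.toEquiv
  obtain ⟨hN, hc⟩ := KohnSpectrum.card_eq_and_reCount_eq (H := G.comap KohnSpectrum.quatHom)
    (K := G'.comap KohnSpectrum.quatHom) fun m hm => by
      rw [hr, hr']
      exact KohnSpectrum.dimHpqInv_zero_eq_of_specMult_eq hGdet hG'det hspec m hm
  obtain ⟨f⟩ := KohnSpectrum.nonempty_mulEquiv_of_reCount_eq hN hc
  exact ⟨e.symm.trans (f.trans e')⟩
end
end

section
/- Let G ⊆ U(2) be a finite subgroup acting freely on S^3 (no element other than the identity has 1 as an eigenvalue). If G is non-abelian, then dim_ℂ H_{1,1}^G = 0 and dim_ℂ H_{0,2}^G = 0. If G is abelian, then dim_ℂ H_{1,1}^G ≥ 1. Consequently, the multiplicity of the eigenvalue 4 of the Kohn Laplacian on G\S^3, namely dim_ℂ H_{1,1}^G + dim_ℂ H_{0,2}^G, is zero if G is non-abelian and positive if G is abelian. -/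
noncomputable section

open MvPolynomial Matrix Complex Real Filter

/-- The polynomial `∑ i j, M i j * X (ι i) * X (κ j)` attached to a matrix `M`. -/
def bilinPoly {m σ : Type*} [Fintype m] (ι κ : m → σ) :
    Matrix m m ℂ →ₗ[ℂ] MvPolynomial σ ℂ where
  toFun M := ∑ i, ∑ j, C (M i j) * (X (ι i) * X (κ j))
  map_add' M N := by simp [add_mul, Finset.sum_add_distrib]
  map_smul' c M := by simp [Finset.mul_sum, MvPolynomial.smul_eq_C_mul, mul_assoc]

lemma bilinPoly_apply {m σ : Type*} [Fintype m] (ι κ : m → σ) (M : Matrix m m ℂ) :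
    bilinPoly ι κ M = ∑ i, ∑ j, C (M i j) * (X (ι i) * X (κ j)) := rfl

lemma bilinPoly_single {m σ : Type*} [Fintype m] [DecidableEq m] (ι κ : m → σ) (i j : m) (c : ℂ) :
    bilinPoly ι κ (Matrix.single i j c) = C c * (X (ι i) * X (κ j)) := by
  rw [bilinPoly_apply, Finset.sum_eq_single i, Finset.sum_eq_single j]
  · simp
  · intro b _ hb; simp [hb.symm]
  · simp
  · intro b _ hb; simp [hb.symm]
  · simp

/-- A linear substitution acts on `bilinPoly` by congruence. -/
lemma map_bilinPoly {m σ : Type*} [Fintype m] (ι κ : m → σ)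
    (F : MvPolynomial σ ℂ →ₐ[ℂ] MvPolynomial σ ℂ) (P Q : Matrix m m ℂ)
    (hP : ∀ i, F (X (ι i)) = ∑ k, C (P i k) * X (ι k))
    (hQ : ∀ j, F (X (κ j)) = ∑ l, C (Q j l) * X (κ l)) (M : Matrix m m ℂ) :
    F (bilinPoly ι κ M) = bilinPoly ι κ (Pᵀ * M * Q) := by
  classical
  have hC : ∀ c : ℂ, F (C c) = C c := fun c => F.commutes c
  induction M using Matrix.induction_on' with
  | h_zero => simp
  | h_add M N hM hN => simp only [mul_add, add_mul, map_add, hM, hN]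
  | h_std_basis i j c =>
    rw [bilinPoly_single, map_mul, map_mul, hC, hP, hQ, Finset.sum_mul_sum, Finset.mul_sum,
      bilinPoly_apply]
    refine Finset.sum_congr rfl fun k _ => ?_
    rw [Finset.mul_sum]
    refine Finset.sum_congr rfl fun l _ => ?_
    have : (Pᵀ * Matrix.single i j c * Q) k l = P i k * c * Q j l := by
      simp [Matrix.mul_apply, Matrix.single_apply, ite_and, Finset.sum_ite_eq]
    rw [this, map_mul, map_mul]
    ring

lemma uAct_bilinPoly_inr_inl {n : ℕ} (g : Matrix.unitaryGroup (Fin n) ℂ)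
    (M : Matrix (Fin n) (Fin n) ℂ) :
    uAct n g (bilinPoly Sum.inr Sum.inl M) =
      bilinPoly Sum.inr Sum.inl
        (((g⁻¹ : Matrix.unitaryGroup (Fin n) ℂ) : Matrix (Fin n) (Fin n) ℂ)ᴴ * M *
          ((g⁻¹ : Matrix.unitaryGroup (Fin n) ℂ) : Matrix (Fin n) (Fin n) ℂ)) :=
  map_bilinPoly _ _ _ (((g⁻¹ : Matrix.unitaryGroup (Fin n) ℂ) : Matrix (Fin n) (Fin n) ℂ).map star)
    _ (fun i => by simp [uAct]) (fun j => by simp [uAct]) M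

lemma uAct_bilinPoly_inr_inr {n : ℕ} (g : Matrix.unitaryGroup (Fin n) ℂ)
    (M : Matrix (Fin n) (Fin n) ℂ) :
    uAct n g (bilinPoly Sum.inr Sum.inr M) =
      bilinPoly Sum.inr Sum.inr
        (((g⁻¹ : Matrix.unitaryGroup (Fin n) ℂ) : Matrix (Fin n) (Fin n) ℂ)ᴴ * M *
          ((g⁻¹ : Matrix.unitaryGroup (Fin n) ℂ) : Matrix (Fin n) (Fin n) ℂ).map star) :=
  map_bilinPoly _ _ _ (((g⁻¹ : Matrix.unitaryGroup (Fin n) ℂ) : Matrix (Fin n) (Fin n) ℂ).map star)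
    _ (fun i => by simp [uAct]) (fun j => by simp [uAct]) M

lemma kohnLap_bilinPoly_inr_inl (M : Matrix (Fin 2) (Fin 2) ℂ) :
    kohnLap 2 (bilinPoly Sum.inr Sum.inl M) = C M.trace := by
  simp [kohnLap, bilinPoly_apply, Fin.sum_univ_two, Matrix.trace, pderiv_X]

lemma bilinPoly_inr_inl_injective :
    Function.Injective
      (bilinPoly (Sum.inr : Fin 2 → Var 2) (Sum.inl : Fin 2 → Var 2)) := by
  rw [injective_iff_map_eq_zero]
  intro M hM
  ext i j
  have h := congrArg (MvPolynomial.eval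
    (Sum.elim (Pi.single j 1) (Pi.single i 1) : Var 2 → ℂ)) hM
  fin_cases i <;> fin_cases j <;>
    simpa [bilinPoly_apply, Fin.sum_univ_two, Pi.single_apply] using h

lemma eq_of_bilinPoly_inr_inr_eq {M N : Matrix (Fin 2) (Fin 2) ℂ} (hM : M.IsSymm)
    (hN : N.IsSymm)
    (h : bilinPoly (Sum.inr : Fin 2 → Var 2) (Sum.inr : Fin 2 → Var 2) M =
      bilinPoly (Sum.inr : Fin 2 → Var 2) (Sum.inr : Fin 2 → Var 2) N) : M = N := by
  have key (v : Fin 2 → ℂ) := congrArg (MvPolynomial.eval (Sum.elim 0 v : Var 2 → ℂ)) h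
  have h0 := key ![1, 0]
  have h1 := key ![0, 1]
  have h2 := key ![1, 1]
  have hM' := hM.apply 0 1
  have hN' := hN.apply 0 1
  simp [bilinPoly_apply, Fin.sum_univ_two] at h0 h1 h2
  ext i j
  fin_cases i <;> fin_cases j <;> simp <;> grind

lemma weight_bidegWt_two {d : Var 2 →₀ ℕ} {p q : ℕ}
    (h : Finsupp.weight (bidegWt 2) d = (p, q)) :
    d (Sum.inl 0) + d (Sum.inl 1) = p ∧ d (Sum.inr 0) + d (Sum.inr 1) = q := by
  rw [Finsupp.weight_apply, Finsupp.sum_fintype _ _ (by simp)] at h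
  simpa [bidegWt, Fintype.sum_sum_type, Fin.sum_univ_two, Prod.ext_iff] using h

lemma mem_range_bilinPoly_of_bidegree_one_one {f : MvPolynomial (Var 2) ℂ}
    (hf : f ∈ weightedHomogeneousSubmodule ℂ (bidegWt 2) (1, 1)) :
    ∃ M, bilinPoly Sum.inr Sum.inl M = f := by
  change f ∈ LinearMap.range (bilinPoly Sum.inr Sum.inl)
  rw [f.as_sum]
  refine Submodule.sum_mem _ fun d hd => ?_
  have hw := hf (mem_support_iff.1 hd)
  have : ∃ i j : Fin 2, d = Finsupp.single (Sum.inr i) 1 + Finsupp.single (Sum.inl j) 1 := by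
    obtain ⟨h1, h2⟩ := weight_bidegWt_two hw
    refine ⟨if d (Sum.inr 0) = 1 then 0 else 1, if d (Sum.inl 0) = 1 then 0 else 1, ?_⟩
    ext (x | x) <;> fin_cases x <;> simp [Finsupp.single_apply] <;> grind
  obtain ⟨i, j, hij⟩ := this
  refine ⟨Matrix.single i j (coeff d f), ?_⟩
  rw [bilinPoly_single, X, X, monomial_mul, C_mul_monomial, ← hij]
  simp

lemma exists_isSymm_of_bidegree_zero_two {f : MvPolynomial (Var 2) ℂ}
    (hf : f ∈ weightedHomogeneousSubmodule ℂ (bidegWt 2) (0, 2)) :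
    ∃ M : Matrix (Fin 2) (Fin 2) ℂ, M.IsSymm ∧ bilinPoly Sum.inr Sum.inr M = f := by
  have hmem : f ∈ LinearMap.range (bilinPoly (Sum.inr : Fin 2 → Var 2) Sum.inr) := by
    rw [f.as_sum]
    refine Submodule.sum_mem _ fun d hd => ?_
    have hw := hf (mem_support_iff.1 hd)
    have : ∃ i j : Fin 2, d = Finsupp.single (Sum.inr i) 1 + Finsupp.single (Sum.inr j) 1 := by
      obtain ⟨h1, h2⟩ := weight_bidegWt_two hw
      refine ⟨if d (Sum.inr 0) = 0 then 1 else 0, if d (Sum.inr 0) = 2 then 0 else 1, ?_⟩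
      ext (x | x) <;> fin_cases x <;> simp [Finsupp.single_apply] <;> grind
    obtain ⟨i, j, hij⟩ := this
    refine ⟨Matrix.single i j (coeff d f), ?_⟩
    rw [bilinPoly_single, X, X, monomial_mul, C_mul_monomial, ← hij]
    simp
  obtain ⟨M, rfl⟩ := hmem
  refine ⟨(1 / 2 : ℂ) • (M + Mᵀ), ?_, ?_⟩
  · simp [Matrix.IsSymm, add_comm]
  · have hT : bilinPoly (Sum.inr : Fin 2 → Var 2) Sum.inr Mᵀ = bilinPoly Sum.inr Sum.inr M := by
      simp only [bilinPoly_apply, Matrix.transpose_apply]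
      rw [Finset.sum_comm]
      simp only [mul_comm]
    rw [map_smul, map_add, hT, ← two_smul ℂ, smul_smul]
    norm_num

/-- The centralizer of a non-scalar `2 × 2` matrix is commutative. -/
lemma commute_of_commute_nonscalar {K : Type*} [Field K] {M a b : Matrix (Fin 2) (Fin 2) K}
    (hM : ¬ ∃ c : K, M = c • 1) (ha : M * a = a * M) (hb : M * b = b * M) : a * b = b * a := by
  have hne : M 0 1 ≠ 0 ∨ M 1 0 ≠ 0 ∨ M 0 0 - M 1 1 ≠ 0 := by
    by_contra! h
    refine hM ⟨M 0 0, ?_⟩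
    ext i j
    fin_cases i <;> fin_cases j <;> simp [h.1, h.2.1, (sub_eq_zero.1 h.2.2).symm]
  have a1 := congrFun₂ ha 0 0
  have a2 := congrFun₂ ha 0 1
  have a3 := congrFun₂ ha 1 0
  have b1 := congrFun₂ hb 0 0
  have b2 := congrFun₂ hb 0 1
  have b3 := congrFun₂ hb 1 0
  simp only [Matrix.mul_apply, Fin.sum_univ_two] at a1 a2 a3 b1 b2 b3
  ext i j
  rcases hne with h | h | h <;> fin_cases i <;> fin_cases j <;>
    simp [Matrix.mul_apply, Fin.sum_univ_two] <;> apply mul_left_cancel₀ h <;> grind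

/-- `gᴴ M g = M` for a unitary matrix `g` means that `M` commutes with `g`. -/
lemma conjTranspose_mul_mul_eq_iff {n : ℕ} (g : Matrix.unitaryGroup (Fin n) ℂ)
    (M : Matrix (Fin n) (Fin n) ℂ) :
    (g : Matrix (Fin n) (Fin n) ℂ)ᴴ * M * g = M ↔
      M * (g : Matrix (Fin n) (Fin n) ℂ) = g * M := by
  have h1 : (g : Matrix (Fin n) (Fin n) ℂ)ᴴ * g = 1 := Matrix.UnitaryGroup.star_mul_self g
  have h2 : (g : Matrix (Fin n) (Fin n) ℂ) * (g : Matrix (Fin n) (Fin n) ℂ)ᴴ = 1 :=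
    mul_eq_one_comm.1 h1
  constructor
  · intro h
    nth_rewrite 2 [← h]
    rw [← mul_assoc, ← mul_assoc, h2, one_mul]
  · intro h
    rw [mul_assoc, h, ← mul_assoc, h1, one_mul]

/-- A matrix preserving a nondegenerate bilinear form has determinant one, unless it has the
eigenvalue `1`. -/
lemma det_eq_one_of_invariant_form {g B : Matrix (Fin 2) (Fin 2) ℂ} (hB : B.det ≠ 0)
    (h : gᵀ * B * g = B) (hfree : (g - 1).det = 0 → g = 1) : g.det = 1 := by
  have hd : g.det * g.det = 1 := by
    have := congrArg Matrix.det h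
    rw [Matrix.det_mul, Matrix.det_mul, Matrix.det_transpose] at this
    apply mul_left_cancel₀ hB
    linear_combination this
  have hadj : B * g * g.adjugate = g.det • B := by
    rw [mul_assoc, Matrix.mul_adjugate]; simp
  rcases mul_self_eq_one_iff.1 hd with h1 | h1
  · exact h1
  · have htr : g.trace = 0 := by
      have h2 : gᵀ * B = g.det • (B * g.adjugate) := by
        calc gᵀ * B = g.det • g.det • (gᵀ * B) := by rw [smul_smul, hd, one_smul]
          _ = g.det • (gᵀ * B * (g * g.adjugate)) := by rw [Matrix.mul_adjugate]; simp
          _ = g.det • (gᵀ * B * g * g.adjugate) := by simp only [mul_assoc]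
          _ = _ := by rw [h]
      have h3 : gᵀ * B * B⁻¹ = g.det • (B * g.adjugate * B⁻¹) := by rw [h2]; simp
      have hu : IsUnit B.det := isUnit_iff_ne_zero.2 hB
      rw [Matrix.mul_nonsing_inv_cancel_right _ _ hu] at h3
      have h4 := congrArg Matrix.trace h3
      rw [Matrix.trace_smul, Matrix.trace_mul_cycle, Matrix.nonsing_inv_mul _ hu, one_mul, h1,
        Matrix.trace_transpose, Matrix.adjugate_fin_two] at h4
      simp [Matrix.trace_fin_two] at h4 ⊢
      linear_combination h4 / 2
    have : (g - 1).det = 0 := by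
      rw [Matrix.det_fin_two] at h1 ⊢
      rw [Matrix.trace_fin_two] at htr
      simp
      linear_combination h1 - htr
    rw [hfree this, Matrix.det_one]

/-- A matrix of determinant one preserving the symmetric form `B` commutes with the traceless
matrix `J B`. -/
lemma commute_of_invariant_form {g B : Matrix (Fin 2) (Fin 2) ℂ} (h : gᵀ * B * g = B)
    (hg : g.det = 1) : (!![0, 1; -1, 0] * B) * g = g * (!![0, 1; -1, 0] * B) := by
  have hJ : !![0, 1; -1, 0] = g * !![0, 1; -1, 0] * gᵀ := by
    rw [Matrix.det_fin_two] at hg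
    ext i j
    fin_cases i <;> fin_cases j <;> simp [Matrix.mul_apply, Fin.sum_univ_two] <;> grind
  calc _ = g * !![0, 1; -1, 0] * (gᵀ * B * g) := by
        nth_rewrite 1 [hJ]; simp only [mul_assoc]
    _ = _ := by rw [h, mul_assoc]

lemma mem_HpqInv {n p q : ℕ} {S : Set (Matrix.unitaryGroup (Fin n) ℂ)}
    {f : MvPolynomial (Var n) ℂ} :
    f ∈ HpqInv n p q S ↔ (f ∈ weightedHomogeneousSubmodule ℂ (bidegWt n) (p, q) ∧
      kohnLap n f = 0) ∧ ∀ g ∈ S, uAct n g f = f := by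
  simp [HpqInv, Hpq, Submodule.mem_iInf, sub_eq_zero]

lemma bilinPoly_mem_HpqInv_iff (G : Subgroup (Matrix.unitaryGroup (Fin 2) ℂ))
    (M : Matrix (Fin 2) (Fin 2) ℂ) :
    bilinPoly Sum.inr Sum.inl M ∈ HpqInv 2 1 1 (G : Set (Matrix.unitaryGroup (Fin 2) ℂ)) ↔
      M.trace = 0 ∧ ∀ g ∈ G, M * (g : Matrix (Fin 2) (Fin 2) ℂ) = g * M := by
  have hdeg : bilinPoly Sum.inr Sum.inl M ∈
      weightedHomogeneousSubmodule ℂ (bidegWt 2) (1, 1) := by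
    rw [bilinPoly_apply]
    refine Submodule.sum_mem _ fun i _ => Submodule.sum_mem _ fun j _ => ?_
    rw [← MvPolynomial.smul_eq_C_mul]
    refine Submodule.smul_mem _ _ ?_
    exact (isWeightedHomogeneous_X ℂ (bidegWt 2) (Sum.inr i)).mul
      (isWeightedHomogeneous_X ℂ (bidegWt 2) (Sum.inl j))
  rw [mem_HpqInv, kohnLap_bilinPoly_inr_inl, map_eq_zero_iff _ (C_injective _ _)]
  refine and_congr (and_iff_right hdeg) ?_
  simp only [uAct_bilinPoly_inr_inl, bilinPoly_inr_inl_injective.eq_iff,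
    conjTranspose_mul_mul_eq_iff, SetLike.mem_coe]
  exact ⟨fun h g hg => by simpa using h g⁻¹ (inv_mem hg), fun h g hg => h _ (inv_mem hg)⟩

lemma smul_one_eq_zero_of_trace {K : Type*} [Field K] [CharZero K]
    {M : Matrix (Fin 2) (Fin 2) K} (hM : ∃ c : K, M = c • 1) (ht : M.trace = 0) : M = 0 := by
  obtain ⟨c, rfl⟩ := hM
  have : c = 0 := by simpa using ht
  simp [this]

lemma HpqInv_one_one_eq_bot {G : Subgroup (Matrix.unitaryGroup (Fin 2) ℂ)}
    (hG : ¬ ∀ a ∈ G, ∀ b ∈ G, a * b = b * a) :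
    HpqInv 2 1 1 (G : Set (Matrix.unitaryGroup (Fin 2) ℂ)) = ⊥ := by
  rw [eq_bot_iff]
  intro f hf
  obtain ⟨M, rfl⟩ := mem_range_bilinPoly_of_bidegree_one_one (mem_HpqInv.1 hf).1.1
  obtain ⟨ht, hM⟩ := (bilinPoly_mem_HpqInv_iff G M).1 hf
  have : ∃ c : ℂ, M = c • 1 := by
    by_contra hc
    exact hG fun a ha b hb =>
      Subtype.ext (commute_of_commute_nonscalar hc (hM a ha) (hM b hb))
  rw [smul_one_eq_zero_of_trace this ht]
  simp

open scoped ComplexOrder in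
lemma HpqInv_zero_two_eq_bot {G : Subgroup (Matrix.unitaryGroup (Fin 2) ℂ)}
    (hfree : actsFreely (G : Set (Matrix.unitaryGroup (Fin 2) ℂ)))
    (hG : ¬ ∀ a ∈ G, ∀ b ∈ G, a * b = b * a) :
    HpqInv 2 0 2 (G : Set (Matrix.unitaryGroup (Fin 2) ℂ)) = ⊥ := by
  have scalar (M : Matrix (Fin 2) (Fin 2) ℂ)
      (hM : ∀ g ∈ G, M * (g : Matrix (Fin 2) (Fin 2) ℂ) = g * M) : ∃ c : ℂ, M = c • 1 := by
    by_contra hc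
    exact hG fun a ha b hb =>
      Subtype.ext (commute_of_commute_nonscalar hc (hM a ha) (hM b hb))
  rw [eq_bot_iff]
  intro f hf
  obtain ⟨A, hA, rfl⟩ := exists_isSymm_of_bidegree_zero_two (mem_HpqInv.1 hf).1.1
  have hinv := (mem_HpqInv.1 hf).2
  set B : Matrix (Fin 2) (Fin 2) ℂ := Aᴴ
  have hBsymm : B.IsSymm := hA.conjTranspose
  have hB (g) (hg : g ∈ G) : (g : Matrix (Fin 2) (Fin 2) ℂ)ᵀ * B * g = B := by
    have h := hinv g⁻¹ (inv_mem hg)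
    rw [uAct_bilinPoly_inr_inr, inv_inv] at h
    have h' := eq_of_bilinPoly_inr_inr_eq ?_ hA h
    · have := congrArg Matrix.conjTranspose h'
      rw [Matrix.conjTranspose_mul, Matrix.conjTranspose_mul, Matrix.conjTranspose_conjTranspose,
        ← mul_assoc] at this
      have hs : ((g : Matrix (Fin 2) (Fin 2) ℂ).map star)ᴴ =
          (g : Matrix (Fin 2) (Fin 2) ℂ)ᵀ := by
        ext i j
        simp
      rwa [hs] at this
    · have : ((g : Matrix (Fin 2) (Fin 2) ℂ)ᴴ)ᵀ = (g : Matrix (Fin 2) (Fin 2) ℂ).map star := rfl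
      rw [Matrix.IsSymm, Matrix.transpose_mul, Matrix.transpose_mul, hA.eq, this, ← mul_assoc]
      rfl
  have hsc : ∃ c : ℂ, Bᴴ * B = c • 1 := by
    refine scalar _ fun g hg => ?_
    rw [← conjTranspose_mul_mul_eq_iff]
    have hu : (g : Matrix (Fin 2) (Fin 2) ℂ)ᴴ * g = 1 := Matrix.UnitaryGroup.star_mul_self g
    have hu' := mul_eq_one_comm.1 hu
    have hu'' : ((g : Matrix (Fin 2) (Fin 2) ℂ)ᵀ)ᴴ * (g : Matrix (Fin 2) (Fin 2) ℂ)ᵀ = 1 := by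
      have := congrArg Matrix.transpose hu'
      rwa [Matrix.transpose_mul, Matrix.transpose_one] at this
    have hBg := hB g hg
    set a : Matrix (Fin 2) (Fin 2) ℂ := (g : Matrix (Fin 2) (Fin 2) ℂ)
    calc aᴴ * (Bᴴ * B) * a = aᴴ * Bᴴ * ((aᵀ)ᴴ * aᵀ) * B * a := by
          rw [hu'', mul_one]; simp only [mul_assoc]
      _ = (aᵀ * B * a)ᴴ * (aᵀ * B * a) := by
          simp only [Matrix.conjTranspose_mul, mul_assoc]
      _ = Bᴴ * B := by rw [hBg]
  have hB0 : B = 0 := by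
    obtain ⟨c, hc⟩ := hsc
    by_cases hc0 : c = 0
    · rw [hc0, zero_smul] at hc
      exact Matrix.conjTranspose_mul_self_eq_zero.1 hc
    have hdet : B.det ≠ 0 := by
      intro h0
      have := congrArg Matrix.det hc
      rw [Matrix.det_mul, h0, mul_zero] at this
      exact hc0 (by simpa using this.symm)
    have hJ : !![0, 1; -1, 0] * B = 0 := by
      refine smul_one_eq_zero_of_trace (scalar _ fun g hg => ?_) ?_
      · exact commute_of_invariant_form (hB g hg) (det_eq_one_of_invariant_form hdet (hB g hg)
          fun h => congrArg Subtype.val (hfree g hg h))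
      · have := hBsymm.apply 0 1
        rw [Matrix.trace_fin_two, Matrix.mul_apply, Matrix.mul_apply]
        simp [Fin.sum_univ_two, this]
    have := congrArg Matrix.det hJ
    rw [Matrix.det_mul] at this
    simp [Matrix.det_fin_two_of, hdet] at this
  rw [Matrix.conjTranspose_eq_zero.1 hB0]
  simp

lemma one_le_dimHpqInv_one_one {G : Subgroup (Matrix.unitaryGroup (Fin 2) ℂ)}
    (hG : ∀ a ∈ G, ∀ b ∈ G, a * b = b * a) :
    1 ≤ dimHpqInv 2 1 1 (G : Set (Matrix.unitaryGroup (Fin 2) ℂ)) := by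
  have hM : ∃ M : Matrix (Fin 2) (Fin 2) ℂ, M ≠ 0 ∧ M.trace = 0 ∧
      ∀ g ∈ G, M * (g : Matrix (Fin 2) (Fin 2) ℂ) = g * M := by
    by_cases hs : ∀ g ∈ G, ∃ c : ℂ, (g : Matrix (Fin 2) (Fin 2) ℂ) = c • 1
    · refine ⟨!![1, 0; 0, -1], fun h => by simpa using congrFun₂ h 0 0,
        by simp [Matrix.trace_fin_two], fun g hg => ?_⟩
      obtain ⟨c, hc⟩ := hs g hg
      simp [hc]
    · push Not at hs
      obtain ⟨a, ha, hna⟩ := hs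
      refine ⟨a - ((a : Matrix (Fin 2) (Fin 2) ℂ).trace / 2) • 1, sub_ne_zero.2 (hna _), ?_,
        fun g hg => ?_⟩
      · simp [Matrix.trace_sub]
      · have := congrArg Subtype.val (hG a ha g hg)
        simp [sub_mul, mul_sub] at this ⊢
        exact this
  obtain ⟨M, hM0, hM⟩ := hM
  have hle : HpqInv 2 1 1 (G : Set (Matrix.unitaryGroup (Fin 2) ℂ)) ≤
      LinearMap.range (bilinPoly Sum.inr Sum.inl) := fun f hf =>
    mem_range_bilinPoly_of_bidegree_one_one (mem_HpqInv.1 hf).1.1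
  have := Submodule.finiteDimensional_of_le hle
  rw [dimHpqInv, Submodule.one_le_finrank_iff]
  intro hbot
  have hmem := (bilinPoly_mem_HpqInv_iff G M).2 hM
  rw [hbot, Submodule.mem_bot, map_eq_zero_iff _ bilinPoly_inr_inl_injective] at hmem
  exact hM0 hmem

/-- The multiplicity of the eigenvalue 4 of the Kohn Laplacian detects abelianness. -/
theorem multiplicity_four (G : Subgroup (Matrix.unitaryGroup (Fin 2) ℂ))
    (hGfin : Finite G) (hGfree : actsFreely (G : Set (Matrix.unitaryGroup (Fin 2) ℂ))) :
    ((¬ ∀ a ∈ G, ∀ b ∈ G, a * b = b * a) →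
      dimHpqInv 2 1 1 (G : Set _) = 0 ∧ dimHpqInv 2 0 2 (G : Set _) = 0) ∧
    ((∀ a ∈ G, ∀ b ∈ G, a * b = b * a) → 1 ≤ dimHpqInv 2 1 1 (G : Set _)) ∧
    ((¬ ∀ a ∈ G, ∀ b ∈ G, a * b = b * a) →
      dimHpqInv 2 1 1 (G : Set _) + dimHpqInv 2 0 2 (G : Set _) = 0) ∧
    ((∀ a ∈ G, ∀ b ∈ G, a * b = b * a) →
      0 < dimHpqInv 2 1 1 (G : Set _) + dimHpqInv 2 0 2 (G : Set _)) := by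
  have h0 : (¬ ∀ a ∈ G, ∀ b ∈ G, a * b = b * a) →
      dimHpqInv 2 1 1 (G : Set _) = 0 ∧ dimHpqInv 2 0 2 (G : Set _) = 0 := fun hG => by
    rw [dimHpqInv, dimHpqInv, HpqInv_one_one_eq_bot hG, HpqInv_zero_two_eq_bot hGfree hG]
    simp
  refine ⟨h0, one_le_dimHpqInv_one_one, fun hG => ?_, fun hG => ?_⟩
  · rw [(h0 hG).1, (h0 hG).2]
  · exact Nat.add_pos_left (one_le_dimHpqInv_one_one hG) _
end
end

section
/- Let n ≥ 2, let G ⊆ U(n) be a finite subgroup acting freely on S^{2n−1}, and let s be a real number. Then the set of real numbers { (1 + (p+q)(p+q+2n−2))^{s/2} / (2q(p+n−1)) : p ≥ 0, q ≥ 1 natural numbers with H_{p,q}^G ≠ {0} } is bounded above if and only if s ≤ 1. (Equivalently, the complex Green's operator for the Kohn Laplacian on G\S^{2n−1} maps H^t boundedly to H^{s+t} if and only if s ≤ 1.) -/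
noncomputable section

open MvPolynomial Matrix Complex Real Filter

/-- The antiholomorphic linear form `g · z̄ᵢ`. -/
def conjForm (n : ℕ) (i : Fin n) (g : Matrix.unitaryGroup (Fin n) ℂ) :
    MvPolynomial (Var n) ℂ :=
  uAct n g (X (Sum.inr i))

theorem conjForm_eq (n : ℕ) (i : Fin n) (g : Matrix.unitaryGroup (Fin n) ℂ) :
    conjForm n i g = ∑ j : Fin n,
      MvPolynomial.C ((starRingEnd ℂ) ((g⁻¹ : Matrix.unitaryGroup (Fin n) ℂ) i j)) *
        X (Sum.inr j) := by
  simp [conjForm, uAct]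

theorem uAct_conjForm (n : ℕ) (i : Fin n) (g h : Matrix.unitaryGroup (Fin n) ℂ) :
    uAct n h (conjForm n i g) = conjForm n i (h * g) := by
  have hX : ∀ j, uAct n h (X (Sum.inr j)) = conjForm n j h := fun _ => rfl
  have hC : ∀ c : ℂ, uAct n h (MvPolynomial.C c) = MvPolynomial.C c := fun c =>
    (uAct n h).commutes c
  rw [conjForm_eq, map_sum]
  simp only [map_mul, hX, hC]
  have hmul : ∀ k, ((h * g)⁻¹ : Matrix.unitaryGroup (Fin n) ℂ) i k =
      ∑ j, (g⁻¹ : Matrix.unitaryGroup (Fin n) ℂ) i j *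
        (h⁻¹ : Matrix.unitaryGroup (Fin n) ℂ) j k := fun k => by
    rw [_root_.mul_inv_rev]
    exact Matrix.mul_apply
  simp only [conjForm_eq, Finset.mul_sum, hmul, map_sum, map_mul, Finset.sum_mul]
  rw [Finset.sum_comm]
  simp only [mul_assoc]

theorem conjForm_one (n : ℕ) (i : Fin n) : conjForm n i 1 = X (Sum.inr i) := by
  rw [conjForm_eq, Finset.sum_eq_single i]
  · simp
  · intro j _ hj
    simp [Matrix.one_apply_ne hj.symm]
  · simp

theorem conjForm_ne_zero (n : ℕ) (i : Fin n) (g : Matrix.unitaryGroup (Fin n) ℂ) :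
    conjForm n i g ≠ 0 := by
  intro h
  have h' := uAct_conjForm n i g g⁻¹
  rw [h, map_zero, inv_mul_cancel, conjForm_one] at h'
  exact X_ne_zero _ h'.symm

theorem conjForm_isWeightedHomogeneous (n : ℕ) (i : Fin n)
    (g : Matrix.unitaryGroup (Fin n) ℂ) :
    IsWeightedHomogeneous (bidegWt n) (conjForm n i g) (0, 1) := by
  rw [conjForm_eq]
  refine IsWeightedHomogeneous.sum _ _ _ fun j _ => ?_
  simpa [bidegWt] using (isWeightedHomogeneous_C (bidegWt n) _).mul
    (isWeightedHomogeneous_X ℂ (bidegWt n) (Sum.inr j))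

theorem pderiv_inl_conjForm (n : ℕ) (i k : Fin n) (g : Matrix.unitaryGroup (Fin n) ℂ) :
    pderiv (Sum.inl k) (conjForm n i g) = 0 := by
  rw [conjForm_eq, map_sum]
  refine Finset.sum_eq_zero fun j _ => ?_
  rw [pderiv_C_mul, pderiv_X_of_ne (by simp), mul_zero]

theorem pderiv_comm {σ R : Type*} [CommRing R] (i j : σ) (f : MvPolynomial σ R) :
    pderiv i (pderiv j f) = pderiv j (pderiv i f) := by
  classical
  have h : ⁅pderiv (R := R) i, pderiv (R := R) j⁆ = 0 := by
    refine MvPolynomial.derivation_ext fun k => ?_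
    simp [Derivation.commutator_apply, pderiv_X, Pi.single_apply, apply_ite]
  have h' := DFunLike.congr_fun h f
  rwa [Derivation.commutator_apply, Derivation.zero_apply, sub_eq_zero] at h'

theorem kohnLap_eq_zero {n : ℕ} {f : MvPolynomial (Var n) ℂ}
    (hf : ∀ k, pderiv (Sum.inl k) f = 0) : kohnLap n f = 0 := by
  have hcomm : ∀ k, pderiv (Sum.inl k) (pderiv (Sum.inr k) f) = 0 := fun k => by
    rw [pderiv_comm, hf, map_zero]
  simp [kohnLap, hcomm]

/-- The norm `∏_{g ∈ G} g · z̄ᵢ`, a `G`-invariant antiholomorphic polynomial. -/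
def conjNorm (n : ℕ) (i : Fin n) (G : Subgroup (Matrix.unitaryGroup (Fin n) ℂ)) [Fintype G] :
    MvPolynomial (Var n) ℂ :=
  ∏ g : G, conjForm n i g

theorem uAct_conjNorm (n : ℕ) (i : Fin n) (G : Subgroup (Matrix.unitaryGroup (Fin n) ℂ))
    [Fintype G] (h : G) : uAct n h (conjNorm n i G) = conjNorm n i G := by
  rw [conjNorm, map_prod]
  simp only [uAct_conjForm]
  exact Fintype.prod_equiv (Equiv.mulLeft h) _ _ fun g => by simp

/-- For a finite group `G`, `H_{0,q}^G` is nonzero whenever `q` is a multiple of `|G|`. -/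
theorem HpqInv_zero_mul_card_ne_bot {n : ℕ} (hn : 0 < n)
    (G : Subgroup (Matrix.unitaryGroup (Fin n) ℂ)) [Fintype G] (k : ℕ) :
    HpqInv n 0 (k * Fintype.card G) (G : Set _) ≠ ⊥ := by
  let i : Fin n := ⟨0, hn⟩
  refine (Submodule.ne_bot_iff _).2 ⟨conjNorm n i G ^ k, ⟨⟨?_, ?_⟩, ?_⟩, ?_⟩
  · have h := (IsWeightedHomogeneous.prod Finset.univ (fun g : G => conjForm n i g)
      (fun _ => (0, 1)) fun g _ => conjForm_isWeightedHomogeneous n i g).pow k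
    simpa [conjNorm, mem_weightedHomogeneousSubmodule] using h
  · refine kohnLap_eq_zero fun j => ?_
    have h : pderiv (Sum.inl j) (conjNorm n i G) = 0 := by
      refine Finset.prod_induction _ (fun f => pderiv (Sum.inl j) f = 0) ?_ ?_ ?_
      · intro a b ha hb
        simp [ha, hb]
      · simp
      · exact fun g _ => pderiv_inl_conjForm n i j g
    rw [Derivation.leibniz_pow, h, smul_zero, smul_zero]
  · simp only [SetLike.mem_coe, Submodule.mem_iInf, LinearMap.mem_ker, LinearMap.sub_apply,
      AlgHom.toLinearMap_apply, LinearMap.id_apply, sub_eq_zero, map_pow]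
    intro g hg
    rw [uAct_conjNorm n i G ⟨g, hg⟩]
  · exact pow_ne_zero _ (Finset.prod_ne_zero_iff.2 fun g _ => conjForm_ne_zero n i g)

theorem sobolev_ratio_le_one {n p q : ℕ} (hn : 2 ≤ n) (hq : 1 ≤ q) {s : ℝ} (hs : s ≤ 1) :
    (1 + ((p : ℝ) + q) * ((p : ℝ) + q + 2 * n - 2)) ^ (s / 2) /
        (2 * q * ((p : ℝ) + n - 1)) ≤ 1 := by
  have hn' : (2 : ℝ) ≤ n := by exact_mod_cast hn
  have hq' : (1 : ℝ) ≤ q := by exact_mod_cast hq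
  have hp' : (0 : ℝ) ≤ p := p.cast_nonneg
  have hbase : 1 ≤ 1 + ((p : ℝ) + q) * ((p : ℝ) + q + 2 * n - 2) := by
    have := mul_nonneg (show (0 : ℝ) ≤ p + q by linarith)
      (show (0 : ℝ) ≤ (p : ℝ) + q + 2 * n - 2 by linarith)
    linarith
  rw [div_le_one (by have : (0 : ℝ) < (p : ℝ) + n - 1 := by linarith
                     positivity)]
  calc (1 + ((p : ℝ) + q) * ((p : ℝ) + q + 2 * n - 2)) ^ (s / 2)
      ≤ (1 + ((p : ℝ) + q) * ((p : ℝ) + q + 2 * n - 2)) ^ (1 / 2 : ℝ) :=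
        Real.rpow_le_rpow_of_exponent_le hbase (by linarith)
    _ = √(1 + ((p : ℝ) + q) * ((p : ℝ) + q + 2 * n - 2)) := (Real.sqrt_eq_rpow _).symm
    _ ≤ (p : ℝ) + q + n - 1 := Real.sqrt_le_iff.2 ⟨by linarith, by nlinarith⟩
    _ ≤ 2 * q * ((p : ℝ) + n - 1) := by nlinarith

theorem rpow_sub_one_le_sobolev_ratio {n q : ℕ} (hn : 2 ≤ n) (hq : 1 ≤ q) {s : ℝ} (hs : 0 ≤ s) :
    (q : ℝ) ^ (s - 1) / (2 * ((n : ℝ) - 1)) ≤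
      (1 + (((0 : ℕ) : ℝ) + q) * (((0 : ℕ) : ℝ) + q + 2 * n - 2)) ^ (s / 2) /
        (2 * q * (((0 : ℕ) : ℝ) + n - 1)) := by
  have hn' : (2 : ℝ) ≤ n := by exact_mod_cast hn
  have hq' : (0 : ℝ) < q := by exact_mod_cast hq
  have hpos : (0 : ℝ) < (n : ℝ) - 1 := by linarith
  have hpow : (q : ℝ) ^ s ≤ (1 + (q : ℝ) * ((q : ℝ) + 2 * n - 2)) ^ (s / 2) := by
    calc (q : ℝ) ^ s = ((q : ℝ) ^ 2) ^ (s / 2) := by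
          rw [← Real.rpow_natCast_mul hq'.le]
          congr 1
          push_cast
          ring
      _ ≤ _ := Real.rpow_le_rpow (by positivity) (by nlinarith) (by linarith)
  rw [Real.rpow_sub_one hq'.ne', div_div, Nat.cast_zero, zero_add, zero_add,
    show (q : ℝ) * (2 * ((n : ℝ) - 1)) = 2 * q * ((n : ℝ) - 1) by ring]
  gcongr

/-- Sobolev estimates for the complex Green's operator: the relevant ratio set is
bounded above iff `s ≤ 1`. -/
theorem green_sobolev_iff (n : ℕ) (hn : 2 ≤ n)
    (G : Subgroup (Matrix.unitaryGroup (Fin n) ℂ))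
    (hGfin : Finite G) (hGfree : actsFreely (G : Set (Matrix.unitaryGroup (Fin n) ℂ))) (s : ℝ) :
    BddAbove {x : ℝ | ∃ p q : ℕ, 1 ≤ q ∧ HpqInv n p q (G : Set _) ≠ ⊥ ∧
      x = (1 + ((p : ℝ) + q) * ((p : ℝ) + q + 2 * n - 2)) ^ (s / 2) /
        (2 * q * ((p : ℝ) + n - 1))} ↔ s ≤ 1 := by
  constructor
  · rintro ⟨B, hB⟩
    by_contra! hs
    have := Fintype.ofFinite G
    have hcard : 0 < Fintype.card G := Fintype.card_pos
    have hn' : (2 : ℝ) ≤ n := by exact_mod_cast hn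
    have hlim : Tendsto (fun k : ℕ => ((k * Fintype.card G : ℕ) : ℝ) ^ (s - 1) /
        (2 * ((n : ℝ) - 1))) atTop atTop :=
      ((tendsto_rpow_atTop (by linarith : 0 < s - 1)).comp
        (tendsto_natCast_atTop_atTop.comp
          (tendsto_id.atTop_mul_const' hcard))).atTop_div_const (by linarith)
    obtain ⟨k, hkB, hk⟩ := ((hlim.eventually_gt_atTop B).and (eventually_ge_atTop 1)).exists
    have hq : 1 ≤ k * Fintype.card G := Nat.mul_pos hk hcard
    have hle := hB ⟨0, k * Fintype.card G, hq,
      HpqInv_zero_mul_card_ne_bot (by lia) G k, rfl⟩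
    exact absurd ((rpow_sub_one_le_sobolev_ratio hn hq (by linarith)).trans hle) (not_le.2 hkB)
  · rintro hs
    refine ⟨1, ?_⟩
    rintro x ⟨p, q, hq, -, rfl⟩
    exact sobolev_ratio_le_one hn hq hs
end
end

section
/- Let n ≥ 2 and let G ⊆ U(n) be a finite subgroup, with e(G) the exponent of G (the least common multiple of the orders of its elements). Then there exists M > 0 such that for every integer m ≥ M, dim_ℂ H_{0, m·e(G)}^G ≥ 1. -/
noncomputable section

open MvPolynomial Matrix Complex Real Filter

section LinearSubstitution

variable {K σ : Type*} [Field K] [Fintype σ]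

/-- The linear change of variables `X i ↦ ∑ j, A i j * X j`. -/
def linSubst (A : Matrix σ σ K) : MvPolynomial σ K →ₐ[K] MvPolynomial σ K :=
  aeval fun i => ∑ j, MvPolynomial.C (A i j) * X j

theorem linSubst_linSubst (A B : Matrix σ σ K) (p : MvPolynomial σ K) :
    linSubst A (linSubst B p) = linSubst (B * A) p := by
  rw [← AlgHom.comp_apply]
  congr 1
  ext1 i
  simp only [linSubst, AlgHom.comp_apply, aeval_X, map_sum, map_mul, algHom_C, algebraMap_eq,
    Matrix.mul_apply, Finset.sum_mul, Finset.mul_sum]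
  rw [Finset.sum_comm]
  simp only [mul_assoc]

theorem eval_linSubst (A : Matrix σ σ K) (w : σ → K) (p : MvPolynomial σ K) :
    eval w (linSubst A p) = eval (A *ᵥ w) p := by
  have h : (aeval w).comp (linSubst A) = aeval (A *ᵥ w) := by
    ext i
    simp [linSubst, Matrix.mulVec, dotProduct]
  exact DFunLike.congr_fun h p

theorem MvPolynomial.IsHomogeneous.linSubst {p : MvPolynomial σ K} {k : ℕ}
    (hp : p.IsHomogeneous k) (A : Matrix σ σ K) : (linSubst A p).IsHomogeneous k := by
  simpa [_root_.linSubst] using hp.aeval (n := 1) (fun i => ∑ j, MvPolynomial.C (A i j) * X j)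
    fun i => IsHomogeneous.sum _ _ _ fun j _ => isHomogeneous_C_mul_X _ _

theorem MvPolynomial.IsHomogeneous.eval_smul {p : MvPolynomial σ K} {k : ℕ}
    (hp : p.IsHomogeneous k) (c : K) (v : σ → K) : eval (c • v) p = c ^ k * eval v p := by
  rw [eval_eq', eval_eq', Finset.mul_sum]
  refine Finset.sum_congr rfl fun d hd => ?_
  have hdeg : ∑ i, d i = k := by
    rw [← Finsupp.degree_eq_sum, Finsupp.degree_eq_weight_one]
    exact hp (mem_support_iff.mp hd)
  simp only [Pi.smul_apply, smul_eq_mul, mul_pow, Finset.prod_mul_distrib,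
    Finset.prod_pow_eq_pow_sum, hdeg]
  ring

variable [DecidableEq σ]

theorem exists_isHomogeneous_one_eval {u v : σ → K} (hv : v ∉ Submodule.span K {u}) :
    ∃ p : MvPolynomial σ K, p.IsHomogeneous 1 ∧ eval u p = 0 ∧ eval v p ≠ 0 := by
  obtain ⟨f, hfv, hfu⟩ := Submodule.exists_le_ker_of_notMem hv
  have key (w : σ → K) :
      eval w (∑ i, MvPolynomial.C (f (Pi.single i 1)) * X i) = f w := by
    conv_rhs => rw [← LinearMap.sum_single_apply (fun _ => K) w, map_sum]
    simp only [map_sum, map_mul, eval_C, eval_X]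
    refine Finset.sum_congr rfl fun i _ => ?_
    rw [mul_comm, ← smul_eq_mul, ← map_smul, ← Pi.single_smul, smul_eq_mul, mul_one]
  refine ⟨_, IsHomogeneous.sum _ _ _ fun i _ => isHomogeneous_C_mul_X _ _, ?_, by rwa [key]⟩
  rw [key]
  exact hfu (Submodule.mem_span_singleton_self u)

/-- A vector which is an eigenvector only of the scalar matrices in a finite family. -/
theorem exists_ne_zero_forall_mulVec_eq_smul [Infinite K] [Nonempty σ] {ι : Type*} [Finite ι]
    (A : ι → Matrix σ σ K) :
    ∃ v : σ → K, v ≠ 0 ∧ ∀ i (c : K), A i *ᵥ v = c • v → A i = c • 1 := by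
  let I := {x : Σ i, Module.End.Eigenvalues (Matrix.toLin' (A i)) //
    Module.End.eigenspace (Matrix.toLin' (A x.1)) (x.2 : K) ≠ ⊤}
  let p : Option I → Submodule K (σ → K) := fun o =>
    o.elim ⊥ fun x => Module.End.eigenspace (Matrix.toLin' (A x.1.1)) (x.1.2 : K)
  obtain ⟨v, hv⟩ := Submodule.exists_forall_notMem_of_forall_ne_top p (by
    rintro (_ | x)
    · exact bot_ne_top
    · exact x.2)
  have hv0 : v ≠ 0 := hv none
  refine ⟨v, hv0, fun i c h => ?_⟩
  have hmem : v ∈ Module.End.eigenspace (Matrix.toLin' (A i)) c := by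
    simpa [Module.End.mem_eigenspace_iff] using h
  have hc : Module.End.HasEigenvalue (Matrix.toLin' (A i)) c :=
    Module.End.hasEigenvalue_of_hasEigenvector ⟨hmem, hv0⟩
  have htop : Module.End.eigenspace (Matrix.toLin' (A i)) c = ⊤ := by
    by_contra htop
    exact hv (some ⟨⟨i, c, hc⟩, htop⟩) hmem
  apply Matrix.toLin'.injective
  ext1 j
  ext1
  have := Module.End.mem_eigenspace_iff.mp (htop ▸ Submodule.mem_top (x := Pi.single j (1 : K)))
  simp [this]

theorem exists_isHomogeneous_linSubst_eq [CharZero K] [Nonempty σ] {G : Type*} [Group G]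
    [Finite G] (ρ : G →* Matrix σ σ K) {k : ℕ} (hk : Nat.card G ≤ k)
    (he : Monoid.exponent G ∣ k) :
    ∃ p : MvPolynomial σ K, p.IsHomogeneous k ∧ p ≠ 0 ∧ ∀ g, linSubst (ρ g) p = p := by
  classical
  have := Fintype.ofFinite G
  obtain ⟨v, hv0, hv⟩ := exists_ne_zero_forall_mulVec_eq_smul fun g => ρ g
  have hform (g : G) : ∃ l : MvPolynomial σ K, l.IsHomogeneous 1 ∧ eval v l ≠ 0 ∧
      ((∀ c : K, ρ g ≠ c • 1) → eval (ρ g *ᵥ v) l = 0) := by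
    by_cases hg : ∃ c : K, ρ g = c • 1
    · obtain ⟨l, hl, -, hlv⟩ := exists_isHomogeneous_one_eval (u := 0) (v := v) (by simpa)
      exact ⟨l, hl, hlv, fun h => (hg.elim h).elim⟩
    · obtain ⟨l, hl, hlu, hlv⟩ := exists_isHomogeneous_one_eval (u := ρ g *ᵥ v) (v := v) (by
        rw [Submodule.mem_span_singleton]
        rintro ⟨a, ha⟩
        have ha0 : a ≠ 0 := by
          rintro rfl
          exact hv0 (by simpa using ha.symm)
        exact hg ⟨a⁻¹, hv g _ (by rw [eq_inv_smul_iff₀ ha0, ha])⟩)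
      exact ⟨l, hl, hlv, fun _ => hlu⟩
  choose l hl hlv hlu using hform
  set f := (∏ g, l g) * l 1 ^ (k - Nat.card G) with hf
  have hfhom : f.IsHomogeneous k := by
    have h := (IsHomogeneous.prod Finset.univ l (fun _ => 1) fun g _ => hl g).mul
      ((hl 1).pow (k - Nat.card G))
    have hdeg : ∑ _g : G, 1 + 1 * (k - Nat.card G) = k := by
      rw [Finset.sum_const, Finset.card_univ, ← Nat.card_eq_fintype_card, smul_eq_mul, mul_one,
        one_mul, Nat.add_sub_cancel' hk]
    rwa [hdeg] at h
  have hfv : eval v f ≠ 0 := by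
    simp [hf, Finset.prod_eq_zero_iff, hlv]
  have hfg (g : G) :
      eval (ρ g *ᵥ v) f = if ∃ c : K, ρ g = c • 1 then eval v f else 0 := by
    split_ifs with hg
    · obtain ⟨c, hc⟩ := hg
      have hpow : ρ g ^ k = 1 := by
        rw [← map_pow, Monoid.exponent_dvd_iff_forall_pow_eq_one.mp he, map_one]
      have hck : c ^ k = 1 := by
        obtain ⟨i⟩ := ‹Nonempty σ›
        simpa [hc, smul_pow] using congr_fun₂ hpow i i
      rw [hc, smul_mulVec, one_mulVec, hfhom.eval_smul, hck, one_mul]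
    · push Not at hg
      rw [hf, map_mul, map_prod, Finset.prod_eq_zero (Finset.mem_univ g) (hlu g hg), zero_mul]
  refine ⟨∑ g, linSubst (ρ g) f, IsHomogeneous.sum _ _ _ fun g _ => hfhom.linSubst _, ?_, ?_⟩
  · intro h0
    have h := congr_arg (eval v) h0
    simp only [map_sum, eval_linSubst, hfg, ← Finset.sum_filter, Finset.sum_const, map_zero,
      smul_eq_zero, hfv, or_false, Finset.card_eq_zero] at h
    exact Finset.notMem_empty (1 : G) (h ▸ by simpa using ⟨1, (one_smul K _).symm⟩)
  · intro g
    simp only [map_sum, linSubst_linSubst, ← map_mul]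
    exact Fintype.sum_equiv (Equiv.mulRight g) _ _ fun _ => rfl

end LinearSubstitution

theorem weight_bidegWt_fst_add_snd {n : ℕ} (d : Var n →₀ ℕ) :
    (Finsupp.weight (bidegWt n) d).1 + (Finsupp.weight (bidegWt n) d).2 = d.degree := by
  induction d using Finsupp.induction_linear with
  | zero => simp
  | add f g hf hg => simp only [map_add, Prod.fst_add, Prod.snd_add, ← hf, ← hg]; ring
  | single i a => cases i <;> simp [bidegWt, Finsupp.weight_single]

theorem weight_bidegWt_mapDomain_inr {n : ℕ} (d : Fin n →₀ ℕ) :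
    Finsupp.weight (bidegWt n) (d.mapDomain Sum.inr) = (0, d.degree) := by
  induction d using Finsupp.induction_linear with
  | zero => rfl
  | add f g hf hg => simp [Finsupp.mapDomain_add, map_add, hf, hg]
  | single i a => simp [bidegWt, Finsupp.weight_single]

instance finiteDimensional_Hpq (n p q : ℕ) : FiniteDimensional ℂ (Hpq n p q) := by
  refine Submodule.finiteDimensional_of_le (S₂ := restrictTotalDegree (Var n) ℂ (p + q)) ?_
  rintro f ⟨hf, -⟩
  rw [mem_restrictTotalDegree, totalDegree, Finset.sup_le_iff]
  intro d hd
  have h := hf (mem_support_iff.mp hd)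
  have h' := weight_bidegWt_fst_add_snd d
  rw [h] at h'
  exact h'.ge

theorem rename_inr_mem_Hpq {n k : ℕ} {f : MvPolynomial (Fin n) ℂ} (hf : f.IsHomogeneous k) :
    rename Sum.inr f ∈ Hpq n 0 k := by
  classical
  refine ⟨fun d hd => ?_, ?_⟩
  · obtain ⟨u, rfl, hu⟩ := coeff_rename_ne_zero _ _ _ hd
    rw [weight_bidegWt_mapDomain_inr, Finsupp.degree_eq_weight_one]
    exact congr_arg _ (hf hu)
  · rw [SetLike.mem_coe, LinearMap.mem_ker]
    simp only [kohnLap, LinearMap.sum_apply, LinearMap.comp_apply, Derivation.coeFn_coe]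
    refine Finset.sum_eq_zero fun i _ => ?_
    rw [pderiv_rename Sum.inr_injective]
    refine pderiv_eq_zero_of_notMem_vars fun hi => ?_
    simpa using vars_rename _ _ hi

theorem uAct_rename_inr {n : ℕ} (g : Matrix.unitaryGroup (Fin n) ℂ)
    (f : MvPolynomial (Fin n) ℂ) :
    uAct n g (rename Sum.inr f) =
      rename Sum.inr (linSubst ((starRingEnd ℂ).mapMatrix ↑(g⁻¹)) f) := by
  have h : (uAct n g).comp (rename Sum.inr) =
      (rename Sum.inr).comp (linSubst ((starRingEnd ℂ).mapMatrix ↑(g⁻¹))) := by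
    ext1 i
    simp [uAct, linSubst]
  exact DFunLike.congr_fun h f

theorem exists_invariant_high_degree (n : ℕ) (hn : 2 ≤ n)
    (G : Subgroup (Matrix.unitaryGroup (Fin n) ℂ)) (hGfin : Finite G) :
    ∃ M : ℕ, 0 < M ∧ ∀ m : ℕ, M ≤ m →
      1 ≤ dimHpqInv n 0 (m * Monoid.exponent G) (G : Set _) := by
  refine ⟨Nat.card G, Nat.card_pos, fun m hm => ?_⟩
  have : Nonempty (Fin n) := ⟨⟨0, by lia⟩⟩
  let ρ : G →* Matrix (Fin n) (Fin n) ℂ :=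
    ((starRingEnd ℂ).mapMatrix : Matrix (Fin n) (Fin n) ℂ →+* _).toMonoidHom.comp
      ((Matrix.unitaryGroup (Fin n) ℂ).subtype.comp G.subtype)
  obtain ⟨f, hf, hf0, hinv⟩ := exists_isHomogeneous_linSubst_eq ρ
    (hm.trans (Nat.le_mul_of_pos_right m Monoid.ExponentExists.of_finite.exponent_pos))
    (dvd_mul_left _ _)
  have : FiniteDimensional ℂ (HpqInv n 0 (m * Monoid.exponent G) (G : Set _)) :=
    Submodule.finiteDimensional_inf_left _ _
  have hmem : rename Sum.inr f ∈ HpqInv n 0 (m * Monoid.exponent G) (G : Set _) := by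
    refine ⟨rename_inr_mem_Hpq hf, ?_⟩
    simp only [SetLike.mem_coe, Submodule.mem_iInf, LinearMap.mem_ker, LinearMap.sub_apply,
      AlgHom.toLinearMap_apply, LinearMap.id_apply, sub_eq_zero]
    intro g hg
    rw [uAct_rename_inr]
    exact congr_arg _ (hinv ⟨g, hg⟩⁻¹)
  rw [dimHpqInv, Nat.one_le_iff_ne_zero, ← Nat.pos_iff_ne_zero, Module.finrank_pos_iff_exists_ne_zero]
  refine ⟨⟨_, hmem⟩, fun h => hf0 ?_⟩
  exact rename_injective _ Sum.inr_injective (by simpa using congr_arg Subtype.val h)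
end
end
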